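/- There exist absolute constants c, C > 0 such that if σ ≤ c·(σ_min(A)/κ⁴)·√n/(√d·(√(nd)+√m+√(2γ n log n))), then with probability at least 1 − C·n^{−γ+1} the spectral initialization S⁰ satisfies: (i) min_{Q∈O(d)} max_{1≤i≤n} ‖S_i⁰ − Q‖ ≤ 120κ²σ(√(nd)+√m+√(2γ n log n))/(√n·σ_min(A)); (ii) d_F(S⁰, Z) ≤ ε√(nd)/2; (iii) d_F(S⁰, S^{i,0}) ≤ ε√d for all 1 ≤ i ≤ n; and (iv) max_{1≤i≤n} ‖W_i W^T S⁰‖_F ≤ (ξ/2)√d(√(nd)+√m+√(2γ n log n))², where ε = 1/(32κ²√d) and ξ = 6. -/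

import Mathlib

open MeasureTheory Matrix Filter

namespace GOPP

/-- Frobenius norm of a real matrix. -/
noncomputable def frob {α β : Type*} [Fintype α] [Fintype β] (X : Matrix α β ℝ) : ℝ :=
  Real.sqrt (∑ i, ∑ j, X i j ^ 2)

/-- Euclidean norm of a vector. -/
noncomputable def vnorm {β : Type*} [Fintype β] (v : β → ℝ) : ℝ :=
  Real.sqrt (∑ j, v j ^ 2)

/-- Operator (spectral) norm: the supremum of ‖Xu‖ over unit vectors u. -/
noncomputable def opNorm {α β : Type*} [Fintype α] [Fintype β] (X : Matrix α β ℝ) : ℝ :=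
  sSup {r : ℝ | ∃ u : β → ℝ, vnorm u = 1 ∧ r = vnorm (X.mulVec u)}

/-- Smallest singular value: the infimum of ‖uᵀX‖ over unit vectors u (for a d×m matrix
with d ≤ m this is the d-th largest singular value; for square matrices it is σ_min). -/
noncomputable def sigmaMin {α β : Type*} [Fintype α] [Fintype β] (X : Matrix α β ℝ) : ℝ :=
  sInf {r : ℝ | ∃ u : α → ℝ, vnorm u = 1 ∧ r = vnorm (Matrix.vecMul u X)}

/-- Condition number κ = σ_max/σ_min. -/
noncomputable def kappa {d m : ℕ} (A : Matrix (Fin d) (Fin m) ℝ) : ℝ :=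
  opNorm A / sigmaMin A

/-- Q is an orthogonal matrix. -/
def IsOrth {d : ℕ} (Q : Matrix (Fin d) (Fin d) ℝ) : Prop :=
  Qᵀ * Q = 1 ∧ Q * Qᵀ = 1

/-- Nuclear norm, via the dual characterization ‖M‖_* = max_{Q ∈ O(d)} ⟨Q, M⟩. -/
noncomputable def nuclearNorm {d : ℕ} (M : Matrix (Fin d) (Fin d) ℝ) : ℝ :=
  sSup {r : ℝ | ∃ Q : Matrix (Fin d) (Fin d) ℝ, IsOrth Q ∧ r = Matrix.trace (Qᵀ * M)}

/-- The i-th d×k block of an (nd)×k block matrix. -/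
def blk {n d k : ℕ} (S : Matrix (Fin n × Fin d) (Fin k) ℝ) (i : Fin n) :
    Matrix (Fin d) (Fin k) ℝ :=
  Matrix.of fun a b => S (i, a) b

/-- The i-th diagonal d×d block of an (nd)×(nd) matrix. -/
def dblk {n d : ℕ} (G : Matrix (Fin n × Fin d) (Fin n × Fin d) ℝ) (i : Fin n) :
    Matrix (Fin d) (Fin d) ℝ :=
  Matrix.of fun a b => G (i, a) (i, b)

/-- S ∈ O(d)^{⊗n}: each of the n d×d blocks of S is orthogonal. -/
def OrthBlocks {n d : ℕ} (S : Matrix (Fin n × Fin d) (Fin d) ℝ) : Prop :=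
  ∀ i, IsOrth (blk S i)

/-- Z ∈ ℝ^{nd×d}: the vertical stack of n copies of I_d. -/
def ZStack (n d : ℕ) : Matrix (Fin n × Fin d) (Fin d) ℝ :=
  Matrix.of fun p j => if p.2 = j then 1 else 0

/-- Vertical stack of n given d×k matrices. -/
def stack {n d k : ℕ} (B : Fin n → Matrix (Fin d) (Fin k) ℝ) :
    Matrix (Fin n × Fin d) (Fin k) ℝ :=
  Matrix.of fun p b => B p.1 p.2 b

/-- d_F(X,Y) = min_{Q ∈ O(d)} ‖X − YQ‖_F. -/
noncomputable def dF {n d : ℕ} (X Y : Matrix (Fin n × Fin d) (Fin d) ℝ) : ℝ :=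
  sInf {r : ℝ | ∃ Q, IsOrth Q ∧ r = frob (X - Y * Q)}

/-- R is a polar factor P(X) of X: an orthogonal global minimizer of ‖X − Q‖_F over O(d). -/
def IsPolar {d : ℕ} (X R : Matrix (Fin d) (Fin d) ℝ) : Prop :=
  IsOrth R ∧ ∀ Q : Matrix (Fin d) (Fin d) ℝ, IsOrth Q → frob (X - R) ≤ frob (X - Q)

/-- S = P_n(X): blockwise polar factor. -/
def IsPolarBlocks {n d : ℕ} (X S : Matrix (Fin n × Fin d) (Fin d) ℝ) : Prop :=
  ∀ i, IsPolar (blk X i) (blk S i)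

/-- U collects (an orthonormal basis of the span of) the top d left singular vectors of D:
U has orthonormal columns and maximizes the Ky Fan quantity trace(Uᵀ(DDᵀ)U). -/
def IsTopSingVecs {N : Type*} [Fintype N] {d m : ℕ} (D : Matrix N (Fin m) ℝ)
    (U : Matrix N (Fin d) ℝ) : Prop :=
  Uᵀ * U = 1 ∧ ∀ Q : Matrix N (Fin d) ℝ, Qᵀ * Q = 1 →
    Matrix.trace (Qᵀ * (D * Dᵀ) * Q) ≤ Matrix.trace (Uᵀ * (D * Dᵀ) * U)

/-- (U, S, V) is a top-d singular triple of D: orthonormal U, V, diagonal nonnegative S,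
DV = US, DᵀU = VS, and U spans a top-d left singular subspace. -/
def IsSVDTriple {N : Type*} [Fintype N] {d m : ℕ} (D : Matrix N (Fin m) ℝ)
    (U : Matrix N (Fin d) ℝ) (S : Matrix (Fin d) (Fin d) ℝ)
    (V : Matrix (Fin m) (Fin d) ℝ) : Prop :=
  Vᵀ * V = 1 ∧ (∀ a b, a ≠ b → S a b = 0) ∧ (∀ a, 0 ≤ S a a) ∧
    D * V = U * S ∧ Dᵀ * U = V * S ∧ IsTopSingVecs D U

/-- The generalized power method sequence with spectral initialization, run on the data
matrix D (so with C = DDᵀ): S⁰ = P_n(U) for top singular vectors U of D, and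
S^{t+1} = P_n(C Sᵗ). -/
def IsGPM {n d m : ℕ} (D : Matrix (Fin n × Fin d) (Fin m) ℝ)
    (S : ℕ → Matrix (Fin n × Fin d) (Fin d) ℝ) : Prop :=
  (∃ U, IsTopSingVecs D U ∧ IsPolarBlocks U (S 0)) ∧
    ∀ t, IsPolarBlocks (D * Dᵀ * S t) (S (t + 1))

/-- W^(i): W with its i-th block row replaced by 0. -/
def mask {n d m : ℕ} (W : Matrix (Fin n × Fin d) (Fin m) ℝ) (i : Fin n) :
    Matrix (Fin n × Fin d) (Fin m) ℝ :=
  Matrix.of fun p b => if p.1 = i then 0 else W p b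

/-- The noise matrix Δ = WAᵀZᵀ + ZAWᵀ + σWWᵀ. -/
noncomputable def delta {n d m : ℕ} (A : Matrix (Fin d) (Fin m) ℝ)
    (W : Matrix (Fin n × Fin d) (Fin m) ℝ) (σ : ℝ) :
    Matrix (Fin n × Fin d) (Fin n × Fin d) ℝ :=
  W * Aᵀ * (ZStack n d)ᵀ + ZStack n d * A * Wᵀ + σ • (W * Wᵀ)

/-- The i-th block column Δ_i = WAᵀ + ZAW_iᵀ + σWW_iᵀ of Δ. -/
noncomputable def deltaCol {n d m : ℕ} (A : Matrix (Fin d) (Fin m) ℝ)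
    (W : Matrix (Fin n × Fin d) (Fin m) ℝ) (σ : ℝ) (i : Fin n) :
    Matrix (Fin n × Fin d) (Fin d) ℝ :=
  W * Aᵀ + ZStack n d * A * (blk W i)ᵀ + σ • (W * (blk W i)ᵀ)

/-- The operator L S = C S/(n‖A‖²) with C = ZAAᵀZᵀ + σΔ. -/
noncomputable def Lop {n d m : ℕ} (A : Matrix (Fin d) (Fin m) ℝ)
    (W : Matrix (Fin n × Fin d) (Fin m) ℝ) (σ : ℝ)
    (S : Matrix (Fin n × Fin d) (Fin d) ℝ) : Matrix (Fin n × Fin d) (Fin d) ℝ :=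
  ((n : ℝ) * opNorm A ^ 2)⁻¹ •
    ((ZStack n d * A * Aᵀ * (ZStack n d)ᵀ + σ • delta A W σ) * S)

/-- √(nd) + √m + √(2γ n log n). -/
noncomputable def bnd1 (n d m : ℕ) (γ : ℝ) : ℝ :=
  Real.sqrt ((n : ℝ) * d) + Real.sqrt (m : ℝ) + Real.sqrt (2 * γ * n * Real.log n)

/-- √(nd) + √m + √(2γ log n). -/
noncomputable def bnd2 (n d m : ℕ) (γ : ℝ) : ℝ :=
  Real.sqrt ((n : ℝ) * d) + Real.sqrt (m : ℝ) + Real.sqrt (2 * γ * Real.log n)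

/-- The basin of attraction N_ε. -/
def memNeps {n d : ℕ} (ε : ℝ) (S : Matrix (Fin n × Fin d) (Fin d) ℝ) : Prop :=
  OrthBlocks S ∧ dF S (ZStack n d) ≤ ε * Real.sqrt ((n : ℝ) * d)

/-- The basin of attraction N_{ξ,∞}. -/
def memNxi {n d m : ℕ} (W : Matrix (Fin n × Fin d) (Fin m) ℝ) (γ ξ : ℝ)
    (S : Matrix (Fin n × Fin d) (Fin d) ℝ) : Prop :=
  OrthBlocks S ∧ ∀ i, frob (blk W i * Wᵀ * S) ≤ ξ * Real.sqrt (d : ℝ) * bnd1 n d m γ ^ 2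

/-- The distribution of a matrix with i.i.d. standard Gaussian N(0,1) entries. -/
noncomputable def stdGaussian (ι κ : Type*) [Fintype ι] [Fintype κ] :
    Measure (ι → κ → ℝ) :=
  Measure.pi fun _ : ι => Measure.pi fun _ : κ => ProbabilityTheory.gaussianReal 0 1

set_option linter.unusedSectionVars false

section LinearAlgebra
open scoped Matrix.Norms.L2Operator

variable {α β δ : Type*} [Fintype α] [Fintype β] [Fintype δ]

lemma vnorm_eq_norm (v : β → ℝ) : vnorm v = ‖WithLp.toLp 2 v‖ := by
  simp [vnorm, EuclideanSpace.norm_eq]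

lemma vnorm_nonneg (v : β → ℝ) : 0 ≤ vnorm v := Real.sqrt_nonneg _

lemma vnorm_sq (v : β → ℝ) : vnorm v ^ 2 = v ⬝ᵥ v := by
  rw [vnorm, Real.sq_sqrt (Finset.sum_nonneg fun _ _ => sq_nonneg _)]
  simp [dotProduct, sq]

lemma vnorm_add_le (v w : β → ℝ) : vnorm (v + w) ≤ vnorm v + vnorm w := by
  simpa [vnorm_eq_norm] using norm_add_le (WithLp.toLp 2 v) (WithLp.toLp 2 w)

lemma vnorm_sub_le (v w : β → ℝ) : vnorm (v - w) ≤ vnorm v + vnorm w := by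
  simpa [vnorm_eq_norm] using norm_sub_le (WithLp.toLp 2 v) (WithLp.toLp 2 w)

lemma vnorm_smul (c : ℝ) (v : β → ℝ) : vnorm (c • v) = |c| * vnorm v := by
  simp [vnorm_eq_norm, norm_smul]

lemma vnorm_neg (v : β → ℝ) : vnorm (-v) = vnorm v := by
  simp [vnorm_eq_norm]

lemma vnorm_eq_zero {v : β → ℝ} : vnorm v = 0 ↔ v = 0 := by
  simp [vnorm_eq_norm]

lemma abs_dotProduct_le (v w : β → ℝ) : |v ⬝ᵥ w| ≤ vnorm v * vnorm w := by
  have := abs_real_inner_le_norm (WithLp.toLp 2 v) (WithLp.toLp 2 w)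
  rw [vnorm_eq_norm, vnorm_eq_norm]
  simpa [EuclideanSpace.inner_eq_star_dotProduct, dotProduct_comm] using this

lemma dotProduct_le (v w : β → ℝ) : v ⬝ᵥ w ≤ vnorm v * vnorm w :=
  (le_abs_self _).trans (abs_dotProduct_le v w)

lemma exists_unit_smul {v : β → ℝ} (hv : v ≠ 0) :
    ∃ u, vnorm u = 1 ∧ v = vnorm v • u := by
  have h0 : vnorm v ≠ 0 := fun h => hv (vnorm_eq_zero.1 h)
  refine ⟨(vnorm v)⁻¹ • v, ?_, ?_⟩
  · rw [vnorm_smul, abs_of_nonneg (inv_nonneg.2 (vnorm_nonneg v)), inv_mul_cancel₀ h0]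
  · rw [smul_smul, mul_inv_cancel₀ h0, one_smul]

section OperatorNorm
variable [DecidableEq β] [DecidableEq α] [DecidableEq δ]

lemma vnorm_mulVec_le (X : Matrix α β ℝ) (v : β → ℝ) : vnorm (X *ᵥ v) ≤ ‖X‖ * vnorm v := by
  rw [vnorm_eq_norm, vnorm_eq_norm]
  exact l2_opNorm_mulVec X (WithLp.toLp 2 v)

lemma norm_le_of_vnorm_mulVec_le {X : Matrix α β ℝ} {r : ℝ} (hr : 0 ≤ r)
    (h : ∀ v, vnorm (X *ᵥ v) ≤ r * vnorm v) : ‖X‖ ≤ r := by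
  rw [l2_opNorm_def]
  refine ContinuousLinearMap.opNorm_le_bound _ hr fun x => ?_
  have := h x.ofLp
  rw [vnorm_eq_norm, vnorm_eq_norm] at this
  exact this

lemma norm_transpose (X : Matrix α β ℝ) : ‖Xᵀ‖ = ‖X‖ := by
  rw [← conjTranspose_eq_transpose_of_trivial, l2_opNorm_conjTranspose]

lemma opNorm_bddAbove (X : Matrix α β ℝ) :
    BddAbove {r : ℝ | ∃ u : β → ℝ, vnorm u = 1 ∧ r = vnorm (X.mulVec u)} := by
  refine ⟨‖X‖, ?_⟩
  rintro r ⟨u, hu, rfl⟩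
  simpa [hu] using vnorm_mulVec_le X u

lemma opNorm_eq_norm (X : Matrix α β ℝ) : opNorm X = ‖X‖ := by
  have h0 : 0 ≤ opNorm X := Real.sSup_nonneg (by rintro r ⟨u, -, rfl⟩; exact vnorm_nonneg _)
  refine le_antisymm (Real.sSup_le ?_ (norm_nonneg _)) (norm_le_of_vnorm_mulVec_le h0 fun v => ?_)
  · rintro r ⟨u, hu, rfl⟩
    simpa [hu] using vnorm_mulVec_le X u
  · by_cases hv : v = 0
    · simp [hv, vnorm_eq_zero.2]
    obtain ⟨u, hu, hvu⟩ := exists_unit_smul hv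
    rw [hvu, mulVec_smul, vnorm_smul, vnorm_smul, hu, mul_one, mul_comm]
    exact mul_le_mul_of_nonneg_right (le_csSup (opNorm_bddAbove X) ⟨u, hu, rfl⟩) (abs_nonneg _)

lemma sigmaMin_mul_vnorm_le (X : Matrix α β ℝ) (v : α → ℝ) :
    sigmaMin X * vnorm v ≤ vnorm (Xᵀ *ᵥ v) := by
  by_cases hv : v = 0
  · simp [hv, vnorm_eq_zero.2]
  obtain ⟨u, hu, hvu⟩ := exists_unit_smul hv
  rw [hvu, mulVec_smul, vnorm_smul, vnorm_smul, hu, mul_one, mul_comm]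
  refine mul_le_mul_of_nonneg_left (csInf_le ⟨0, ?_⟩ ⟨u, hu, ?_⟩) (abs_nonneg _)
  · rintro r ⟨u, -, rfl⟩; exact vnorm_nonneg _
  · rw [mulVec_transpose]

end OperatorNorm

lemma frob_nonneg (X : Matrix α β ℝ) : 0 ≤ frob X := Real.sqrt_nonneg _

lemma frob_sq (X : Matrix α β ℝ) : frob X ^ 2 = ∑ i, ∑ j, X i j ^ 2 :=
  Real.sq_sqrt (Finset.sum_nonneg fun _ _ => Finset.sum_nonneg fun _ _ => sq_nonneg _)

lemma frob_eq_norm (X : Matrix α β ℝ) :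
    frob X = ‖WithLp.toLp 2 (fun p : α × β => X p.1 p.2)‖ := by
  simp [frob, EuclideanSpace.norm_eq, Fintype.sum_prod_type]

lemma frob_add_le (X Y : Matrix α β ℝ) : frob (X + Y) ≤ frob X + frob Y := by
  simp only [frob_eq_norm]
  exact norm_add_le (WithLp.toLp 2 (fun p : α × β => X p.1 p.2)) (WithLp.toLp 2 _)

lemma frob_smul (c : ℝ) (X : Matrix α β ℝ) : frob (c • X) = |c| * frob X := by
  simp only [frob_eq_norm]
  exact norm_smul c (WithLp.toLp 2 (fun p : α × β => X p.1 p.2))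

lemma frob_neg (X : Matrix α β ℝ) : frob (-X) = frob X := by simp [frob]

lemma frob_sub_le (X Y : Matrix α β ℝ) : frob (X - Y) ≤ frob X + frob Y := by
  rw [sub_eq_add_neg, ← frob_neg Y]; exact frob_add_le _ _

lemma frob_transpose (X : Matrix α β ℝ) : frob Xᵀ = frob X := by
  simp only [frob, transpose_apply]; rw [Finset.sum_comm]

lemma frob_sq_rows (X : Matrix α β ℝ) : frob X ^ 2 = ∑ i, vnorm (X i) ^ 2 := by
  simp only [frob_sq, vnorm_sq, dotProduct, ← sq]

lemma frob_sq_cols (X : Matrix α β ℝ) : frob X ^ 2 = ∑ j, vnorm (Xᵀ j) ^ 2 := by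
  rw [← frob_transpose, frob_sq_rows]

lemma frob_sq_trace (X : Matrix α β ℝ) : frob X ^ 2 = trace (Xᵀ * X) := by
  rw [frob_sq_cols]
  simp only [vnorm_sq, trace, diag_apply, mul_apply, dotProduct, transpose_apply]

lemma trace_transpose_mul_le (X Y : Matrix α β ℝ) : trace (Xᵀ * Y) ≤ frob X * frob Y := by
  have := real_inner_le_norm (WithLp.toLp 2 (fun p : α × β => X p.1 p.2))
    (WithLp.toLp 2 (fun p : α × β => Y p.1 p.2))
  rw [← frob_eq_norm, ← frob_eq_norm] at this
  refine le_trans (le_of_eq ?_) this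
  simp only [trace, diag_apply, mul_apply, transpose_apply, PiLp.inner_apply,
    Fintype.sum_prod_type]
  rw [Finset.sum_comm]
  simp [mul_comm]

section FrobeniusOperator
variable [DecidableEq β] [DecidableEq α] [DecidableEq δ]

lemma frob_mul_le (X : Matrix α β ℝ) (Y : Matrix β δ ℝ) : frob (X * Y) ≤ ‖X‖ * frob Y := by
  refine le_of_sq_le_sq ?_ (mul_nonneg (norm_nonneg _) (frob_nonneg _))
  rw [mul_pow, frob_sq_cols, frob_sq_cols, Finset.mul_sum]
  refine Finset.sum_le_sum fun j _ => ?_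
  rw [← mul_pow]
  refine pow_le_pow_left₀ (vnorm_nonneg _) ?_ 2
  exact vnorm_mulVec_le X (Yᵀ j)

lemma frob_mul_le' (X : Matrix α β ℝ) (Y : Matrix β δ ℝ) : frob (X * Y) ≤ frob X * ‖Y‖ := by
  rw [← frob_transpose, transpose_mul, ← frob_transpose X, mul_comm, ← norm_transpose Y]
  exact frob_mul_le _ _

lemma norm_le_frob (X : Matrix α β ℝ) : ‖X‖ ≤ frob X := by
  refine norm_le_of_vnorm_mulVec_le (frob_nonneg _) fun v => ?_
  refine le_of_sq_le_sq ?_ (mul_nonneg (frob_nonneg _) (vnorm_nonneg _))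
  rw [mul_pow, frob_sq_rows, Finset.sum_mul, vnorm_sq]
  refine Finset.sum_le_sum fun i _ => ?_
  rw [← sq, ← mul_pow]
  exact sq_le_sq.2 ((abs_dotProduct_le _ _).trans (le_abs_self _))

lemma frob_le_sqrt_mul_norm (X : Matrix α β ℝ) :
    frob X ≤ √(Fintype.card β) * ‖X‖ := by
  refine le_of_sq_le_sq ?_ (by positivity)
  rw [mul_pow, Real.sq_sqrt (by positivity), frob_sq_cols, ← nsmul_eq_mul]
  refine Finset.sum_le_card_nsmul _ _ _ fun j _ => ?_
  refine pow_le_pow_left₀ (vnorm_nonneg _) ?_ 2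
  have h := vnorm_mulVec_le X (Pi.single j 1)
  have h1 : vnorm (Pi.single j (1 : ℝ)) = 1 := by
    rw [← sq_eq_sq₀ (vnorm_nonneg _) zero_le_one, vnorm_sq]; simp
  rw [h1, mul_one, mulVec_single_one] at h
  exact h

end FrobeniusOperator
end LinearAlgebra

section Polar
open scoped Matrix.Norms.L2Operator

variable {N δ : Type*} [Fintype N] [DecidableEq N] [Fintype δ] {n d m k : ℕ}

lemma vnorm_mulVec_of_isometry [DecidableEq δ] {U : Matrix N δ ℝ} (hU : Uᵀ * U = 1) (v : δ → ℝ) :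
    vnorm (U *ᵥ v) = vnorm v := by
  rw [← sq_eq_sq₀ (vnorm_nonneg _) (vnorm_nonneg _), vnorm_sq, vnorm_sq, dotProduct_mulVec,
    vecMul_mulVec, ← dotProduct_mulVec, hU, one_mulVec]

lemma norm_le_one_of_isometry {U : Matrix N (Fin d) ℝ} (hU : Uᵀ * U = 1) : ‖U‖ ≤ 1 :=
  norm_le_of_vnorm_mulVec_le zero_le_one fun v => by rw [vnorm_mulVec_of_isometry hU, one_mul]

lemma frob_mul_of_isometry {U : Matrix N (Fin d) ℝ} (hU : Uᵀ * U = 1)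
    (X : Matrix (Fin d) δ ℝ) : frob (U * X) = frob X := by
  rw [← sq_eq_sq₀ (frob_nonneg _) (frob_nonneg _), frob_sq_trace, frob_sq_trace, transpose_mul,
    Matrix.mul_assoc, ← Matrix.mul_assoc Uᵀ, hU, Matrix.one_mul]

lemma frob_sq_of_isometry {U : Matrix N (Fin d) ℝ} (hU : Uᵀ * U = 1) : frob U ^ 2 = d := by
  rw [frob_sq_trace, hU, trace_one, Fintype.card_fin]

namespace IsOrth
variable {Q R : Matrix (Fin d) (Fin d) ℝ}

lemma transpose (hQ : IsOrth Q) : IsOrth Qᵀ := by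
  simpa [IsOrth] using hQ.symm

lemma mul (hQ : IsOrth Q) (hR : IsOrth R) : IsOrth (Q * R) := by
  constructor
  · rw [transpose_mul, Matrix.mul_assoc, ← Matrix.mul_assoc Qᵀ, hQ.1, Matrix.one_mul, hR.1]
  · rw [transpose_mul, Matrix.mul_assoc, ← Matrix.mul_assoc R, hR.2, Matrix.one_mul, hQ.2]

lemma one : IsOrth (1 : Matrix (Fin d) (Fin d) ℝ) := by simp [IsOrth]

lemma norm_le_one (hQ : IsOrth Q) : ‖Q‖ ≤ 1 := norm_le_one_of_isometry hQ.1

lemma norm_mul_right (hQ : IsOrth Q) (X : Matrix N (Fin d) ℝ) : ‖X * Q‖ = ‖X‖ := by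
  refine le_antisymm ?_ ?_
  · exact (l2_opNorm_mul _ _).trans (mul_le_of_le_one_right (norm_nonneg _) hQ.norm_le_one)
  · calc ‖X‖ = ‖X * Q * Qᵀ‖ := by rw [Matrix.mul_assoc, hQ.2, Matrix.mul_one]
      _ ≤ ‖X * Q‖ := (l2_opNorm_mul _ _).trans
          (mul_le_of_le_one_right (norm_nonneg _) hQ.transpose.norm_le_one)

lemma frob_mul_right (hQ : IsOrth Q) (X : Matrix N (Fin d) ℝ) : frob (X * Q) = frob X := by
  rw [← frob_transpose, transpose_mul, frob_mul_of_isometry hQ.transpose.1, frob_transpose]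

end IsOrth

lemma isOrth_reflection {v : Fin d → ℝ} (hv : v ⬝ᵥ v ≠ 0) :
    IsOrth (1 - (2 / (v ⬝ᵥ v)) • vecMulVec v v) := by
  have h : (1 - (2 / (v ⬝ᵥ v)) • vecMulVec v v) * (1 - (2 / (v ⬝ᵥ v)) • vecMulVec v v) = 1 := by
    rw [Matrix.sub_mul, Matrix.mul_sub, Matrix.mul_sub, Matrix.one_mul, Matrix.one_mul,
      Matrix.mul_one, smul_mul_smul_comm, vecMulVec_mul_vecMulVec]
    ext i j
    simp [vecMulVec_apply]
    field_simp
    ring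
  have ht : (1 - (2 / (v ⬝ᵥ v)) • vecMulVec v v)ᵀ = 1 - (2 / (v ⬝ᵥ v)) • vecMulVec v v := by
    simp [transpose_vecMulVec]
  exact ⟨by rw [ht, h], by rw [ht, h]⟩

lemma frob_sub_sq (X Q : Matrix (Fin d) (Fin d) ℝ) (hQ : IsOrth Q) :
    frob (X - Q) ^ 2 = frob X ^ 2 - 2 * trace (Xᵀ * Q) + d := by
  rw [frob_sq_trace, frob_sq_trace, transpose_sub, Matrix.sub_mul, Matrix.mul_sub, Matrix.mul_sub,
    hQ.1, trace_sub, trace_sub, trace_sub, trace_one, Fintype.card_fin]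
  have : trace (Qᵀ * X) = trace (Xᵀ * Q) := by
    rw [← trace_transpose, transpose_mul, transpose_transpose]
  rw [this]; ring

lemma isPolar_iff {X S : Matrix (Fin d) (Fin d) ℝ} :
    IsPolar X S ↔ IsOrth S ∧ ∀ Q, IsOrth Q → trace (Xᵀ * Q) ≤ trace (Xᵀ * S) := by
  refine and_congr_right fun hS => forall₂_congr fun Q hQ => ?_
  rw [← sq_le_sq₀ (frob_nonneg _) (frob_nonneg _), frob_sub_sq _ _ hS, frob_sub_sq _ _ hQ]
  constructor <;> intro h <;> linarith

lemma isClosed_isOrth : IsClosed {Q : Matrix (Fin d) (Fin d) ℝ | IsOrth Q} := by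
  refine (isClosed_eq ?_ ?_).inter (isClosed_eq ?_ ?_) <;> fun_prop

lemma isCompact_isometry : IsCompact {U : Matrix N (Fin d) ℝ | Uᵀ * U = 1} := by
  refine Metric.isCompact_of_isClosed_isBounded (isClosed_eq (by fun_prop) (by fun_prop)) ?_
  exact (Metric.isBounded_closedBall (x := (0 : Matrix N (Fin d) ℝ)) (r := 1)).subset fun U hU => by
    simpa using norm_le_one_of_isometry hU

lemma exists_isPolar (X : Matrix (Fin d) (Fin d) ℝ) : ∃ S, IsPolar X S := by
  have hc : IsCompact {Q : Matrix (Fin d) (Fin d) ℝ | IsOrth Q} :=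
    isCompact_isometry.of_isClosed_subset isClosed_isOrth fun Q hQ => hQ.1
  obtain ⟨S, hS, hmax⟩ := hc.exists_isMaxOn ⟨1, IsOrth.one⟩
    (f := fun Q => trace (Xᵀ * Q)) (by fun_prop)
  exact ⟨S, isPolar_iff.2 ⟨hS, fun Q hQ => hmax hQ⟩⟩

lemma IsPolar.smul {X S : Matrix (Fin d) (Fin d) ℝ} (h : IsPolar X S) {c : ℝ} (hc : 0 ≤ c) :
    IsPolar (c • X) S := by
  rw [isPolar_iff] at h ⊢
  refine ⟨h.1, fun Q hQ => ?_⟩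
  simpa using mul_le_mul_of_nonneg_left (h.2 Q hQ) hc

lemma IsPolar.mul_right {X S O : Matrix (Fin d) (Fin d) ℝ} (h : IsPolar X S) (hO : IsOrth O) :
    IsPolar (X * O) (S * O) := by
  rw [isPolar_iff] at h ⊢
  refine ⟨h.1.mul hO, fun Q hQ => ?_⟩
  have := h.2 (Q * Oᵀ) (hQ.mul hO.transpose)
  rw [← Matrix.mul_assoc, trace_mul_comm, ← Matrix.mul_assoc, ← transpose_mul] at this
  refine this.trans (le_of_eq ?_)
  rw [transpose_mul, Matrix.mul_assoc, trace_mul_comm Oᵀ, Matrix.mul_assoc, Matrix.mul_assoc,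
    hO.2, Matrix.mul_one]

section MaximalTrace
variable {Y : Matrix (Fin d) (Fin d) ℝ} (hY : ∀ R, IsOrth R → trace (Y * R) ≤ trace Y)
include hY

lemma dotProduct_mulVec_nonneg_of_trace_le (v : Fin d → ℝ) : 0 ≤ v ⬝ᵥ Y *ᵥ v := by
  by_cases hv : v = 0
  · simp [hv]
  have hv0 : 0 < v ⬝ᵥ v := by
    rw [← vnorm_sq]; exact pow_pos ((vnorm_nonneg _).lt_of_ne' (mt vnorm_eq_zero.1 hv)) 2
  have h := hY _ (isOrth_reflection hv0.ne')
  rw [Matrix.mul_sub, Matrix.mul_one, Matrix.mul_smul, mul_vecMulVec, trace_sub, trace_smul,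
    trace_vecMulVec, smul_eq_mul, dotProduct_comm (Y *ᵥ v)] at h
  have : 0 ≤ 2 / (v ⬝ᵥ v) * (v ⬝ᵥ Y *ᵥ v) := by linarith
  exact nonneg_of_mul_nonneg_right this (by positivity)

lemma reflection_pair_le {u v : Fin d → ℝ} (hu : 0 < u ⬝ᵥ u) (hv : 0 < v ⬝ᵥ v) :
    2 * (u ⬝ᵥ v) * (v ⬝ᵥ Y *ᵥ u) ≤ (v ⬝ᵥ v) * (u ⬝ᵥ Y *ᵥ u) + (u ⬝ᵥ u) * (v ⬝ᵥ Y *ᵥ v) := by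
  have h := hY _ ((isOrth_reflection hu.ne').mul (isOrth_reflection hv.ne'))
  simp only [Matrix.mul_sub, Matrix.mul_one, Matrix.mul_smul, mul_vecMulVec, trace_sub, trace_smul,
    trace_vecMulVec, sub_mulVec, one_mulVec, smul_mulVec, vecMulVec_mulVec, mulVec_sub,
    mulVec_smul, op_smul_eq_smul, sub_dotProduct, smul_dotProduct, smul_eq_mul] at h
  rw [dotProduct_comm (Y *ᵥ v), dotProduct_comm (Y *ᵥ u), dotProduct_comm (Y *ᵥ u)] at h
  generalize u ⬝ᵥ Y *ᵥ u = a at *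
  generalize v ⬝ᵥ Y *ᵥ v = b at *
  generalize v ⬝ᵥ Y *ᵥ u = e at *
  have h2 : 2 / (u ⬝ᵥ u) * (2 / (v ⬝ᵥ v)) * (u ⬝ᵥ v * e)
      ≤ 2 / (u ⬝ᵥ u) * a + 2 / (v ⬝ᵥ v) * b := by linarith
  have h3 := mul_le_mul_of_nonneg_left h2 (by positivity : 0 ≤ (u ⬝ᵥ u) * (v ⬝ᵥ v) / 2)
  field_simp at h3
  linarith

lemma isSymm_of_trace_le : Yᵀ = Y := by
  ext i j
  rw [transpose_apply]
  by_cases hij : i = j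
  · rw [hij]
  have hpsd := dotProduct_mulVec_nonneg_of_trace_le hY
  have hi := hpsd (Pi.single i 1)
  have hj := hpsd (Pi.single j 1)
  simp only [mulVec_single_one, single_one_dotProduct, col_apply] at hi hj
  have key : ∀ τ : ℝ, τ * (Y j i - Y i j) ≤ τ ^ 2 * (Y i i + Y j j) := by
    intro τ
    have h := reflection_pair_le hY (u := Pi.single i 1) (v := Pi.single i 1 + τ • Pi.single j 1)
      (by simp) (by
        simp [dotProduct_add, hij, Ne.symm hij]
        nlinarith [sq_nonneg τ])
    simp [add_dotProduct, dotProduct_add, hij, Ne.symm hij, mulVec_add, mulVec_smul] at h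
    nlinarith
  have h := key ((Y j i - Y i j) / (Y i i + Y j j + 1))
  have hp : 0 < Y i i + Y j j + 1 := by linarith
  rw [div_pow, div_mul_eq_mul_div, div_mul_eq_mul_div, div_le_div_iff₀ hp (by positivity)] at h
  have h2 : (Y j i - Y i j) ^ 2 * (Y i i + Y j j + 1) ≤ 0 := by
    have := le_of_mul_le_mul_right (a := Y i i + Y j j + 1)
      (b := (Y j i - Y i j) ^ 2 * (Y i i + Y j j + 1))
      (c := (Y j i - Y i j) ^ 2 * (Y i i + Y j j)) (by nlinarith) hp
    nlinarith
  have h3 : (Y j i - Y i j) ^ 2 = 0 :=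
    le_antisymm (nonpos_of_mul_nonpos_left h2 hp) (sq_nonneg _)
  linarith [pow_eq_zero_iff (two_ne_zero) |>.1 h3]

end MaximalTrace

namespace IsPolar
variable {X S : Matrix (Fin d) (Fin d) ℝ}

lemma trace_mul_le (h : IsPolar X S) (R : Matrix (Fin d) (Fin d) ℝ) (hR : IsOrth R) :
    trace (Xᵀ * S * R) ≤ trace (Xᵀ * S) := by
  rw [Matrix.mul_assoc]; exact (isPolar_iff.1 h).2 _ (h.1.mul hR)

lemma isSymm (h : IsPolar X S) : (Sᵀ * X)ᵀ = Sᵀ * X := by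
  have := isSymm_of_trace_le h.trace_mul_le
  rw [transpose_mul, transpose_transpose] at this ⊢
  exact this.symm

lemma nonneg (h : IsPolar X S) (v : Fin d → ℝ) : 0 ≤ v ⬝ᵥ (Sᵀ * X) *ᵥ v := by
  rw [← h.isSymm, transpose_mul, transpose_transpose]
  exact dotProduct_mulVec_nonneg_of_trace_le h.trace_mul_le v

lemma mul_eq (h : IsPolar X S) : S * (Sᵀ * X) = X := by
  rw [← Matrix.mul_assoc, h.1.2, Matrix.one_mul]

lemma sq_eq (h : IsPolar X S) : (Sᵀ * X) * (Sᵀ * X) = Xᵀ * X := by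
  nth_rw 1 [← h.isSymm]
  rw [transpose_mul, transpose_transpose, Matrix.mul_assoc, h.mul_eq]

lemma norm_sub (h : IsPolar X S) : ‖X - S‖ = ‖Sᵀ * X - 1‖ := by
  have : X - S = S * (Sᵀ * X - 1) := by rw [Matrix.mul_sub, h.mul_eq, Matrix.mul_one]
  rw [this]
  refine le_antisymm ?_ ?_
  · exact (l2_opNorm_mul _ _).trans (mul_le_of_le_one_left (norm_nonneg _) h.1.norm_le_one)
  · calc ‖Sᵀ * X - 1‖ = ‖Sᵀ * (S * (Sᵀ * X - 1))‖ := by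
          rw [← Matrix.mul_assoc, h.1.1, Matrix.one_mul]
      _ ≤ _ := (l2_opNorm_mul _ _).trans
          (mul_le_of_le_one_left (norm_nonneg _) h.1.transpose.norm_le_one)

lemma norm_sub_le_gram (h : IsPolar X S) : ‖X - S‖ ≤ ‖Xᵀ * X - 1‖ := by
  rw [h.norm_sub]
  refine norm_le_of_vnorm_mulVec_le (norm_nonneg _) fun v => ?_
  refine le_trans ?_ (vnorm_mulVec_le _ _)
  set T := Sᵀ * X
  set w := (T - 1) *ᵥ v
  have e : (Xᵀ * X - 1) *ᵥ v = T *ᵥ w + w := by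
    have : (Xᵀ * X - 1 : Matrix (Fin d) (Fin d) ℝ) = T * (T - 1) + (T - 1) := by
      rw [← h.sq_eq, Matrix.mul_sub, Matrix.mul_one]; abel
    rw [this, add_mulVec, mulVec_mulVec]
  rw [e]
  have h1 : vnorm w ^ 2 ≤ vnorm w * vnorm (T *ᵥ w + w) := by
    refine le_trans ?_ (dotProduct_le _ _)
    rw [dotProduct_add, vnorm_sq]
    linarith [h.nonneg w]
  rcases (vnorm_nonneg w).eq_or_lt with h0 | h0
  · rw [← h0]; exact vnorm_nonneg _
  · rw [sq] at h1; exact le_of_mul_le_mul_left h1 h0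

lemma norm_sub_le (h : IsPolar X S) {Q : Matrix (Fin d) (Fin d) ℝ} (hQ : IsOrth Q) :
    ‖X - S‖ ≤ 2 * ‖X - Q‖ + ‖X - Q‖ ^ 2 := by
  refine h.norm_sub_le_gram.trans ?_
  obtain ⟨F, hF⟩ : ∃ F, F = X - Q := ⟨_, rfl⟩
  rw [← hF]
  have : Xᵀ * X - 1 = Qᵀ * F + Fᵀ * Q + Fᵀ * F := by
    rw [hF]
    rw [transpose_sub, Matrix.mul_sub, Matrix.sub_mul, Matrix.sub_mul, Matrix.mul_sub,
      Matrix.mul_sub, hQ.1]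
    abel
  rw [this]
  have h1 : ‖Qᵀ * F‖ ≤ ‖F‖ := (l2_opNorm_mul _ _).trans
    (mul_le_of_le_one_left (norm_nonneg _) hQ.transpose.norm_le_one)
  have h2 : ‖Fᵀ * Q‖ ≤ ‖F‖ := (hQ.norm_mul_right Fᵀ).trans (norm_transpose F) |>.le
  have h3 : ‖Fᵀ * F‖ ≤ ‖F‖ ^ 2 := by
    have h := l2_opNorm_mul Fᵀ F
    rwa [norm_transpose, ← sq] at h
  have h4 := norm_add_le (Qᵀ * F + Fᵀ * Q) (Fᵀ * F)
  have h5 := norm_add_le (Qᵀ * F) (Fᵀ * Q)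
  linarith only [h1, h2, h3, h4, h5]

lemma quadratic_lower (h : IsPolar X S) (hX : ‖X - S‖ ≤ 1 / 2) (v : Fin d → ℝ) :
    1 / 2 * vnorm v ^ 2 ≤ v ⬝ᵥ (Sᵀ * X) *ᵥ v := by
  rw [h.norm_sub] at hX
  have h1 : v ⬝ᵥ (Sᵀ * X) *ᵥ v = v ⬝ᵥ (Sᵀ * X - 1) *ᵥ v + vnorm v ^ 2 := by
    rw [sub_mulVec, dotProduct_sub, one_mulVec, vnorm_sq]; ring
  have h2 := (abs_le.1 (abs_dotProduct_le v ((Sᵀ * X - 1) *ᵥ v))).1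
  have h3 := vnorm_mulVec_le (Sᵀ * X - 1) v
  have h4 : vnorm v * vnorm ((Sᵀ * X - 1) *ᵥ v) ≤ vnorm v * (1 / 2 * vnorm v) :=
    mul_le_mul_of_nonneg_left (h3.trans (mul_le_mul_of_nonneg_right hX (vnorm_nonneg _)))
      (vnorm_nonneg _)
  nlinarith

end IsPolar

lemma le_trace_conj {T : Matrix (Fin d) (Fin d) ℝ} {c : ℝ}
    (hT : ∀ v, c * vnorm v ^ 2 ≤ v ⬝ᵥ T *ᵥ v) (Δ : Matrix N (Fin d) ℝ) :
    c * frob Δ ^ 2 ≤ trace (Δ * T * Δᵀ) := by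
  rw [frob_sq_rows, Finset.mul_sum, trace]
  refine Finset.sum_le_sum fun i _ => (hT (Δ i)).trans (le_of_eq ?_)
  rw [diag_apply, Matrix.mul_assoc, mul_apply]
  simp only [dotProduct, mulVec, mul_apply, transpose_apply]

lemma trace_conj_sub {S S' T : Matrix (Fin d) (Fin d) ℝ} (hS : IsOrth S) (hS' : IsOrth S')
    (hT : Tᵀ = T) :
    trace ((S - S') * T * (S - S')ᵀ) = 2 * trace T - 2 * trace (S'ᵀ * S * T) := by
  rw [trace_mul_comm, ← Matrix.mul_assoc]
  have : (S - S')ᵀ * (S - S') = 1 + 1 - S'ᵀ * S - Sᵀ * S' := by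
    rw [transpose_sub, Matrix.sub_mul, Matrix.mul_sub, Matrix.mul_sub, hS.1, hS'.1]; abel
  rw [this, Matrix.sub_mul, Matrix.sub_mul, Matrix.add_mul, Matrix.one_mul, trace_sub, trace_sub,
    trace_add]
  have h2 : trace (Sᵀ * S' * T) = trace (S'ᵀ * S * T) := by
    rw [← trace_transpose, transpose_mul, hT, transpose_mul, transpose_transpose, trace_mul_comm]
  rw [h2]; ring

lemma IsPolar.lipschitz {X Y S S' : Matrix (Fin d) (Fin d) ℝ} (h : IsPolar X S)
    (h' : IsPolar Y S') (hX : ‖X - S‖ ≤ 1 / 2) : frob (S - S') ≤ 4 * frob (X - Y) := by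
  have e1 := trace_conj_sub h.1 h'.1 h.isSymm
  have e2 := trace_conj_sub h'.1 h.1 h'.isSymm
  have l1 := le_trace_conj (h.quadratic_lower hX) (S - S')
  have l2 := le_trace_conj (c := 0) (by simpa using h'.nonneg) (S' - S)
  have e3 : trace ((S - S')ᵀ * (X - Y)) = trace (Sᵀ * X) - trace (S'ᵀ * S * (Sᵀ * X))
      + trace (S'ᵀ * Y) - trace (Sᵀ * S' * (S'ᵀ * Y)) := by
    rw [Matrix.mul_assoc S'ᵀ, Matrix.mul_assoc Sᵀ S', h.mul_eq, h'.mul_eq, transpose_sub,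
      Matrix.sub_mul, Matrix.mul_sub, Matrix.mul_sub, trace_sub, trace_sub, trace_sub]
    ring
  have l3 := trace_transpose_mul_le (S - S') (X - Y)
  have h4 : frob (S - S') * frob (S - S') ≤ frob (S - S') * (4 * frob (X - Y)) := by nlinarith
  rcases (frob_nonneg (S - S')).eq_or_lt with h0 | h0
  · rw [← h0]; exact mul_nonneg (by norm_num) (frob_nonneg _)
  · exact le_of_mul_le_mul_left h4 h0

lemma vnorm_mulVec_sq_le {T : Matrix (Fin d) (Fin d) ℝ} (hT : Tᵀ = T)
    (h0 : ∀ v, 0 ≤ v ⬝ᵥ T *ᵥ v) (h1 : ‖T‖ ≤ 1) (v : Fin d → ℝ) :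
    vnorm (T *ᵥ v) ^ 2 ≤ v ⬝ᵥ T *ᵥ v := by
  set w := T *ᵥ v
  have h := h0 (v - w)
  have hvw : v ⬝ᵥ T *ᵥ w = vnorm w ^ 2 := by
    rw [dotProduct_mulVec, ← mulVec_transpose, hT, vnorm_sq]
  have hww : w ⬝ᵥ T *ᵥ w ≤ vnorm w ^ 2 := by
    refine (dotProduct_le _ _).trans ?_
    rw [sq]
    exact mul_le_mul_of_nonneg_left ((vnorm_mulVec_le _ _).trans
      (mul_le_of_le_one_left (vnorm_nonneg _) h1)) (vnorm_nonneg _)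
  have e : (v - w) ⬝ᵥ T *ᵥ (v - w) =
      v ⬝ᵥ w - v ⬝ᵥ T *ᵥ w - vnorm w ^ 2 + w ⬝ᵥ T *ᵥ w := by
    rw [mulVec_sub, sub_dotProduct, dotProduct_sub, dotProduct_sub, vnorm_sq]; ring
  linarith

lemma frob_sq_le_trace {T : Matrix (Fin d) (Fin d) ℝ} (hT : Tᵀ = T)
    (h0 : ∀ v, 0 ≤ v ⬝ᵥ T *ᵥ v) (h1 : ‖T‖ ≤ 1) : frob T ^ 2 ≤ trace T := by
  rw [frob_sq_cols, trace]
  refine Finset.sum_le_sum fun i _ => ?_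
  have := vnorm_mulVec_sq_le hT h0 h1 (Pi.single i 1)
  rw [mulVec_single_one, single_one_dotProduct] at this
  exact this

/-- Two orthonormal frames can be aligned up to `√2` times the sine of the angle between
their spans. -/
lemma exists_isOrth_frob_sub_sq_le {U V : Matrix N (Fin d) ℝ} (hU : Uᵀ * U = 1)
    (hV : Vᵀ * V = 1) :
    ∃ O : Matrix (Fin d) (Fin d) ℝ, IsOrth O ∧ frob (U - V * O) ^ 2 ≤ 2 * frob (V - U * (Uᵀ * V)) ^ 2 := by
  obtain ⟨O, hO⟩ := exists_isPolar (Vᵀ * U)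
  refine ⟨O, hO.1, ?_⟩
  set T := Oᵀ * (Vᵀ * U) with hT
  have hn : ‖T‖ ≤ 1 := by
    refine (l2_opNorm_mul _ _).trans (mul_le_one₀ hO.1.transpose.norm_le_one (norm_nonneg _) ?_)
    refine (l2_opNorm_mul _ _).trans (mul_le_one₀ ?_ (norm_nonneg _) (norm_le_one_of_isometry hU))
    rw [norm_transpose]; exact norm_le_one_of_isometry hV
  have h1 := frob_sq_le_trace hO.isSymm hO.nonneg hn
  have h2 : frob T = frob (Uᵀ * V) := by
    rw [hT, frob_mul_of_isometry (by rw [transpose_transpose]; exact hO.1.2), ← frob_transpose,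
      transpose_mul, transpose_transpose]
  have h3 : frob (U - V * O) ^ 2 = 2 * d - 2 * trace T := by
    have hVO : (V * O)ᵀ * (V * O) = 1 := by
      rw [transpose_mul, Matrix.mul_assoc, ← Matrix.mul_assoc Vᵀ, hV, Matrix.one_mul, hO.1.1]
    rw [frob_sq_trace, transpose_sub, Matrix.sub_mul, Matrix.mul_sub, Matrix.mul_sub, hU, hVO,
      trace_sub, trace_sub, trace_sub, trace_one, Fintype.card_fin]
    have h4 : trace (Uᵀ * (V * O)) = trace ((V * O)ᵀ * U) := by
      rw [← trace_transpose, transpose_mul, transpose_transpose]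
    rw [h4, transpose_mul, Matrix.mul_assoc]; ring
  have h5 : frob (V - U * (Uᵀ * V)) ^ 2 = d - frob (Uᵀ * V) ^ 2 := by
    have e : (V - U * (Uᵀ * V))ᵀ * (V - U * (Uᵀ * V)) = 1 - (Uᵀ * V)ᵀ * (Uᵀ * V) := by
      have e1 : Uᵀ * (V - U * (Uᵀ * V)) = 0 := by
        rw [Matrix.mul_sub, ← Matrix.mul_assoc Uᵀ U, hU, Matrix.one_mul, sub_self]
      rw [transpose_sub, Matrix.sub_mul, transpose_mul U, Matrix.mul_assoc _ Uᵀ, e1,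
        Matrix.mul_zero, sub_zero, Matrix.mul_sub, hV, transpose_mul, transpose_transpose,
        Matrix.mul_assoc]
    rw [frob_sq_trace, frob_sq_trace, e, trace_sub, trace_one, Fintype.card_fin]
  rw [h3, h5, ← h2]
  linarith

section Blocks

lemma blk_mul (X : Matrix (Fin n × Fin d) (Fin k) ℝ) (Y : Matrix (Fin k) (Fin m) ℝ) (i : Fin n) :
    blk (X * Y) i = blk X i * Y := rfl

lemma blk_sub (X Y : Matrix (Fin n × Fin d) (Fin k) ℝ) (i : Fin n) :
    blk (X - Y) i = blk X i - blk Y i := rfl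

lemma blk_add (X Y : Matrix (Fin n × Fin d) (Fin k) ℝ) (i : Fin n) :
    blk (X + Y) i = blk X i + blk Y i := rfl

lemma blk_smul (c : ℝ) (X : Matrix (Fin n × Fin d) (Fin k) ℝ) (i : Fin n) :
    blk (c • X) i = c • blk X i := rfl

lemma frob_sq_blk (X : Matrix (Fin n × Fin d) (Fin k) ℝ) :
    frob X ^ 2 = ∑ i, frob (blk X i) ^ 2 := by
  simp only [frob_sq, Fintype.sum_prod_type, blk, of_apply]

lemma frob_blk_le (X : Matrix (Fin n × Fin d) (Fin k) ℝ) (i : Fin n) :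
    frob (blk X i) ≤ frob X := by
  refine le_of_sq_le_sq ?_ (frob_nonneg _)
  rw [frob_sq_blk X]
  exact Finset.single_le_sum (f := fun i => frob (blk X i) ^ 2) (fun _ _ => sq_nonneg _)
    (Finset.mem_univ i)

lemma vnorm_blk_mulVec_le (X : Matrix (Fin n × Fin d) (Fin k) ℝ) (i : Fin n) (v : Fin k → ℝ) :
    vnorm (blk X i *ᵥ v) ≤ vnorm (X *ᵥ v) := by
  refine le_of_sq_le_sq ?_ (vnorm_nonneg _)
  rw [vnorm_sq, vnorm_sq, dotProduct, dotProduct, Fintype.sum_prod_type]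
  exact Finset.single_le_sum (f := fun i => ∑ a, (X *ᵥ v) (i, a) * (X *ᵥ v) (i, a))
    (fun _ _ => Finset.sum_nonneg fun _ _ => mul_self_nonneg _) (Finset.mem_univ i)

lemma norm_blk_le (X : Matrix (Fin n × Fin d) (Fin k) ℝ) (i : Fin n) : ‖blk X i‖ ≤ ‖X‖ :=
  norm_le_of_vnorm_mulVec_le (norm_nonneg _) fun v =>
    (vnorm_blk_mulVec_le X i v).trans (vnorm_mulVec_le X v)

end Blocks
end Polar

section TopSubspace
open scoped Matrix.Norms.L2Operator

variable {N : Type*} [Fintype N] [DecidableEq N] {d m : ℕ}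
  {D : Matrix N (Fin m) ℝ} {U : Matrix N (Fin d) ℝ}

lemma vnorm_add_sq (v w : N → ℝ) :
    vnorm (v + w) ^ 2 = vnorm v ^ 2 + 2 * (v ⬝ᵥ w) + vnorm w ^ 2 := by
  simp only [vnorm_sq, add_dotProduct, dotProduct_add, dotProduct_comm w v]; ring

lemma vnorm_smul_sq (c : ℝ) (v : N → ℝ) : vnorm (c • v) ^ 2 = c ^ 2 * vnorm v ^ 2 := by
  rw [vnorm_smul, mul_pow, sq_abs]

lemma vnorm_pos {v : N → ℝ} (hv : v ≠ 0) : 0 < vnorm v :=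
  (vnorm_nonneg v).lt_of_ne' (mt vnorm_eq_zero.1 hv)

lemma trace_mul_transpose_conj (D : Matrix N (Fin m) ℝ) (Q : Matrix N (Fin d) ℝ) :
    trace (Qᵀ * (D * Dᵀ) * Q) = frob (Dᵀ * Q) ^ 2 := by
  rw [frob_sq_trace, transpose_mul, transpose_transpose]
  simp only [Matrix.mul_assoc]

lemma frob_sq_add_vecMulVec {k : ℕ} (X : Matrix (Fin k) (Fin d) ℝ) (x : Fin k → ℝ)
    (a : Fin d → ℝ) :
    frob (X + vecMulVec x a) ^ 2
      = frob X ^ 2 + 2 * ((X *ᵥ a) ⬝ᵥ x) + vnorm x ^ 2 * vnorm a ^ 2 := by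
  rw [frob_sq_trace, frob_sq_trace, transpose_add, transpose_vecMulVec, Matrix.add_mul,
    Matrix.mul_add, Matrix.mul_add, mul_vecMulVec, vecMulVec_mul_vecMulVec, vecMulVec_mul,
    trace_add, trace_add, trace_add, trace_vecMulVec, trace_vecMulVec, trace_vecMulVec,
    vnorm_sq, vnorm_sq, dotProduct_smul, smul_eq_mul]
  have h1 : (Xᵀ *ᵥ x) ⬝ᵥ a = (X *ᵥ a) ⬝ᵥ x := by
    rw [mulVec_transpose, ← dotProduct_mulVec, dotProduct_comm]
  have h2 : a ⬝ᵥ (x ᵥ* X) = (X *ᵥ a) ⬝ᵥ x := by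
    rw [dotProduct_comm, ← dotProduct_mulVec, dotProduct_comm]
  rw [h1, h2]; ring

namespace IsTopSingVecs

lemma swap (h : IsTopSingVecs D U) {a : Fin d → ℝ} {x : N → ℝ} {ρ : ℝ}
    (hx : vnorm x ^ 2 = vnorm a ^ 2) (hUx : Uᵀ *ᵥ x = ρ • a) :
    vnorm (Dᵀ *ᵥ x) ^ 2 ≤ vnorm (Dᵀ *ᵥ (U *ᵥ a)) ^ 2 := by
  by_cases ha : a = 0
  · have : x = 0 := by
      rw [ha, vnorm_eq_zero.2 rfl] at hx
      exact vnorm_eq_zero.1 (pow_eq_zero_iff two_ne_zero |>.1 (by simpa using hx))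
    simp [this, ha]
  have ha0 : vnorm a ≠ 0 := (vnorm_pos ha).ne'
  set r := vnorm a ^ 2 with hr
  have hr0 : r ≠ 0 := pow_ne_zero 2 ha0
  set y := (1 / r) • (x - U *ᵥ a) with hy
  have hxU : x ⬝ᵥ U *ᵥ a = ρ * r := by
    rw [dotProduct_mulVec, ← mulVec_transpose, hUx, smul_dotProduct, ← vnorm_sq, smul_eq_mul]
  have hyn : vnorm y ^ 2 = 2 * (1 - ρ) / r := by
    rw [hy, vnorm_smul_sq, sub_eq_add_neg, vnorm_add_sq, vnorm_neg, vnorm_mulVec_of_isometry h.1,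
      hx, dotProduct_neg, hxU, ← hr]
    field_simp; ring
  have hUy : Uᵀ *ᵥ y = ((ρ - 1) / r) • a := by
    rw [hy, mulVec_smul, mulVec_sub, hUx, mulVec_mulVec, h.1, one_mulVec,
      show ρ • a - a = (ρ - 1) • a by rw [sub_smul, one_smul], smul_smul]
    congr 1; ring
  have hQ : (U + vecMulVec y a)ᵀ * (U + vecMulVec y a) = 1 := by
    rw [transpose_add, transpose_vecMulVec, Matrix.add_mul, Matrix.mul_add, Matrix.mul_add, h.1,
      mul_vecMulVec, vecMulVec_mul_vecMulVec, vecMulVec_mul, ← mulVec_transpose, hUy,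
      ← vnorm_sq, hyn, smul_vecMulVec, vecMulVec_smul, vecMulVec_smul, add_assoc, ← add_assoc,
      ← add_assoc, add_assoc (1 : Matrix (Fin d) (Fin d) ℝ), add_assoc, ← add_smul, ← add_smul]
    rw [show (ρ - 1) / r + (ρ - 1) / r + 2 * (1 - ρ) / r = 0 by ring, zero_smul, add_zero]
  have hle := h.2 _ hQ
  rw [trace_mul_transpose_conj, trace_mul_transpose_conj, Matrix.mul_add, mul_vecMulVec,
    frob_sq_add_vecMulVec, ← mulVec_mulVec] at hle
  have hx' : Dᵀ *ᵥ x = Dᵀ *ᵥ (U *ᵥ a) + r • (Dᵀ *ᵥ y) := by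
    rw [hy, mulVec_smul, smul_smul, mul_one_div_cancel hr0, one_smul, mulVec_sub]; abel
  rw [hx', vnorm_add_sq, dotProduct_smul, vnorm_smul_sq, smul_eq_mul]
  rw [← hr] at hle
  have : r * (2 * ((Dᵀ *ᵥ U *ᵥ a) ⬝ᵥ Dᵀ *ᵥ y) + vnorm (Dᵀ *ᵥ y) ^ 2 * r) ≤ 0 :=
    mul_nonpos_of_nonneg_of_nonpos (sq_nonneg _) (by linarith)
  linarith

lemma tilt (h : IsTopSingVecs D U) (a : Fin d → ℝ) {w : N → ℝ} (hw : Uᵀ *ᵥ w = 0) :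
    vnorm a ^ 2 * vnorm (Dᵀ *ᵥ (U *ᵥ a + w)) ^ 2
      ≤ (vnorm a ^ 2 + vnorm w ^ 2) * vnorm (Dᵀ *ᵥ (U *ᵥ a)) ^ 2 := by
  by_cases ha : a = 0
  · simp [ha, vnorm_eq_zero.2]
  have ha0 := vnorm_pos ha
  set s := vnorm a ^ 2 + vnorm w ^ 2
  have hs : 0 < s := by positivity
  set ρ := Real.sqrt (vnorm a ^ 2 / s)
  have hρ : ρ ^ 2 = vnorm a ^ 2 / s := Real.sq_sqrt (by positivity)
  have hUw : (U *ᵥ a) ⬝ᵥ w = 0 := by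
    rw [dotProduct_comm, dotProduct_mulVec, ← mulVec_transpose, hw, zero_dotProduct]
  have hx : vnorm (ρ • (U *ᵥ a + w)) ^ 2 = vnorm a ^ 2 := by
    rw [vnorm_smul_sq, hρ, vnorm_add_sq, hUw, vnorm_mulVec_of_isometry h.1, mul_zero, add_zero]
    exact div_mul_cancel₀ _ hs.ne'
  have := h.swap (a := a) (ρ := ρ) hx (by
    rw [mulVec_smul, mulVec_add, hw, mulVec_mulVec, h.1, one_mulVec, add_zero])
  rw [mulVec_smul, vnorm_smul_sq, hρ, div_mul_eq_mul_div, div_le_iff₀ hs] at this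
  linarith

lemma cross_eq_zero (h : IsTopSingVecs D U) (a : Fin d → ℝ) {w : N → ℝ} (hw : Uᵀ *ᵥ w = 0) :
    (Dᵀ *ᵥ (U *ᵥ a)) ⬝ᵥ (Dᵀ *ᵥ w) = 0 := by
  by_cases ha : a = 0
  · simp [ha]
  have ha0 : 0 < vnorm a ^ 2 := pow_pos (vnorm_pos ha) 2
  set B := (Dᵀ *ᵥ (U *ᵥ a)) ⬝ᵥ (Dᵀ *ᵥ w)
  set K := vnorm w ^ 2 * vnorm (Dᵀ *ᵥ (U *ᵥ a)) ^ 2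
  have hK : 0 ≤ K := by positivity
  have key : ∀ τ : ℝ, 2 * τ * (vnorm a ^ 2 * B) ≤ τ ^ 2 * K := by
    intro τ
    have := h.tilt a (w := τ • w) (by rw [mulVec_smul, hw, smul_zero])
    rw [mulVec_add, mulVec_smul, vnorm_add_sq, dotProduct_smul, vnorm_smul_sq, vnorm_smul_sq,
      smul_eq_mul] at this
    have : 0 ≤ vnorm a ^ 2 * (τ ^ 2 * vnorm (Dᵀ *ᵥ w) ^ 2) := by positivity
    simp only [K, B]
    linarith
  have h1 := key (vnorm a ^ 2 * B / (K + 1))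
  rw [div_pow, mul_div_assoc', div_mul_eq_mul_div, div_mul_eq_mul_div,
    div_le_div_iff₀ (by positivity) (by positivity)] at h1
  have h2 : (vnorm a ^ 2 * B) ^ 2 * (K + 1) * (K + 2) ≤ 0 := by linarith
  have h3 : (vnorm a ^ 2 * B) ^ 2 ≤ 0 :=
    nonpos_of_mul_nonpos_left (nonpos_of_mul_nonpos_left h2 (by positivity)) (by positivity)
  have h4 : vnorm a ^ 2 * B = 0 := pow_eq_zero_iff two_ne_zero |>.1 (le_antisymm h3 (sq_nonneg _))
  exact (mul_eq_zero.1 h4).resolve_left ha0.ne'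

lemma vnorm_sq_add (h : IsTopSingVecs D U) (a : Fin d → ℝ) {w : N → ℝ} (hw : Uᵀ *ᵥ w = 0) :
    vnorm (Dᵀ *ᵥ (U *ᵥ a + w)) ^ 2 = vnorm (Dᵀ *ᵥ (U *ᵥ a)) ^ 2 + vnorm (Dᵀ *ᵥ w) ^ 2 := by
  rw [mulVec_add, vnorm_add_sq, h.cross_eq_zero a hw]; ring

lemma perp_le (h : IsTopSingVecs D U) (a : Fin d → ℝ) {w : N → ℝ} (hw : Uᵀ *ᵥ w = 0) :
    vnorm a ^ 2 * vnorm (Dᵀ *ᵥ w) ^ 2 ≤ vnorm w ^ 2 * vnorm (Dᵀ *ᵥ (U *ᵥ a)) ^ 2 := by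
  have := h.tilt a hw
  rw [h.vnorm_sq_add a hw] at this
  linarith

lemma eigen (h : IsTopSingVecs D U) : D * Dᵀ * U = U * (Uᵀ * (D * Dᵀ) * U) := by
  refine Matrix.ext_of_mulVec_single fun i => ?_
  set a : Fin d → ℝ := Pi.single i 1
  set y := (D * Dᵀ * U) *ᵥ a - (U * (Uᵀ * (D * Dᵀ) * U)) *ᵥ a with hy
  have hUy : Uᵀ *ᵥ y = 0 := by
    rw [hy, mulVec_sub, mulVec_mulVec, mulVec_mulVec, ← Matrix.mul_assoc Uᵀ U, h.1, Matrix.one_mul,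
      ← Matrix.mul_assoc, sub_self]
  have h1 : ((D * Dᵀ * U) *ᵥ a) ⬝ᵥ y = 0 := by
    have := h.cross_eq_zero a hUy
    rw [mulVec_transpose D y, dotProduct_comm, ← dotProduct_mulVec, mulVec_mulVec, mulVec_mulVec,
      dotProduct_comm] at this
    exact this
  have h2 : ((U * (Uᵀ * (D * Dᵀ) * U)) *ᵥ a) ⬝ᵥ y = 0 := by
    rw [← mulVec_mulVec, dotProduct_comm, dotProduct_mulVec, ← mulVec_transpose, hUy,
      zero_dotProduct]
  have h3 : vnorm y ^ 2 = 0 := by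
    rw [vnorm_sq]; nth_rw 1 [hy]; rw [sub_dotProduct, h1, h2, sub_zero]
  have h4 := vnorm_eq_zero.1 (pow_eq_zero_iff two_ne_zero |>.1 h3)
  exact sub_eq_zero.1 h4

lemma lower {Z : Matrix N (Fin d) ℝ} {ℓ : ℝ} (h : IsTopSingVecs D U) (hℓ : 0 ≤ ℓ)
    (hZ : ∀ b, b ≠ 0 → 0 < vnorm (Z *ᵥ b) ∧ ℓ * vnorm (Z *ᵥ b) ≤ vnorm (Dᵀ *ᵥ (Z *ᵥ b)))
    (a : Fin d → ℝ) : ℓ * vnorm a ≤ vnorm (Dᵀ *ᵥ (U *ᵥ a)) := by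
  by_cases ha : a = 0
  · simp [ha, vnorm_eq_zero.2]
  have ha0 := vnorm_pos ha
  set r := vnorm a ^ 2 with hr
  have hr0 : 0 < r := pow_pos ha0 2
  obtain ⟨b, hb, hMb⟩ : ∃ b, b ≠ 0 ∧ ((1 - (1 / r) • vecMulVec a a) * (Uᵀ * Z)) *ᵥ b = 0 := by
    rw [Matrix.exists_mulVec_eq_zero_iff, ← Matrix.exists_vecMul_eq_zero_iff]
    refine ⟨a, ha, ?_⟩
    rw [← vecMul_vecMul, vecMul_sub, vecMul_one, vecMul_smul, vecMul_vecMulVec, ← vnorm_sq, ← hr,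
      smul_smul, one_div_mul_cancel hr0.ne', one_smul, sub_self, zero_vecMul]
  set z := Z *ᵥ b
  set ρ := (1 / r) * (a ⬝ᵥ (Uᵀ *ᵥ z)) with hρ
  have hUz : Uᵀ *ᵥ z = ρ • a := by
    rw [← mulVec_mulVec, ← mulVec_mulVec, sub_mulVec, one_mulVec, sub_eq_zero, smul_mulVec,
      vecMulVec_mulVec, op_smul_eq_smul, smul_smul] at hMb
    exact hMb
  set w := z - U *ᵥ (ρ • a) with hw
  have hUw : Uᵀ *ᵥ w = 0 := by
    rw [hw, mulVec_sub, hUz, mulVec_mulVec, h.1, one_mulVec, sub_self]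
  have hz : z = U *ᵥ (ρ • a) + w := by rw [hw]; abel
  obtain ⟨hz0, hz1⟩ := hZ b hb
  have e1 := h.vnorm_sq_add (ρ • a) hUw
  have e2 : vnorm z ^ 2 = ρ ^ 2 * r + vnorm w ^ 2 := by
    rw [hz, vnorm_add_sq, vnorm_mulVec_of_isometry h.1, vnorm_smul_sq, dotProduct_comm,
      dotProduct_mulVec, ← mulVec_transpose, hUw, zero_dotProduct]; ring
  have e3 := h.perp_le a hUw
  rw [← hz, mulVec_smul, mulVec_smul, vnorm_smul_sq] at e1
  have e4 : (ℓ * vnorm z) ^ 2 ≤ vnorm (Dᵀ *ᵥ z) ^ 2 :=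
    pow_le_pow_left₀ (mul_nonneg hℓ hz0.le) hz1 2
  have e5 : vnorm z ^ 2 * (ℓ * vnorm a) ^ 2 ≤ vnorm z ^ 2 * vnorm (Dᵀ *ᵥ (U *ᵥ a)) ^ 2 := by
    calc vnorm z ^ 2 * (ℓ * vnorm a) ^ 2 = r * (ℓ * vnorm z) ^ 2 := by rw [hr]; ring
      _ ≤ r * vnorm (Dᵀ *ᵥ z) ^ 2 := mul_le_mul_of_nonneg_left e4 hr0.le
      _ ≤ _ := by rw [e1, e2]; nlinarith
  exact le_of_sq_le_sq (le_of_mul_le_mul_left e5 (pow_pos hz0 2)) (vnorm_nonneg _)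

lemma perp_upper {Z : Matrix N (Fin d) ℝ} {e : ℝ} (h : IsTopSingVecs D U) (he : 0 ≤ e)
    (hZ : ∀ x, Zᵀ *ᵥ x = 0 → vnorm (Dᵀ *ᵥ x) ≤ e * vnorm x) {w : N → ℝ} (hw : Uᵀ *ᵥ w = 0) :
    vnorm (Dᵀ *ᵥ w) ≤ e * vnorm w := by
  by_cases hw0 : w = 0
  · simp [hw0, vnorm_eq_zero.2]
  have hwp := vnorm_pos hw0
  refine le_of_sq_le_sq ?_ (by positivity)
  by_cases hdet : (Zᵀ * U).det = 0
  · obtain ⟨a, ha, haz⟩ := Matrix.exists_mulVec_eq_zero_iff.2 hdet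
    have h1 := hZ (U *ᵥ a) (by rw [mulVec_mulVec, haz])
    rw [vnorm_mulVec_of_isometry h.1] at h1
    have h2 := pow_le_pow_left₀ (vnorm_nonneg _) h1 2
    have h3 := h.perp_le a hw
    refine le_of_mul_le_mul_left (h3.trans ?_) (pow_pos (vnorm_pos ha) 2)
    nlinarith [sq_nonneg (vnorm w)]
  · set a := -((Zᵀ * U)⁻¹ *ᵥ (Zᵀ *ᵥ w)) with ha
    have hx : Zᵀ *ᵥ (U *ᵥ a + w) = 0 := by
      rw [mulVec_add, mulVec_mulVec, ha, mulVec_neg, mulVec_mulVec,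
        Matrix.mul_nonsing_inv _ (isUnit_iff_ne_zero.2 hdet), one_mulVec, neg_add_cancel]
    have h1 := pow_le_pow_left₀ (vnorm_nonneg _) (hZ _ hx) 2
    rw [h.vnorm_sq_add a hw, mul_pow, vnorm_add_sq, vnorm_mulVec_of_isometry h.1, dotProduct_comm,
      dotProduct_mulVec, ← mulVec_transpose, hw, zero_dotProduct, mul_zero, add_zero] at h1
    have h3 := h.perp_le a hw
    have h4 : 0 < vnorm a ^ 2 + vnorm w ^ 2 := by positivity
    refine le_of_mul_le_mul_left (a := vnorm a ^ 2 + vnorm w ^ 2) ?_ h4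
    nlinarith [mul_le_mul_of_nonneg_left h1 (sq_nonneg (vnorm w))]

end IsTopSingVecs

lemma exists_isTopSingVecs (D : Matrix N (Fin m) ℝ) (hd : d ≤ Fintype.card N) :
    ∃ U : Matrix N (Fin d) ℝ, IsTopSingVecs D U := by
  obtain ⟨f⟩ : Nonempty (Fin d ↪ N) := Function.Embedding.nonempty_of_card_le (by simpa using hd)
  obtain ⟨U, hU, hmax⟩ := (isCompact_isometry (N := N) (d := d)).exists_isMaxOn
    (f := fun Q => trace (Qᵀ * (D * Dᵀ) * Q))
    ⟨Matrix.of fun x j => if x = f j then 1 else 0, by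
      ext i j
      simp [mul_apply, one_apply, f.injective.eq_iff, eq_comm]⟩ (by fun_prop)
  exact ⟨U, hU, fun Q hQ => hmax hQ⟩

end TopSubspace

section Perturbation
open scoped Matrix.Norms.L2Operator

variable {N : Type*} [Fintype N] [DecidableEq N] {n d m : ℕ}

lemma frob_sq_transpose_mul_le {D : Matrix N (Fin m) ℝ} {Y U : Matrix N (Fin d) ℝ} {e : ℝ}
    (hY : Uᵀ * Y = 0) (hD : ∀ w, Uᵀ *ᵥ w = 0 → vnorm (Dᵀ *ᵥ w) ≤ e * vnorm w) :
    frob (Dᵀ * Y) ^ 2 ≤ e ^ 2 * frob Y ^ 2 := by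
  rw [frob_sq_cols, frob_sq_cols, Finset.mul_sum]
  refine Finset.sum_le_sum fun j _ => ?_
  have h1 : (Dᵀ * Y)ᵀ j = Dᵀ *ᵥ (Yᵀ j) := by
    ext i; simp [mul_apply, mulVec, dotProduct]
  have h2 : Uᵀ *ᵥ (Yᵀ j) = 0 := by
    ext i
    have := congrFun (congrFun hY i) j
    simpa [mul_apply, mulVec, dotProduct] using this
  rw [h1, ← mul_pow]
  exact pow_le_pow_left₀ (vnorm_nonneg _) (hD _ h2) 2

/-- A `sin Θ` bound for top singular subspaces. -/
lemma IsTopSingVecs.sin_theta {D D' : Matrix N (Fin m) ℝ} {U U' : Matrix N (Fin d) ℝ} {e ℓ : ℝ}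
    (h : IsTopSingVecs D U) (h' : IsTopSingVecs D' U')
    (hD : ∀ w, Uᵀ *ᵥ w = 0 → vnorm (Dᵀ *ᵥ w) ≤ e * vnorm w) (hℓ : 0 ≤ ℓ)
    (hD' : ∀ a, ℓ * vnorm a ≤ vnorm (D'ᵀ *ᵥ (U' *ᵥ a))) :
    (ℓ ^ 2 - e ^ 2) * frob (U' - U * (Uᵀ * U')) ≤ frob ((D * Dᵀ - D' * D'ᵀ) * U') := by
  set Y := U' - U * (Uᵀ * U') with hYdef
  set Λ := U'ᵀ * (D' * D'ᵀ) * U' with hΛ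
  have hUY : Uᵀ * Y = 0 := by
    rw [hYdef, Matrix.mul_sub, ← Matrix.mul_assoc Uᵀ U, h.1, Matrix.one_mul, sub_self]
  have hYU : Yᵀ * U = 0 := by
    rw [← transpose_transpose U, ← transpose_mul, hUY, transpose_zero]
  have e1 : trace (Yᵀ * (D * Dᵀ * U')) = frob (Dᵀ * Y) ^ 2 := by
    have h1 : D * Dᵀ * Y = D * Dᵀ * U' - U * ((Uᵀ * (D * Dᵀ) * U) * (Uᵀ * U')) := by
      rw [hYdef, Matrix.mul_sub, ← Matrix.mul_assoc (D * Dᵀ) U, h.eigen, Matrix.mul_assoc U]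
    rw [← trace_mul_transpose_conj, Matrix.mul_assoc Yᵀ, h1, Matrix.mul_sub,
      ← Matrix.mul_assoc Yᵀ U, hYU, Matrix.zero_mul, sub_zero]
  have hΛv : ∀ v, ℓ ^ 2 * vnorm v ^ 2 ≤ v ⬝ᵥ Λ *ᵥ v := by
    intro v
    have : v ⬝ᵥ Λ *ᵥ v = vnorm (D'ᵀ *ᵥ (U' *ᵥ v)) ^ 2 := by
      rw [vnorm_sq, hΛ, mulVec_mulVec, dotProduct_mulVec (_ *ᵥ v), vecMul_mulVec,
        ← dotProduct_mulVec, transpose_mul, transpose_transpose]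
      simp only [Matrix.mul_assoc]
    rw [this, ← mul_pow]
    exact pow_le_pow_left₀ (mul_nonneg hℓ (vnorm_nonneg _)) (hD' v) 2
  have e2 : ℓ ^ 2 * frob Y ^ 2 ≤ trace (Yᵀ * (D' * D'ᵀ * U')) := by
    refine (le_trace_conj hΛv Y).trans (le_of_eq ?_)
    have h1 : Yᵀ * Y = Yᵀ * U' := by
      nth_rw 2 [hYdef]
      rw [Matrix.mul_sub, ← Matrix.mul_assoc Yᵀ U, hYU, Matrix.zero_mul, sub_zero]
    rw [h'.eigen, ← hΛ, trace_mul_comm, ← Matrix.mul_assoc, h1, Matrix.mul_assoc]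
  have e3 := frob_sq_transpose_mul_le hUY hD
  have e4 := trace_transpose_mul_le Y ((D' * D'ᵀ - D * Dᵀ) * U')
  rw [Matrix.sub_mul, Matrix.mul_sub, trace_sub, e1, ← Matrix.sub_mul] at e4
  have e5 : frob ((D' * D'ᵀ - D * Dᵀ) * U') = frob ((D * Dᵀ - D' * D'ᵀ) * U') := by
    rw [← frob_neg, ← Matrix.neg_mul, neg_sub]
  rw [e5] at e4
  have e6 : frob Y * ((ℓ ^ 2 - e ^ 2) * frob Y) ≤
      frob Y * frob ((D * Dᵀ - D' * D'ᵀ) * U') := by linarith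
  rcases (frob_nonneg Y).eq_or_lt with h0 | h0
  · rw [← h0, mul_zero]; exact frob_nonneg _
  · exact le_of_mul_le_mul_left e6 h0

section Model

variable (A : Matrix (Fin d) (Fin m) ℝ) {E : Matrix (Fin n × Fin d) (Fin m) ℝ}
  {U : Matrix (Fin n × Fin d) (Fin d) ℝ} {e : ℝ}

lemma ZStack_gram : (ZStack n d)ᵀ * ZStack n d = (n : ℝ) • (1 : Matrix (Fin d) (Fin d) ℝ) := by
  ext i j
  rcases eq_or_ne i j with rfl | hij
  · simp [mul_apply, ZStack, Fintype.sum_prod_type]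
  · simp [mul_apply, ZStack, Fintype.sum_prod_type, hij, hij.symm]

lemma vnorm_ZStack_mulVec (b : Fin d → ℝ) : vnorm (ZStack n d *ᵥ b) = √n * vnorm b := by
  rw [← sq_eq_sq₀ (vnorm_nonneg _) (mul_nonneg (Real.sqrt_nonneg _) (vnorm_nonneg _)), mul_pow,
    Real.sq_sqrt n.cast_nonneg, vnorm_sq, vnorm_sq, dotProduct_mulVec, vecMul_mulVec,
    ← dotProduct_mulVec, ZStack_gram, smul_mulVec, one_mulVec, dotProduct_smul, smul_eq_mul]

lemma norm_ZStack_le : ‖ZStack n d‖ ≤ √n :=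
  norm_le_of_vnorm_mulVec_le (Real.sqrt_nonneg _) fun v => (vnorm_ZStack_mulVec v).le

lemma norm_model_le (hE : ‖E‖ ≤ e) : ‖ZStack n d * A + E‖ ≤ √n * ‖A‖ + e :=
  (norm_add_le _ _).trans (add_le_add ((l2_opNorm_mul _ _).trans
    (mul_le_mul_of_nonneg_right norm_ZStack_le (norm_nonneg _))) hE)

lemma vnorm_transpose_mulVec_le (hE : ‖E‖ ≤ e) (x : Fin n × Fin d → ℝ) :
    vnorm (Eᵀ *ᵥ x) ≤ e * vnorm x :=
  (vnorm_mulVec_le _ _).trans (mul_le_mul_of_nonneg_right ((norm_transpose E).le.trans hE)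
    (vnorm_nonneg _))

lemma model_transpose_mulVec (x : Fin n × Fin d → ℝ) :
    (ZStack n d * A + E)ᵀ *ᵥ x = Aᵀ *ᵥ ((ZStack n d)ᵀ *ᵥ x) + Eᵀ *ᵥ x := by
  rw [transpose_add, add_mulVec, transpose_mul, mulVec_mulVec]

lemma model_lower (hE : ‖E‖ ≤ e) (b : Fin d → ℝ) :
    (√n * sigmaMin A - e) * vnorm (ZStack n d *ᵥ b)
      ≤ vnorm ((ZStack n d * A + E)ᵀ *ᵥ (ZStack n d *ᵥ b)) := by
  rw [model_transpose_mulVec, mulVec_mulVec b, ZStack_gram, smul_mulVec, one_mulVec, mulVec_smul]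
  have h1 := vnorm_sub_le ((n : ℝ) • (Aᵀ *ᵥ b) + Eᵀ *ᵥ (ZStack n d *ᵥ b))
    (Eᵀ *ᵥ (ZStack n d *ᵥ b))
  rw [add_sub_cancel_right, vnorm_smul, abs_of_nonneg n.cast_nonneg] at h1
  have h2 := vnorm_transpose_mulVec_le hE (ZStack n d *ᵥ b)
  have h3 := mul_le_mul_of_nonneg_left (sigmaMin_mul_vnorm_le A b) n.cast_nonneg (α := ℝ)
  have h4 : (n : ℝ) = √n * √n := (Real.mul_self_sqrt n.cast_nonneg).symm
  have h5 : √n * sigmaMin A * vnorm (ZStack n d *ᵥ b) = n * (sigmaMin A * vnorm b) := by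
    rw [vnorm_ZStack_mulVec]; nth_rw 3 [h4]; ring
  linarith

lemma model_perp (hE : ‖E‖ ≤ e) (x : Fin n × Fin d → ℝ) (hx : (ZStack n d)ᵀ *ᵥ x = 0) :
    vnorm ((ZStack n d * A + E)ᵀ *ᵥ x) ≤ e * vnorm x := by
  rw [model_transpose_mulVec, hx, mulVec_zero, zero_add]
  exact vnorm_transpose_mulVec_le hE x

variable {A}

lemma IsTopSingVecs.model_lower (hn : 1 ≤ n) (h : IsTopSingVecs (ZStack n d * A + E) U)
    (hE : ‖E‖ ≤ e) (he : e ≤ √n * sigmaMin A) (a : Fin d → ℝ) :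
    (√n * sigmaMin A - e) * vnorm a ≤ vnorm ((ZStack n d * A + E)ᵀ *ᵥ (U *ᵥ a)) :=
  h.lower (sub_nonneg.2 he) (fun b hb => ⟨by
    rw [vnorm_ZStack_mulVec]
    exact mul_pos (Real.sqrt_pos.2 (by exact_mod_cast hn)) (vnorm_pos hb),
    GOPP.model_lower A hE b⟩) a

lemma IsTopSingVecs.model_perp (h : IsTopSingVecs (ZStack n d * A + E) U)
    (hE : ‖E‖ ≤ e) (w : Fin n × Fin d → ℝ) (hw : Uᵀ *ᵥ w = 0) :
    vnorm ((ZStack n d * A + E)ᵀ *ᵥ w) ≤ e * vnorm w :=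
  h.perp_upper ((norm_nonneg _).trans hE) (GOPP.model_perp A hE) hw

lemma IsTopSingVecs.vnorm_ZStack_transpose_le (h : IsTopSingVecs (ZStack n d * A + E) U)
    (hE : ‖E‖ ≤ e) (w : Fin n × Fin d → ℝ) (hw : Uᵀ *ᵥ w = 0) :
    sigmaMin A * vnorm ((ZStack n d)ᵀ *ᵥ w) ≤ 2 * e * vnorm w := by
  refine (sigmaMin_mul_vnorm_le A _).trans ?_
  have h1 := vnorm_sub_le ((ZStack n d * A + E)ᵀ *ᵥ w) (Eᵀ *ᵥ w)
  have h2 := h.model_perp hE w hw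
  have h3 := vnorm_transpose_mulVec_le hE w
  rw [model_transpose_mulVec, add_sub_cancel_right] at h1
  rw [model_transpose_mulVec] at h2
  linarith

/-- The top left singular vectors of the model are, up to rotation, close to `Z / √n`. -/
lemma IsTopSingVecs.exists_isOrth_near (hn : 1 ≤ n) (h : IsTopSingVecs (ZStack n d * A + E) U)
    (hE : ‖E‖ ≤ e) (hA : 0 < sigmaMin A) :
    ∃ Q : Matrix (Fin d) (Fin d) ℝ, IsOrth Q ∧
      ‖(1 / √n) • ((ZStack n d)ᵀ * U) - Q‖ ≤ 4 * (e / (√n * sigmaMin A)) ^ 2 := by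
  have hq : 0 < √(n : ℝ) := Real.sqrt_pos.2 (by exact_mod_cast hn)
  have hqq : √(n : ℝ) * √n = n := Real.mul_self_sqrt n.cast_nonneg
  set V := (1 / √(n : ℝ)) • ZStack n d with hV
  have hVV : Vᵀ * V = 1 := by
    rw [hV, transpose_smul, Matrix.smul_mul, Matrix.mul_smul, ZStack_gram, smul_smul, smul_smul]
    have hn0 : (n : ℝ) ≠ 0 := by rw [← hqq]; positivity
    rw [show 1 / √(n : ℝ) * (1 / √n) * n = 1 by field_simp; linarith, one_smul]
  set η := e / (√(n : ℝ) * sigmaMin A) with hη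
  have he : 0 ≤ e := (norm_nonneg _).trans hE
  have hη0 : 0 ≤ η := by positivity
  have hw : ∀ w, Uᵀ *ᵥ w = 0 → vnorm (Vᵀ *ᵥ w) ≤ 2 * η * vnorm w := by
    intro w hw
    have := h.vnorm_ZStack_transpose_le hE w hw
    rw [hV, transpose_smul, smul_mulVec, vnorm_smul, abs_of_nonneg (by positivity), hη]
    rw [mul_comm, ← le_div_iff₀ hA] at this
    calc 1 / √(n : ℝ) * vnorm ((ZStack n d)ᵀ *ᵥ w)
        ≤ 1 / √(n : ℝ) * (2 * e * vnorm w / sigmaMin A) :=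
          mul_le_mul_of_nonneg_left this (by positivity)
      _ = _ := by field_simp
  set X := Uᵀ * V with hX
  obtain ⟨S, hS⟩ := exists_isPolar X
  refine ⟨Sᵀ, hS.1.transpose, ?_⟩
  have e1 : (1 / √(n : ℝ)) • ((ZStack n d)ᵀ * U) - Sᵀ = (X - S)ᵀ := by
    rw [transpose_sub, hX, transpose_mul, transpose_transpose, hV, transpose_smul, Matrix.smul_mul]
  rw [e1, norm_transpose]
  refine hS.norm_sub_le_gram.trans (norm_le_of_vnorm_mulVec_le (by positivity) fun v => ?_)
  set w := V *ᵥ v - U *ᵥ (X *ᵥ v) with hwd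
  have hUw : Uᵀ *ᵥ w = 0 := by
    rw [hwd, mulVec_sub, mulVec_mulVec, mulVec_mulVec, h.1, one_mulVec, hX, sub_self]
  have h1 : (Xᵀ * X - 1) *ᵥ v = -(Vᵀ *ᵥ w) := by
    rw [hwd, mulVec_sub, mulVec_mulVec, hVV, one_mulVec, neg_sub, sub_mulVec, one_mulVec]
    simp only [hX, mulVec_mulVec, transpose_mul, transpose_transpose, Matrix.mul_assoc]
  have h2 : vnorm w * vnorm w ≤ vnorm w * (2 * η * vnorm v) := by
    have : vnorm w * vnorm w = v ⬝ᵥ (Vᵀ *ᵥ w) := by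
      rw [← sq, vnorm_sq]; nth_rw 1 [hwd]
      rw [sub_dotProduct, dotProduct_comm (U *ᵥ _), dotProduct_mulVec w, ← mulVec_transpose, hUw,
        zero_dotProduct, sub_zero, dotProduct_mulVec v, vecMul_transpose]
    rw [this]
    refine (dotProduct_le _ _).trans ?_
    calc vnorm v * vnorm (Vᵀ *ᵥ w) ≤ vnorm v * (2 * η * vnorm w) :=
          mul_le_mul_of_nonneg_left (hw w hUw) (vnorm_nonneg _)
      _ = _ := by ring
  have h3 : vnorm w ≤ 2 * η * vnorm v := by
    rcases (vnorm_nonneg w).eq_or_lt with h0 | h0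
    · rw [← h0]; exact mul_nonneg (by positivity) (vnorm_nonneg _)
    · exact le_of_mul_le_mul_left h2 h0
  rw [h1, vnorm_neg]
  calc vnorm (Vᵀ *ᵥ w) ≤ 2 * η * vnorm w := hw w hUw
    _ ≤ 2 * η * (2 * η * vnorm v) := mul_le_mul_of_nonneg_left h3 (by positivity)
    _ = _ := by ring

lemma norm_le_of_mul_gram {k : ℕ} {X : Matrix (Fin k) (Fin d) ℝ} {M : Matrix (Fin m) (Fin d) ℝ}
    {ℓ r : ℝ} (hℓ : 0 < ℓ) (hr : 0 ≤ r) (hM : ∀ a, ℓ * vnorm a ≤ vnorm (M *ᵥ a))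
    (h : ‖X * (Mᵀ * M)‖ ≤ r) : ℓ ^ 2 * ‖X‖ ≤ r := by
  rw [← norm_transpose X, mul_comm, ← le_div_iff₀ (by positivity)]
  refine norm_le_of_vnorm_mulVec_le (by positivity) fun v => ?_
  set b := Xᵀ *ᵥ v
  have h1 : vnorm ((Mᵀ * M) *ᵥ b) ≤ r * vnorm v := by
    have : (Mᵀ * M) *ᵥ b = (X * (Mᵀ * M))ᵀ *ᵥ v := by
      rw [mulVec_mulVec, transpose_mul, transpose_mul, transpose_transpose]
    rw [this]
    refine (vnorm_mulVec_le _ _).trans (mul_le_mul_of_nonneg_right ?_ (vnorm_nonneg _))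
    rwa [norm_transpose]
  have h2 : (ℓ * vnorm b) ^ 2 ≤ vnorm b * vnorm ((Mᵀ * M) *ᵥ b) := by
    refine (pow_le_pow_left₀ (mul_nonneg hℓ.le (vnorm_nonneg _)) (hM b) 2).trans ?_
    rw [vnorm_sq, dotProduct_mulVec, vecMul_mulVec, ← dotProduct_mulVec]
    exact dotProduct_le _ _
  have h3 : vnorm b * (ℓ ^ 2 * vnorm b) ≤ vnorm b * (r * vnorm v) := by
    have := mul_le_mul_of_nonneg_left h1 (vnorm_nonneg b)
    linarith
  rw [div_mul_eq_mul_div, le_div_iff₀ (by positivity), mul_comm]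
  rcases (vnorm_nonneg b).eq_or_lt with h0 | h0
  · rw [← h0, mul_zero]; exact mul_nonneg hr (vnorm_nonneg _)
  · exact le_of_mul_le_mul_left h3 h0

lemma norm_le_of_mul_gram_eq {k : ℕ} {X : Matrix (Fin k) (Fin d) ℝ}
    {M : Matrix (Fin m) (Fin d) ℝ} {B : Matrix (Fin k) (Fin m) ℝ} {ℓ : ℝ} (hℓ : 0 < ℓ)
    (hM : ∀ a, ℓ * vnorm a ≤ vnorm (M *ᵥ a)) (h : X * (Mᵀ * M) = B * M) :
    ℓ * ‖X‖ ≤ ‖B‖ := by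
  rw [← norm_transpose X, mul_comm, ← le_div_iff₀ hℓ]
  refine norm_le_of_vnorm_mulVec_le (by positivity) fun v => ?_
  set b := Xᵀ *ᵥ v
  have h1 : vnorm (M *ᵥ b) * vnorm (M *ᵥ b) ≤ vnorm (M *ᵥ b) * (‖B‖ * vnorm v) := by
    have h2 : (Mᵀ * M) *ᵥ b = Mᵀ *ᵥ (Bᵀ *ᵥ v) := by
      rw [mulVec_mulVec, mulVec_mulVec, ← transpose_mul, ← h, transpose_mul, transpose_mul,
        transpose_transpose]
    have h3 : vnorm (M *ᵥ b) * vnorm (M *ᵥ b) = (M *ᵥ b) ⬝ᵥ (Bᵀ *ᵥ v) := by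
      rw [← sq, vnorm_sq, dotProduct_mulVec, vecMul_mulVec, ← dotProduct_mulVec, h2,
        dotProduct_mulVec b, vecMul_transpose]
    rw [h3]
    refine (dotProduct_le _ _).trans (mul_le_mul_of_nonneg_left ?_ (vnorm_nonneg _))
    rw [← norm_transpose B]
    exact vnorm_mulVec_le _ _
  rw [div_mul_eq_mul_div, le_div_iff₀ hℓ, mul_comm]
  refine (hM b).trans ?_
  rcases (vnorm_nonneg (M *ᵥ b)).eq_or_lt with h0 | h0
  · rw [← h0]; exact mul_nonneg (norm_nonneg _) (vnorm_nonneg _)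
  · exact le_of_mul_le_mul_left h1 h0

end Model
end Perturbation

section LeaveOneOut
open scoped Matrix.Norms.L2Operator

variable {n d m k : ℕ} {A : Matrix (Fin d) (Fin m) ℝ}
  {W : Matrix (Fin n × Fin d) (Fin m) ℝ} {σ β δ κ : ℝ}

lemma norm_mask_le (W : Matrix (Fin n × Fin d) (Fin m) ℝ) (i : Fin n) : ‖mask W i‖ ≤ ‖W‖ := by
  refine norm_le_of_vnorm_mulVec_le (norm_nonneg _) fun v => ?_
  refine le_trans ?_ (vnorm_mulVec_le W v)
  refine Real.sqrt_le_sqrt (Finset.sum_le_sum fun p _ => ?_)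
  by_cases hp : p.1 = i
  · have : (mask W i *ᵥ v) p = 0 := by simp [mask, mulVec, dotProduct, hp]
    rw [this, zero_pow two_ne_zero]; exact sq_nonneg _
  · have : (mask W i *ᵥ v) p = (W *ᵥ v) p := by simp [mask, mulVec, dotProduct, hp]
    rw [this]

lemma blk_mask (W : Matrix (Fin n × Fin d) (Fin m) ℝ) (i : Fin n) : blk (mask W i) i = 0 := by
  ext a b; simp [blk, mask]

lemma sub_mask_transpose_mul (W : Matrix (Fin n × Fin d) (Fin m) ℝ) (i : Fin n)
    (X : Matrix (Fin n × Fin d) (Fin k) ℝ) :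
    (W - mask W i)ᵀ * X = (blk W i)ᵀ * blk X i := by
  ext a b
  simp only [mul_apply, transpose_apply, Matrix.sub_apply, mask, blk, of_apply, Fintype.sum_prod_type]
  rw [Finset.sum_eq_single i]
  · simp
  · intro j _ hj; simp [hj]
  · simp

lemma frob_sub_mask_mul (W : Matrix (Fin n × Fin d) (Fin m) ℝ) (i : Fin n)
    (X : Matrix (Fin m) (Fin k) ℝ) :
    frob ((W - mask W i) * X) = frob (blk W i * X) := by
  rw [← sq_eq_sq₀ (frob_nonneg _) (frob_nonneg _), frob_sq_blk, Finset.sum_eq_single i]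
  · rw [blk_mul, blk_sub, blk_mask, sub_zero]
  · intro j _ hj
    have : blk (W - mask W i) j = 0 := by ext a b; simp [blk, mask, hj]
    rw [blk_mul, this, Matrix.zero_mul]
    simp [frob]
  · simp

lemma blk_ZStack_mul (i : Fin n) : blk (ZStack n d * A) i = A := by
  have : blk (ZStack n d) i = 1 := by ext a b; simp [blk, ZStack, one_apply]
  rw [blk_mul, this, Matrix.one_mul]

lemma sigmaMin_le_norm (hd : 1 ≤ d) : sigmaMin A ≤ ‖A‖ := by
  have h1 := sigmaMin_mul_vnorm_le A (Pi.single ⟨0, hd⟩ 1)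
  have h2 := vnorm_mulVec_le Aᵀ (Pi.single ⟨0, hd⟩ 1)
  have h3 : vnorm (Pi.single (⟨0, hd⟩ : Fin d) (1 : ℝ)) = 1 := by
    rw [← sq_eq_sq₀ (vnorm_nonneg _) zero_le_one, vnorm_sq]; simp
  rw [h3, norm_transpose, mul_one] at h2
  rw [h3, mul_one] at h1
  exact h1.trans h2

/-- The signal-to-noise regime, with `δ = σ β / (√n σ_min(A))`. -/
structure Regime (n : ℕ) (A : Matrix (Fin d) (Fin m) ℝ) (σ β δ κ : ℝ) : Prop where
  hn : 1 ≤ n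
  hd : 1 ≤ d
  hs : 0 < sigmaMin A
  hσ : 0 < σ
  hβ : 0 < β
  hκ : ‖A‖ = κ * sigmaMin A
  hδ : σ * β = δ * (√n * sigmaMin A)
  small : δ * κ ^ 4 * √d ≤ 1 / 100000

namespace Regime
variable (R : Regime n A σ β δ κ)
include R

lemma q_one : 1 ≤ √(n : ℝ) := Real.one_le_sqrt.2 (by exact_mod_cast R.hn)

lemma qs_pos : 0 < √n * sigmaMin A := mul_pos (by linarith [R.q_one]) R.hs

lemma y_one : 1 ≤ √(d : ℝ) := Real.one_le_sqrt.2 (by exact_mod_cast R.hd)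

lemma κ_one : 1 ≤ κ := by
  have := sigmaMin_le_norm (A := A) R.hd
  rw [R.hκ] at this
  exact le_of_mul_le_mul_right (by linarith) R.hs

lemma δ_pos : 0 < δ := by
  have h := mul_pos R.hσ R.hβ
  rw [R.hδ] at h
  exact pos_of_mul_pos_left h (mul_nonneg (Real.sqrt_nonneg _) R.hs.le)

lemma small_pow {j : ℕ} (hj : j ≤ 4) : δ * κ ^ j * √d ≤ 1 / 100000 :=
  le_trans (mul_le_mul_of_nonneg_right (mul_le_mul_of_nonneg_left
    (pow_le_pow_right₀ R.κ_one hj) R.δ_pos.le) (Real.sqrt_nonneg _)) R.small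

lemma small_pow' {j : ℕ} (hj : j ≤ 4) : δ * κ ^ j ≤ 1 / 100000 :=
  le_trans (le_mul_of_one_le_right (mul_nonneg R.δ_pos.le (pow_nonneg (by linarith [R.κ_one]) _))
    R.y_one) (R.small_pow hj)

lemma δ_le : δ ≤ 1 / 100000 := by simpa using R.small_pow' (j := 0) (by norm_num)

lemma noise_le (hW : ‖W‖ ≤ 4 * β) : ‖σ • W‖ ≤ 4 * δ * (√n * sigmaMin A) := by
  rw [norm_smul, Real.norm_eq_abs, abs_of_pos R.hσ]
  have := mul_le_mul_of_nonneg_left hW R.hσ.le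
  linarith [R.hδ]

lemma noise_small : 4 * δ * (√n * sigmaMin A) ≤ 1 / 25000 * (√n * sigmaMin A) :=
  mul_le_mul_of_nonneg_right (by linarith [R.δ_le]) (mul_nonneg (Real.sqrt_nonneg _) R.hs.le)

lemma data_norm_le (hW : ‖W‖ ≤ 4 * β) :
    ‖ZStack n d * A + σ • W‖ ≤ 1.001 * (κ * (√n * sigmaMin A)) := by
  have h := norm_model_le A (R.noise_le hW)
  have h2 := R.noise_small
  rw [R.hκ] at h
  have h3 : √n * (κ * sigmaMin A) = κ * (√n * sigmaMin A) := by ring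
  have : √n * sigmaMin A ≤ κ * (√n * sigmaMin A) :=
    le_mul_of_one_le_left (mul_nonneg (Real.sqrt_nonneg _) R.hs.le) R.κ_one
  linarith [R.qs_pos]

lemma lower {U : Matrix (Fin n × Fin d) (Fin d) ℝ} (hW : ‖W‖ ≤ 4 * β)
    (hU : IsTopSingVecs (ZStack n d * A + σ • W) U) (a : Fin d → ℝ) :
    0.999 * (√n * sigmaMin A) * vnorm a ≤ vnorm ((ZStack n d * A + σ • W)ᵀ *ᵥ (U *ᵥ a)) := by
  refine le_trans (mul_le_mul_of_nonneg_right ?_ (vnorm_nonneg _))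
    (hU.model_lower R.hn (R.noise_le hW) ?_ a)
  all_goals linarith [R.noise_small, R.qs_pos]

lemma mask_noise (hW : ‖W‖ ≤ 4 * β) (i : Fin n) : ‖mask W i‖ ≤ 4 * β :=
  (norm_mask_le W i).trans hW

lemma norm_blk_loo {U' : Matrix (Fin n × Fin d) (Fin d) ℝ} {i : Fin n} (hW : ‖W‖ ≤ 4 * β)
    (hU' : IsTopSingVecs (ZStack n d * A + σ • mask W i) U') :
    ‖blk U' i‖ * √n ≤ 1.01 * κ := by
  have h := norm_le_of_mul_gram_eq (X := blk U' i) (B := A)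
    (M := (ZStack n d * A + σ • mask W i)ᵀ * U') (ℓ := 0.999 * (√n * sigmaMin A))
    (by linarith [R.qs_pos])
    (fun a => by rw [← mulVec_mulVec]; exact R.lower (R.mask_noise hW i) hU' a) (by
      rw [transpose_mul, transpose_transpose]
      have h1 := congrArg (fun X => blk X i) hU'.eigen
      simp only [Matrix.mul_assoc _ (ZStack n d * A + σ • mask W i)ᵀ U'] at h1
      rw [blk_mul, blk_add, blk_smul, blk_ZStack_mul, blk_mask, smul_zero, add_zero, blk_mul] at h1
      replace h1 := h1.symm
      simp only [Matrix.mul_assoc] at h1 ⊢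
      exact h1)
  rw [R.hκ] at h
  have h2 : (0.999 * (√n * ‖blk U' i‖)) * sigmaMin A ≤ κ * sigmaMin A := by linarith
  have := le_of_mul_le_mul_right h2 R.hs
  linarith [R.κ_one]

/-- The singular subspaces of the data and of the leave-one-out data are close. -/
lemma leave_one_out {U U' : Matrix (Fin n × Fin d) (Fin d) ℝ} {i : Fin n} (hW : ‖W‖ ≤ 4 * β)
    (hU : IsTopSingVecs (ZStack n d * A + σ • W) U)
    (hU' : IsTopSingVecs (ZStack n d * A + σ • mask W i) U')
    (hWM : ‖blk W i * ((ZStack n d * A + σ • mask W i)ᵀ * U')‖ ≤ 7 * ‖A‖ * β) :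
    ∃ O : Matrix (Fin d) (Fin d) ℝ, IsOrth O ∧
      frob (U - U' * O) * √n ≤ 17 * (δ * κ ^ 2 * √d) := by
  obtain ⟨O, hO, hUO⟩ := exists_isOrth_frob_sub_sq_le hU.1 hU'.1
  refine ⟨O, hO, ?_⟩
  set Y := U' - U * (Uᵀ * U') with hY
  set D := ZStack n d * A + σ • W with hD
  set D' := ZStack n d * A + σ • mask W i with hD'
  have hst := hU.sin_theta hU' (hU.model_perp (R.noise_le hW)) (by linarith [R.qs_pos])
    (R.lower (R.mask_noise hW i) hU')
  have hdiff : (D * Dᵀ - D' * D'ᵀ) * U'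
      = σ • ((W - mask W i) * (D'ᵀ * U')) + σ • (D * ((blk W i)ᵀ * blk U' i)) := by
    have h1 : D - D' = σ • (W - mask W i) := by rw [hD, hD', smul_sub]; abel
    have h2 : D * Dᵀ - D' * D'ᵀ = (D - D') * D'ᵀ + D * (D - D')ᵀ := by
      rw [transpose_sub, Matrix.sub_mul, Matrix.mul_sub]; abel
    rw [h2, h1, ← sub_mask_transpose_mul, Matrix.add_mul, transpose_smul, Matrix.smul_mul,
      Matrix.smul_mul, Matrix.mul_smul, Matrix.smul_mul, Matrix.mul_assoc, Matrix.mul_assoc]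
  have hb1 : frob (σ • ((W - mask W i) * (D'ᵀ * U'))) ≤ √d * (7 * κ) * (δ * √n * sigmaMin A ^ 2) := by
    rw [frob_smul, abs_of_pos R.hσ, frob_sub_mask_mul]
    have h := frob_le_sqrt_mul_norm (blk W i * (D'ᵀ * U'))
    rw [Fintype.card_fin] at h
    calc σ * frob (blk W i * (D'ᵀ * U')) ≤ σ * (√d * (7 * ‖A‖ * β)) :=
          mul_le_mul_of_nonneg_left
            (h.trans (mul_le_mul_of_nonneg_left hWM (Real.sqrt_nonneg _))) R.hσ.le
      _ = √d * (7 * κ) * sigmaMin A * (σ * β) := by rw [R.hκ]; ring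
      _ = _ := by rw [R.hδ]; ring
  have hb2 : frob (σ • (D * ((blk W i)ᵀ * blk U' i)))
      ≤ √d * (4.1 * κ ^ 2) * (δ * √n * sigmaMin A ^ 2) := by
    rw [frob_smul, abs_of_pos R.hσ]
    have h1 := frob_mul_le D ((blk W i)ᵀ * blk U' i)
    have h2 := frob_mul_le (blk W i)ᵀ (blk U' i)
    have h3 := frob_le_sqrt_mul_norm (blk U' i)
    rw [Fintype.card_fin] at h3
    rw [norm_transpose] at h2
    have h4 := (norm_blk_le W i).trans hW
    have h5 := R.data_norm_le hW
    have h6 := R.norm_blk_loo hW hU'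
    have hβ := R.hβ.le
    have hs := R.hs.le
    have hκ := R.κ_one
    have hσ := R.hσ.le
    calc σ * frob (D * ((blk W i)ᵀ * blk U' i))
        ≤ σ * ((1.001 * (κ * (√n * sigmaMin A))) * (4 * β * (√d * ‖blk U' i‖))) := by
          gcongr
          refine h1.trans (mul_le_mul h5 (h2.trans ?_) (frob_nonneg _) (by positivity))
          exact mul_le_mul h4 h3 (frob_nonneg _) (by positivity)
      _ = (1.001 * 4) * (κ * sigmaMin A * √d) * (σ * β) * (‖blk U' i‖ * √n) := by ring
      _ ≤ (1.001 * 4) * (κ * sigmaMin A * √d) * (σ * β) * (1.01 * κ) := by gcongr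
      _ = (1.001 * 4 * 1.01) * (κ ^ 2 * sigmaMin A * √d) * (δ * (√n * sigmaMin A)) := by
          rw [R.hδ]; ring
      _ = (1.001 * 4 * 1.01) * (κ ^ 2 * √d * δ * √n * sigmaMin A ^ 2) := by ring
      _ ≤ 4.1 * (κ ^ 2 * √d * δ * √n * sigmaMin A ^ 2) := by
          have := R.δ_pos.le
          gcongr
          norm_num
      _ = _ := by ring
  rw [hdiff] at hst
  have hst2 := hst.trans ((frob_add_le _ _).trans (add_le_add hb1 hb2))
  set g := frob Y
  have hg : 0 ≤ g := frob_nonneg _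
  have hqs := R.qs_pos
  have hδ0 := R.δ_pos
  have hκ := R.κ_one
  have e1 : 0.99 * (√n * sigmaMin A) ^ 2 * g ≤
      ((0.999 * (√n * sigmaMin A)) ^ 2 - (4 * δ * (√n * sigmaMin A)) ^ 2) * g := by
    refine mul_le_mul_of_nonneg_right ?_ hg
    have : δ ^ 2 ≤ (1 / 100000) ^ 2 := pow_le_pow_left₀ hδ0.le R.δ_le 2
    have h2 : 0 < (√n * sigmaMin A) ^ 2 := by positivity
    nlinarith
  have e2 : √n * sigmaMin A ^ 2 * (0.99 * (√n * g)) ≤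
      √n * sigmaMin A ^ 2 * (11.1 * (δ * κ ^ 2 * √d)) := by
    have h3 := e1.trans hst2
    have h4 : √d * (7 * κ) * (δ * √n * sigmaMin A ^ 2) ≤
        √d * (7 * κ ^ 2) * (δ * √n * sigmaMin A ^ 2) := by
      have hk2 : κ ≤ κ ^ 2 := by nlinarith
      gcongr
    linarith
  have hq := R.q_one
  have e3 := le_of_mul_le_mul_left e2 (by have := R.hs; positivity)
  have e4 : frob (U - U' * O) ≤ 1.42 * g := by
    refine le_of_sq_le_sq (hUO.trans ?_) (by positivity)
    nlinarith
  have e5 := mul_le_mul_of_nonneg_right e4 (Real.sqrt_nonneg (n : ℝ))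
  have e6 : 0 ≤ δ * κ ^ 2 * √d := by positivity
  linarith

end Regime
end LeaveOneOut

section Deterministic
open scoped Matrix.Norms.L2Operator

variable {n d m k : ℕ} {A : Matrix (Fin d) (Fin m) ℝ}
  {W : Matrix (Fin n × Fin d) (Fin m) ℝ} {σ β δ κ : ℝ}
  {U U' S S' : Matrix (Fin n × Fin d) (Fin d) ℝ}

lemma frob_le_sqrt_mul_norm' (X : Matrix (Fin k) (Fin d) ℝ) : frob X ≤ √d * ‖X‖ := by
  simpa using frob_le_sqrt_mul_norm X

lemma frob_sq_le_of_blk_norm_le {X : Matrix (Fin n × Fin d) (Fin d) ℝ} {r : ℝ}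
    (h : ∀ i, ‖blk X i‖ ≤ r) : frob X ≤ √n * (√d * r) := by
  rcases Nat.eq_zero_or_pos n with rfl | hn
  · simp [frob]
  have hr : 0 ≤ r := (norm_nonneg _).trans (h ⟨0, hn⟩)
  refine le_of_sq_le_sq ?_ (by positivity)
  rw [frob_sq_blk, mul_pow, Real.sq_sqrt n.cast_nonneg]
  refine (Finset.sum_le_card_nsmul _ _ ((√d * r) ^ 2) fun i _ => ?_).trans ?_
  · exact pow_le_pow_left₀ (frob_nonneg _) ((frob_le_sqrt_mul_norm' _).trans
      (mul_le_mul_of_nonneg_left (h i) (Real.sqrt_nonneg _))) 2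
  · simp

lemma frob_blocks_lipschitz {X Y : Matrix (Fin n × Fin d) (Fin d) ℝ}
    (h : IsPolarBlocks X S) (h' : IsPolarBlocks Y S')
    (hX : ∀ i, ‖√n • blk X i - blk S i‖ ≤ 1 / 2) :
    frob (S - S') ≤ 4 * (frob (X - Y) * √n) := by
  have : 4 * (frob (X - Y) * √n) = frob ((4 * √n) • (X - Y)) := by
    rw [frob_smul, abs_of_nonneg (by positivity)]; ring
  rw [this]
  refine le_of_sq_le_sq ?_ (frob_nonneg _)
  rw [frob_sq_blk, frob_sq_blk]
  refine Finset.sum_le_sum fun i _ => pow_le_pow_left₀ (frob_nonneg _) ?_ 2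
  have h1 := ((h i).smul (Real.sqrt_nonneg (n : ℝ))).lipschitz
    ((h' i).smul (Real.sqrt_nonneg (n : ℝ))) (hX i)
  rw [blk_sub]
  refine h1.trans (le_of_eq ?_)
  rw [blk_smul, blk_sub, ← smul_sub, frob_smul, frob_smul, abs_of_nonneg (by positivity),
    abs_of_nonneg (by positivity)]
  ring

lemma IsPolarBlocks.mul_right (h : IsPolarBlocks U S) {O : Matrix (Fin d) (Fin d) ℝ}
    (hO : IsOrth O) : IsPolarBlocks (U * O) (S * O) := fun i => (h i).mul_right hO

namespace Regime
variable (R : Regime n A σ β δ κ)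
include R

lemma δκ_le_δκ_sq : δ * κ ≤ δ * κ ^ 2 := by
  have := R.κ_one
  have := R.δ_pos
  gcongr
  nlinarith

lemma norm_blk_mul_data_le {i : Fin n} (hW : ‖W‖ ≤ 4 * β)
    (hU : IsTopSingVecs (ZStack n d * A + σ • W) U)
    (hU' : IsTopSingVecs (ZStack n d * A + σ • mask W i) U')
    (hWM : ‖blk W i * ((ZStack n d * A + σ • mask W i)ᵀ * U')‖ ≤ 7 * ‖A‖ * β) :
    σ * ‖blk W i * ((ZStack n d * A + σ • W)ᵀ * U)‖
      ≤ 7.02 * (δ * κ * (√n * sigmaMin A ^ 2)) := by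
  obtain ⟨O, hO, hUO⟩ := R.leave_one_out hW hU hU' hWM
  set D := ZStack n d * A + σ • W with hD
  set D' := ZStack n d * A + σ • mask W i with hD'
  have hs := R.hs.le
  have hσ := R.hσ.le
  have hβ := R.hβ.le
  have hδ := R.δ_pos.le
  have hκ := R.κ_one
  have hsplit : blk W i * (Dᵀ * U) = blk W i * (D'ᵀ * U') * O
      + blk W i * (D'ᵀ * (U - U' * O)) + σ • (blk W i * ((blk W i)ᵀ * blk U i)) := by
    have h1 : D = D' + σ • (W - mask W i) := by rw [hD, hD', smul_sub]; abel
    rw [h1, ← sub_mask_transpose_mul, transpose_add, transpose_smul, Matrix.add_mul,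
      Matrix.smul_mul, Matrix.mul_add, Matrix.mul_smul, Matrix.mul_sub, Matrix.mul_sub]
    simp only [Matrix.mul_assoc]
    abel
  have hWi := (norm_blk_le W i).trans hW
  have b1 : ‖blk W i * (D'ᵀ * U') * O‖ ≤ 7 * (κ * sigmaMin A) * β := by
    rw [hO.norm_mul_right, ← R.hκ]; exact hWM
  have b2 : ‖blk W i * (D'ᵀ * (U - U' * O))‖
      ≤ (4 * β) * (1.001 * (κ * (√n * sigmaMin A)) * frob (U - U' * O)) := by
    refine (l2_opNorm_mul _ _).trans (mul_le_mul hWi ?_ (norm_nonneg _) (by positivity))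
    refine (l2_opNorm_mul _ _).trans (mul_le_mul ?_ (norm_le_frob _) (norm_nonneg _)
      (by positivity))
    rw [norm_transpose]
    exact R.data_norm_le (R.mask_noise hW i)
  have hUi : ‖blk U i‖ * √n ≤ 1.02 * κ := by
    have h1 : blk U i = blk U' i * O + blk (U - U' * O) i := by
      rw [blk_sub, blk_mul]; abel
    have h2 : ‖blk U i‖ ≤ ‖blk U' i‖ + frob (U - U' * O) := by
      rw [h1]
      refine (norm_add_le _ _).trans (add_le_add (hO.norm_mul_right _).le ?_)
      exact (norm_le_frob _).trans (frob_blk_le _ _)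
    have h3 := R.norm_blk_loo hW hU'
    have h4 := mul_le_mul_of_nonneg_right h2 (Real.sqrt_nonneg (n : ℝ))
    have h5 := R.small_pow (j := 2) (by norm_num)
    linarith
  have b3 : ‖σ • (blk W i * ((blk W i)ᵀ * blk U i))‖ ≤ σ * ((4 * β) * ((4 * β) * ‖blk U i‖)) := by
    rw [norm_smul, Real.norm_eq_abs, abs_of_nonneg hσ]
    refine mul_le_mul_of_nonneg_left ?_ hσ
    refine (l2_opNorm_mul _ _).trans (mul_le_mul hWi ?_ (norm_nonneg _) (by positivity))
    refine (l2_opNorm_mul _ _).trans (mul_le_mul ?_ le_rfl (norm_nonneg _) (by positivity))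
    rw [norm_transpose]
    exact hWi
  have b := (norm_add₃_le (a := blk W i * (D'ᵀ * U') * O)).trans
    (add_le_add (add_le_add b1 b2) b3)
  rw [hsplit]
  refine (mul_le_mul_of_nonneg_left b hσ).trans ?_
  have h5 := R.small_pow (j := 2) (by norm_num)
  calc σ * (7 * (κ * sigmaMin A) * β
        + 4 * β * (1.001 * (κ * (√n * sigmaMin A)) * frob (U - U' * O))
        + σ * (4 * β * (4 * β * ‖blk U i‖)))
      = (σ * β) * (7 * (κ * sigmaMin A) + 4.004 * (κ * sigmaMin A) * (frob (U - U' * O) * √n)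
          + 16 * (σ * β) * ‖blk U i‖) := by ring
    _ = (σ * β) * (7 * (κ * sigmaMin A) + 4.004 * (κ * sigmaMin A) * (frob (U - U' * O) * √n)
          + 16 * δ * sigmaMin A * (‖blk U i‖ * √n)) := by rw [R.hδ]; ring
    _ ≤ (σ * β) * (7 * (κ * sigmaMin A) + 4.004 * (κ * sigmaMin A) * (17 * (1 / 100000))
          + 16 * (1 / 100000) * sigmaMin A * (1.02 * κ)) := by
        have := R.δ_le
        have h6 : frob (U - U' * O) * √n ≤ 17 * (1 / 100000) := by linarith
        generalize frob (U - U' * O) * √n = g at h6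
        gcongr
    _ ≤ (σ * β) * (7.02 * (κ * sigmaMin A)) := by
        refine mul_le_mul_of_nonneg_left ?_ (by positivity)
        have : 0 ≤ κ * sigmaMin A := by positivity
        linarith
    _ = _ := by rw [R.hδ]; ring

lemma norm_blk_sub_mean_le {i : Fin n} (hW : ‖W‖ ≤ 4 * β)
    (hU : IsTopSingVecs (ZStack n d * A + σ • W) U)
    (hU' : IsTopSingVecs (ZStack n d * A + σ • mask W i) U')
    (hWM : ‖blk W i * ((ZStack n d * A + σ • mask W i)ᵀ * U')‖ ≤ 7 * ‖A‖ * β) :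
    √n * ‖blk U i - (1 / (n : ℝ)) • ((ZStack n d)ᵀ * U)‖ ≤ 11.9 * (δ * κ) := by
  have h1 := R.norm_blk_mul_data_le hW hU hU' hWM
  have hlow := R.lower hW hU
  have hdat := R.data_norm_le hW
  have hqs := R.qs_pos
  have hs := R.hs.le
  have hδ := R.δ_pos.le
  have hκ := R.κ_one
  have heig := hU.eigen
  set D := ZStack n d * A + σ • W with hD
  set M := Dᵀ * U with hM
  have hgram : Mᵀ * M = Uᵀ * (D * Dᵀ) * U := by
    rw [hM, transpose_mul, transpose_transpose]; simp only [Matrix.mul_assoc]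
  rw [← hgram, Matrix.mul_assoc, ← hM] at heig
  have hn0 : (n : ℝ) ≠ 0 := by have := R.hn; positivity
  have hq := R.q_one
  have hqq : √(n : ℝ) * √n = n := Real.mul_self_sqrt n.cast_nonneg
  have hb : blk U i * (Mᵀ * M) = A * M + σ • (blk W i * M) := by
    have := congrArg (fun X => blk X i) heig
    simp only [blk_mul] at this
    rw [← this, hD, blk_add, blk_smul, blk_ZStack_mul, Matrix.add_mul, Matrix.smul_mul]
  have hZ : (1 / (n : ℝ)) • ((ZStack n d)ᵀ * U) * (Mᵀ * M)
      = A * M + (1 / (n : ℝ)) • ((ZStack n d)ᵀ * ((σ • W) * M)) := by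
    rw [Matrix.smul_mul, Matrix.mul_assoc, ← heig, hD, Matrix.add_mul, Matrix.mul_add,
      Matrix.mul_assoc, ← Matrix.mul_assoc _ (ZStack n d), ZStack_gram, Matrix.smul_mul,
      Matrix.one_mul, smul_add, smul_smul, one_div_mul_cancel hn0, one_smul]
  have hX : (blk U i - (1 / (n : ℝ)) • ((ZStack n d)ᵀ * U)) * (Mᵀ * M)
      = σ • (blk W i * M) - (1 / (n : ℝ)) • ((ZStack n d)ᵀ * ((σ • W) * M)) := by
    rw [Matrix.sub_mul, hb, hZ]; abel
  have hMn : ‖M‖ ≤ 1.001 * (κ * (√n * sigmaMin A)) := by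
    refine (l2_opNorm_mul _ _).trans ?_
    rw [norm_transpose]
    exact (mul_le_of_le_one_right (norm_nonneg _) (norm_le_one_of_isometry hU.1)).trans hdat
  have h2 : ‖(1 / (n : ℝ)) • ((ZStack n d)ᵀ * ((σ • W) * M))‖
      ≤ 4.1 * (δ * κ * (√n * sigmaMin A ^ 2)) := by
    rw [norm_smul, Real.norm_eq_abs, abs_of_nonneg (by positivity)]
    have h3 : ‖(ZStack n d)ᵀ * ((σ • W) * M)‖
        ≤ √n * ((4 * δ * (√n * sigmaMin A)) * (1.001 * (κ * (√n * sigmaMin A)))) := by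
      refine (l2_opNorm_mul _ _).trans (mul_le_mul ?_ ?_ (norm_nonneg _) (by positivity))
      · rw [norm_transpose]; exact norm_ZStack_le
      · exact (l2_opNorm_mul _ _).trans (mul_le_mul (R.noise_le hW) hMn (norm_nonneg _)
          (by positivity))
    calc 1 / (n : ℝ) * ‖(ZStack n d)ᵀ * ((σ • W) * M)‖
        ≤ 1 / (n : ℝ) * (√n * ((4 * δ * (√n * sigmaMin A)) *
            (1.001 * (κ * (√n * sigmaMin A))))) := by gcongr
      _ = 1 / (n : ℝ) * (√n * √n) * (4.004 * (δ * κ * (√n * sigmaMin A ^ 2))) := by ring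
      _ = 4.004 * (δ * κ * (√n * sigmaMin A ^ 2)) := by
          rw [hqq, one_div_mul_cancel hn0, one_mul]
      _ ≤ _ := by
          have : 0 ≤ δ * κ * (√n * sigmaMin A ^ 2) := by positivity
          linarith
  have h3 := norm_le_of_mul_gram (X := blk U i - (1 / (n : ℝ)) • ((ZStack n d)ᵀ * U)) (M := M)
    (ℓ := 0.999 * (√n * sigmaMin A)) (r := 11.12 * (δ * κ * (√n * sigmaMin A ^ 2)))
    (by positivity) (by positivity) (fun a => by rw [hM, ← mulVec_mulVec]; exact hlow a) (by
      rw [hX]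
      refine (norm_sub_le _ _).trans ?_
      rw [norm_smul, Real.norm_eq_abs, abs_of_pos R.hσ]
      linarith)
  set g := ‖blk U i - (1 / (n : ℝ)) • ((ZStack n d)ᵀ * U)‖
  have h4 : √n * sigmaMin A ^ 2 * (0.998001 * (√n * g)) ≤
      √n * sigmaMin A ^ 2 * (11.12 * (δ * κ)) := by linarith
  have h5 := le_of_mul_le_mul_left h4 (by have := R.hs; positivity)
  have : 0 ≤ δ * κ := by positivity
  linarith

/-- The blocks of `√n U` are uniformly close to a common orthogonal matrix. -/
lemma exists_isOrth_near_blocks (hW : ‖W‖ ≤ 4 * β)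
    (hU : IsTopSingVecs (ZStack n d * A + σ • W) U)
    (hloo : ∀ i, ∃ U' : Matrix (Fin n × Fin d) (Fin d) ℝ, IsTopSingVecs (ZStack n d * A + σ • mask W i) U' ∧
      ‖blk W i * ((ZStack n d * A + σ • mask W i)ᵀ * U')‖ ≤ 7 * ‖A‖ * β) :
    ∃ Q : Matrix (Fin d) (Fin d) ℝ, IsOrth Q ∧ ∀ i, ‖√n • blk U i - Q‖ ≤ 12 * (δ * κ) := by
  obtain ⟨Q, hQ, hnear⟩ := hU.exists_isOrth_near R.hn (R.noise_le hW) R.hs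
  refine ⟨Q, hQ, fun i => ?_⟩
  obtain ⟨U', hU', hWM⟩ := hloo i
  have h1 := R.norm_blk_sub_mean_le hW hU hU' hWM
  have hqs := R.qs_pos
  rw [mul_div_cancel_right₀ _ hqs.ne'] at hnear
  have hn0 : (n : ℝ) ≠ 0 := by have := R.hn; positivity
  have hq := R.q_one
  have hqq : √(n : ℝ) * √n = n := Real.mul_self_sqrt n.cast_nonneg
  have hsplit : √n • blk U i - Q = √n • (blk U i - (1 / (n : ℝ)) • ((ZStack n d)ᵀ * U))
      + ((1 / √n) • ((ZStack n d)ᵀ * U) - Q) := by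
    rw [smul_sub, smul_smul]
    have : √(n : ℝ) * (1 / n) = 1 / √n := by
      rw [mul_one_div, div_eq_div_iff hn0 (by positivity), hqq, one_mul]
    rw [this]; abel
  rw [hsplit]
  refine (norm_add_le _ _).trans ?_
  rw [norm_smul, Real.norm_eq_abs, abs_of_nonneg (Real.sqrt_nonneg _)]
  have hδ := R.δ_pos
  have hδ' := R.δ_le
  have hκ := R.κ_one
  have h2 : δ ^ 2 ≤ 1 / 100000 * (δ * κ) := by nlinarith
  have : 0 ≤ δ * κ := by positivity
  linarith

section Polar
variable {Q : Matrix (Fin d) (Fin d) ℝ} (hQ : IsOrth Q)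
  (hQU : ∀ i, ‖√n • blk U i - Q‖ ≤ 12 * (δ * κ)) (hS : IsPolarBlocks U S)
include hQ hQU hS

lemma norm_blk_sub_polar_le (i : Fin n) : ‖√n • blk U i - blk S i‖ ≤ 25 * (δ * κ) := by
  refine (((hS i).smul (Real.sqrt_nonneg (n : ℝ))).norm_sub_le hQ).trans ?_
  have h1 := hQU i
  have h2 := pow_le_pow_left₀ (norm_nonneg _) h1 2
  have h3 : δ * κ ≤ 1 / 100000 := by simpa using R.small_pow' (j := 1) (by norm_num)
  have h4 : 0 ≤ δ * κ := mul_nonneg R.δ_pos.le (by linarith [R.κ_one])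
  nlinarith

lemma norm_polar_sub_le (i : Fin n) : ‖blk S i - Q‖ ≤ 37 * (δ * κ) := by
  have h1 := R.norm_blk_sub_polar_le hQ hQU hS i
  have : blk S i - Q = (√n • blk U i - Q) - (√n • blk U i - blk S i) := by abel
  rw [this]
  refine (_root_.norm_sub_le _ _).trans ?_
  linarith [hQU i]

lemma frob_sub_ZStack_le : frob (S - ZStack n d * Q) ≤ √n * (√d * (37 * (δ * κ))) := by
  refine frob_sq_le_of_blk_norm_le fun i => ?_
  have : blk (ZStack n d * Q) i = Q := by
    have h : blk (ZStack n d) i = 1 := by ext a b; simp [blk, ZStack, one_apply]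
    rw [blk_mul, h, Matrix.one_mul]
  rw [blk_sub, this]
  exact R.norm_polar_sub_le hQ hQU hS i

/-- The spectral initialization is close to the leave-one-out initializations. -/
lemma frob_sub_loo_polar_le {i : Fin n} (hW : ‖W‖ ≤ 4 * β)
    (hU : IsTopSingVecs (ZStack n d * A + σ • W) U)
    (hU' : IsTopSingVecs (ZStack n d * A + σ • mask W i) U')
    (hWM : ‖blk W i * ((ZStack n d * A + σ • mask W i)ᵀ * U')‖ ≤ 7 * ‖A‖ * β)
    (hS' : IsPolarBlocks U' S') :
    ∃ O : Matrix (Fin d) (Fin d) ℝ, IsOrth O ∧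
      frob (U - U' * O) * √n ≤ 17 * (δ * κ ^ 2 * √d) ∧
      frob (S - S' * O) ≤ 68 * (δ * κ ^ 2 * √d) := by
  obtain ⟨O, hO, hUO⟩ := R.leave_one_out hW hU hU' hWM
  refine ⟨O, hO, hUO, ?_⟩
  have := frob_blocks_lipschitz hS (hS'.mul_right hO) fun i =>
    (R.norm_blk_sub_polar_le hQ hQU hS i).trans (by
      have : δ * κ ≤ 1 / 100000 := by simpa using R.small_pow' (j := 1) (by norm_num)
      linarith)
  linarith

end Polar

end Regime
end Deterministic

section Conclusion
open scoped Matrix.Norms.L2Operator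

variable {n d m : ℕ} {A : Matrix (Fin d) (Fin m) ℝ}
  {W : Matrix (Fin n × Fin d) (Fin m) ℝ} {σ β δ κ t : ℝ}
  {U U' S S' : Matrix (Fin n × Fin d) (Fin d) ℝ}

/-- A bound on `‖W^(i)ᵀ S^{i,0}‖_F`. -/
noncomputable def crossBound (n d m : ℕ) (β t : ℝ) : ℝ :=
  √n * (√m * √d + t) + β * √n / 200

/-- The concentration properties of the noise on which the analysis rests. -/
structure GoodNoise (A : Matrix (Fin d) (Fin m) ℝ) (W : Matrix (Fin n × Fin d) (Fin m) ℝ)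
    (σ β t : ℝ) : Prop where
  norm_le : ‖W‖ ≤ 4 * β
  norm_blk_le : ∀ i, ‖blk W i‖ ≤ 2 * √m + 4 * √d + 2 * t
  frob_blk_le : ∀ i, frob (blk W i) ≤ √m * √d + t
  frob_mask_le : ∀ i, frob ((mask W i)ᵀ * ZStack n d) ≤ √n * (√m * √d + t)
  norm_blk_mul_le : ∀ i (U' : Matrix (Fin n × Fin d) (Fin d) ℝ),
    IsTopSingVecs (ZStack n d * A + σ • mask W i) U' →
    ‖blk W i * ((ZStack n d * A + σ • mask W i)ᵀ * U')‖ ≤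
      2 * (1.001 * (√n * ‖A‖) * (3 * √d + t))
  frob_blk_mul_le : ∀ i (U' S' : Matrix (Fin n × Fin d) (Fin d) ℝ),
    IsTopSingVecs (ZStack n d * A + σ • mask W i) U' → IsPolarBlocks U' S' →
    (∀ j, ‖√n • blk U' j - blk S' j‖ ≤ 1 / 2) →
    frob ((mask W i)ᵀ * S') ≤ crossBound n d m β t →
    frob (blk W i * ((mask W i)ᵀ * S')) ≤ (√d + t) * crossBound n d m β t

lemma cross_term_le {x y q t : ℝ} (hy : 1 ≤ y) (hxy : y ≤ x) (hq : 1.4 ≤ q) (ht : 0 ≤ t) :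
    (2 * x + 4 * y + 2 * t) * (x * y + t) + (y + t) * (q * (x * y + t))
      ≤ 2 * y * (q * (y + t) + x) ^ 2 := by
  have h0 : x * y + t ≤ y * (x + t) := by nlinarith
  have h1 : (x + t) * (2 * x + 4 * y + 2 * t + q * (y + t)) ≤ 2 * (q * (y + t) + x) ^ 2 := by
    have a1 : 1.4 * (x * (y + t)) ≤ q * (x * (y + t)) :=
      mul_le_mul_of_nonneg_right hq (by nlinarith)
    have a2 : 1.4 * (y + t) ^ 2 ≤ q * (y + t) ^ 2 :=
      mul_le_mul_of_nonneg_right hq (by positivity)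
    have a3 : 1.4 * (q * (y + t) ^ 2) ≤ q * (q * (y + t) ^ 2) :=
      mul_le_mul_of_nonneg_right hq (by nlinarith [sq_nonneg (y + t)])
    have a4 : q * (t * (y + t)) ≤ q * (y + t) ^ 2 :=
      mul_le_mul_of_nonneg_left (by nlinarith) (by linarith)
    nlinarith [mul_nonneg (by linarith : (0 : ℝ) ≤ x) ht]
  have h2 : 0 ≤ 2 * x + 4 * y + 2 * t + q * (y + t) := by nlinarith
  calc (2 * x + 4 * y + 2 * t) * (x * y + t) + (y + t) * (q * (x * y + t))
      = (2 * x + 4 * y + 2 * t + q * (y + t)) * (x * y + t) := by ring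
    _ ≤ (2 * x + 4 * y + 2 * t + q * (y + t)) * (y * (x + t)) :=
        mul_le_mul_of_nonneg_left h0 h2
    _ = y * ((x + t) * (2 * x + 4 * y + 2 * t + q * (y + t))) := by ring
    _ ≤ y * (2 * (q * (y + t) + x) ^ 2) := mul_le_mul_of_nonneg_left h1 (by linarith)
    _ = _ := by ring

lemma dF_le (X Y : Matrix (Fin n × Fin d) (Fin d) ℝ) {Q : Matrix (Fin d) (Fin d) ℝ}
    (hQ : IsOrth Q) : dF X Y ≤ frob (X - Y * Q) :=
  csInf_le ⟨0, by rintro _ ⟨Q, -, rfl⟩; exact frob_nonneg _⟩ ⟨Q, hQ, rfl⟩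

namespace Regime
variable (R : Regime n A σ β δ κ) (G : GoodNoise A W σ β t)
  (hβ : β = √n * (√d + t) + √m) (ht : 0 ≤ t)
include R G hβ ht

lemma blk_mul_loo_le {i : Fin n} (hU' : IsTopSingVecs (ZStack n d * A + σ • mask W i) U') :
    ‖blk W i * ((ZStack n d * A + σ • mask W i)ᵀ * U')‖ ≤ 7 * ‖A‖ * β := by
  refine (G.norm_blk_mul_le i U' hU').trans ?_
  have h1 : √n * (3 * √d + t) ≤ 3 * β := by
    rw [hβ]
    nlinarith [mul_nonneg (Real.sqrt_nonneg (n : ℝ)) ht, Real.sqrt_nonneg (m : ℝ)]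
  have h2 := mul_le_mul_of_nonneg_left h1 (norm_nonneg A)
  have h3 := mul_nonneg (norm_nonneg A) R.hβ.le
  linarith

lemma frob_blk_mul_transpose_mul_le (hn : 2 ≤ n) (hdm : d ≤ m)
    (hU : IsTopSingVecs (ZStack n d * A + σ • W) U) (hS : IsPolarBlocks U S)
    {Q : Matrix (Fin d) (Fin d) ℝ} (hQ : IsOrth Q)
    (hQU : ∀ i, ‖√n • blk U i - Q‖ ≤ 12 * (δ * κ)) (i : Fin n) :
    frob (blk W i * Wᵀ * S) ≤ 3 * √d * β ^ 2 := by
  obtain ⟨U', hU'⟩ := exists_isTopSingVecs (d := d) (ZStack n d * A + σ • mask W i)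
    (by simpa using Nat.le_mul_of_pos_left d R.hn)
  choose S'' hS'' using fun j => exists_isPolar (blk U' j)
  obtain ⟨S', hS'⟩ : ∃ S' : Matrix (Fin n × Fin d) (Fin d) ℝ, IsPolarBlocks U' S' :=
    ⟨stack S'', fun j => hS'' j⟩
  obtain ⟨O, hO, hUO, hSO⟩ := R.frob_sub_loo_polar_le hQ hQU hS G.norm_le hU hU'
    (R.blk_mul_loo_le G hβ ht hU') hS'
  have hκ := R.κ_one
  have hδ := R.δ_pos.le
  have hβ0 := R.hβ.le
  have hy := R.y_one
  have hq := R.q_one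
  have hs2 := R.small_pow (j := 2) (by norm_num)
  have hs1 := R.small_pow (j := 1) (by norm_num)
  rw [pow_one] at hs1
  have hWn := G.norm_le
  have hmn := R.mask_noise hWn i
  have hSZ := R.frob_sub_ZStack_le hQ hQU hS
  have hclose : ∀ j, ‖√n • blk U' j - blk S' j‖ ≤ 1 / 2 := by
    intro j
    rw [← hO.norm_mul_right, Matrix.sub_mul, Matrix.smul_mul]
    have e : √n • (blk U' j * O) - blk S' j * O
        = (√n • blk U j - blk S j) - √n • blk (U - U' * O) j + blk (S - S' * O) j := by
      rw [blk_sub, blk_sub, blk_mul, blk_mul, smul_sub]; abel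
    rw [e]
    have h1 := R.norm_blk_sub_polar_le hQ hQU hS j
    have h2 : ‖√n • blk (U - U' * O) j‖ ≤ 17 * (δ * κ ^ 2 * √d) := by
      rw [norm_smul, Real.norm_eq_abs, abs_of_nonneg (Real.sqrt_nonneg _), mul_comm]
      exact (mul_le_mul_of_nonneg_right ((norm_le_frob _).trans (frob_blk_le _ j))
        (Real.sqrt_nonneg _)).trans hUO
    have h3 := ((norm_le_frob _).trans (frob_blk_le _ j)).trans hSO
    have h4 : δ * κ ≤ 1 / 100000 := by simpa using R.small_pow' (j := 1) (by norm_num)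
    have h5 := norm_add_le ((√n • blk U j - blk S j) - √n • blk (U - U' * O) j)
      (blk (S - S' * O) j)
    have h6 := _root_.norm_sub_le (√n • blk U j - blk S j) (√n • blk (U - U' * O) j)
    linarith
  have hcross : frob ((mask W i)ᵀ * S') ≤ crossBound n d m β t := by
    have h1 : (mask W i)ᵀ * S' * O = (mask W i)ᵀ * ZStack n d * Q
        + (mask W i)ᵀ * (S' * O - ZStack n d * Q) := by
      rw [Matrix.mul_sub]; simp only [Matrix.mul_assoc]; abel
    rw [← hO.frob_mul_right, h1]
    have h2 : frob (S' * O - ZStack n d * Q) ≤ √n * (105 / 100000) := by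
      have e : S' * O - ZStack n d * Q = (S - ZStack n d * Q) - (S - S' * O) := by abel
      rw [e]
      refine (frob_sub_le _ _).trans ?_
      have : √n * (√d * (37 * (δ * κ))) ≤ √n * (37 / 100000) :=
        mul_le_mul_of_nonneg_left (by linarith) (by positivity)
      linarith
    have h3 : frob ((mask W i)ᵀ * (S' * O - ZStack n d * Q)) ≤
        (4 * β) * (√n * (105 / 100000)) := by
      refine (frob_mul_le _ _).trans (mul_le_mul ?_ h2 (frob_nonneg _) (by positivity))
      rwa [norm_transpose]
    refine (frob_add_le _ _).trans ?_
    rw [hQ.frob_mul_right, crossBound]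
    have := G.frob_mask_le i
    have : 0 ≤ β * √n := by positivity
    linarith
  have hE6 := G.frob_blk_mul_le i U' S' hU' hS' hclose hcross
  have hsplit : blk W i * Wᵀ * S = blk W i * ((blk W i)ᵀ * blk S i)
      + blk W i * ((mask W i)ᵀ * S') * O + blk W i * ((mask W i)ᵀ * (S - S' * O)) := by
    rw [← sub_mask_transpose_mul, transpose_sub, Matrix.sub_mul, Matrix.mul_sub, Matrix.mul_sub,
      Matrix.mul_sub]
    simp only [Matrix.mul_assoc]
    abel
  have b1 : frob (blk W i * ((blk W i)ᵀ * blk S i))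
      ≤ (2 * √m + 4 * √d + 2 * t) * (√m * √d + t) := by
    refine (frob_mul_le _ _).trans (mul_le_mul (G.norm_blk_le i) ?_ (frob_nonneg _) (by positivity))
    rw [(hS i).1.frob_mul_right, frob_transpose]
    exact G.frob_blk_le i
  have b3 : frob (blk W i * ((mask W i)ᵀ * (S - S' * O))) ≤ (4 * β) * ((4 * β) * (68 / 100000)) := by
    refine (frob_mul_le _ _).trans (mul_le_mul ((norm_blk_le W i).trans hWn) ?_ (frob_nonneg _)
      (by positivity))
    refine (frob_mul_le _ _).trans (mul_le_mul ?_ (by linarith) (frob_nonneg _) (by positivity))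
    rwa [norm_transpose]
  rw [hsplit]
  refine (frob_add_le _ _).trans ((add_le_add (frob_add_le _ _) b3).trans ?_)
  rw [hO.frob_mul_right]
  have hq2 : (1.4 : ℝ) ≤ √n := by
    refine Real.le_sqrt_of_sq_le ?_
    have : (2 : ℝ) ≤ n := by exact_mod_cast hn
    norm_num; linarith
  have hxy : √(d : ℝ) ≤ √m := Real.sqrt_le_sqrt (by exact_mod_cast hdm)
  have hct := cross_term_le hy hxy hq2 ht
  rw [← hβ] at hct
  have h7 : (√d + t) * (β * √n / 200) ≤ β ^ 2 / 200 := by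
    have : √n * (√d + t) ≤ β := by rw [hβ]; linarith [Real.sqrt_nonneg (m : ℝ)]
    have := mul_le_mul_of_nonneg_left this hβ0
    linarith
  have h8 : β ^ 2 ≤ √d * β ^ 2 := le_mul_of_one_le_left (sq_nonneg _) hy
  rw [crossBound] at hE6
  have h9 := sq_nonneg β
  linarith

theorem conclusion (hn : 2 ≤ n) (hdm : d ≤ m) (hU : IsTopSingVecs (ZStack n d * A + σ • W) U)
    (hS : IsPolarBlocks U S) :
    (∃ Q, IsOrth Q ∧ ∀ i, opNorm (blk S i - Q) ≤ 120 * κ ^ 2 * δ) ∧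
    dF S (ZStack n d) ≤ 1 / (32 * κ ^ 2 * √d) * (√n * √d) / 2 ∧
    (∀ i, frob (blk W i * Wᵀ * S) ≤ 3 * √d * β ^ 2) ∧
    ∀ (i : Fin n) (U' S' : Matrix (Fin n × Fin d) (Fin d) ℝ),
      IsTopSingVecs (ZStack n d * A + σ • mask W i) U' → IsPolarBlocks U' S' →
      dF S S' ≤ 1 / (32 * κ ^ 2 * √d) * √d := by
  have hκ := R.κ_one
  have hδ := R.δ_pos.le
  have hy := R.y_one
  obtain ⟨Q, hQ, hQU⟩ := R.exists_isOrth_near_blocks G.norm_le hU fun i => by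
    obtain ⟨U', hU'⟩ := exists_isTopSingVecs (d := d) (ZStack n d * A + σ • mask W i)
      (by simpa using Nat.le_mul_of_pos_left d R.hn)
    exact ⟨U', hU', R.blk_mul_loo_le G hβ ht hU'⟩
  refine ⟨⟨Q, hQ, fun i => ?_⟩, ?_, ?_, fun i U' S' hU' hS' => ?_⟩
  · rw [opNorm_eq_norm]
    have := R.norm_polar_sub_le hQ hQU hS i
    have h2 := R.δκ_le_δκ_sq
    have : 0 ≤ δ * κ := by positivity
    linarith
  · refine (dF_le S _ hQ).trans ((R.frob_sub_ZStack_le hQ hQU hS).trans ?_)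
    have h1 : 37 * (δ * κ) ≤ 1 / (32 * κ ^ 2 * √d) / 2 := by
      rw [div_div, le_div_iff₀ (by positivity)]
      have := R.small_pow (j := 3) (by norm_num)
      linarith
    have := mul_le_mul_of_nonneg_left h1 (by positivity : 0 ≤ √(n : ℝ) * √d)
    linarith
  · exact R.frob_blk_mul_transpose_mul_le G hβ ht hn hdm hU hS hQ hQU
  · obtain ⟨O, hO, -, hSO⟩ := R.frob_sub_loo_polar_le hQ hQU hS G.norm_le hU hU'
      (R.blk_mul_loo_le G hβ ht hU') hS'
    refine (dF_le S S' hO).trans (hSO.trans ?_)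
    have h1 : 68 * (δ * κ ^ 2) ≤ 1 / (32 * κ ^ 2 * √d) := by
      rw [le_div_iff₀ (by positivity)]
      have := R.small
      linarith
    have := mul_le_mul_of_nonneg_right h1 (by positivity : 0 ≤ √(d : ℝ))
    linarith

end Regime
end Conclusion

section Concentration
open scoped Matrix.Norms.L2Operator
open ProbabilityTheory

lemma integral_exp_mul_sq_gaussian (a : ℝ) :
    ∫ y, Real.exp (a * y ^ 2) ∂(gaussianReal 0 1) = (√(1 - 2 * a))⁻¹ := by
  rw [integral_gaussianReal_eq_integral_smul one_ne_zero]
  have : ∀ y : ℝ, gaussianPDFReal 0 1 y • Real.exp (a * y ^ 2)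
      = (√(2 * Real.pi))⁻¹ * Real.exp (-(1 / 2 - a) * y ^ 2) := by
    intro y
    rw [gaussianPDFReal_def]
    simp only [NNReal.coe_one, mul_one, sub_zero, smul_eq_mul]
    rw [mul_assoc, ← Real.exp_add]
    ring_nf
  simp_rw [this]
  rw [integral_const_mul, integral_gaussian, ← Real.sqrt_inv, ← Real.sqrt_inv, ← Real.sqrt_mul (by positivity)]
  congr 1
  have : Real.pi ≠ 0 := Real.pi_ne_zero
  by_cases h : 1 - 2 * a = 0
  · rw [h, show (1 : ℝ) / 2 - a = 0 by linarith]; simp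
  · rw [show (1 : ℝ) / 2 - a = (1 - 2 * a) / 2 by ring]
    field_simp

variable {J : Type*} [Fintype J]

/-- The standard Gaussian measure on `ℝ^J`. -/
noncomputable abbrev gaussPi (J : Type*) [Fintype J] : Measure (J → ℝ) :=
  Measure.pi fun _ : J => gaussianReal 0 1

lemma inv_sqrt_one_sub_le {α r t : ℝ} (h0 : 0 ≤ α) (h1 : α ≤ 1) (hr : 0 < r) (ht : 0 ≤ t) :
    (√(1 - 2 * (t / (r + t) / 2 * α)))⁻¹ ≤ Real.exp (t / (2 * r) * α) := by
  have hrt : 0 < r + t := by linarith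
  have hb : Real.exp (-(t / r * α)) ≤ 1 - t / (r + t) * α := by
    have e1 : Real.exp (-(t / r)) ≤ 1 + -(t / (r + t)) := by
      rw [Real.exp_neg, inv_le_comm₀ (Real.exp_pos _) (by
        rw [← sub_eq_add_neg, sub_pos, div_lt_one hrt]; linarith)]
      have : (1 + -(t / (r + t)))⁻¹ = t / r + 1 := by
        have : 1 + -(t / (r + t)) = r / (r + t) := by field_simp; ring
        rw [this, inv_div]; field_simp; ring
      rw [this]
      exact Real.add_one_le_exp _
    have e2 := Real.rpow_le_rpow (Real.exp_pos _).le e1 h0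
    rw [← Real.exp_mul] at e2
    have e3 := rpow_one_add_le_one_add_mul_self (s := -(t / (r + t))) (by
      rw [neg_le_neg_iff, div_le_one hrt]; linarith) h0 h1
    calc Real.exp (-(t / r * α)) = Real.exp (-(t / r) * α) := by rw [neg_mul]
      _ ≤ _ := e2.trans e3
      _ = _ := by ring
  rw [inv_le_comm₀ ?_ (Real.exp_pos _), ← Real.exp_neg]
  · have : -(t / (2 * r) * α) = -(t / r * α) / 2 := by field_simp
    rw [this, Real.exp_half]
    exact Real.sqrt_le_sqrt (hb.trans (le_of_eq (by ring)))
  · refine Real.sqrt_pos.2 (lt_of_lt_of_le (Real.exp_pos _) (hb.trans (le_of_eq (by ring))))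

/-- Chernoff bound for weighted chi-square variables. -/
lemma measure_weighted_sq_ge_le {α : J → ℝ} (h0 : ∀ j, 0 ≤ α j) (h1 : ∀ j, α j ≤ 1) {r t : ℝ}
    (hr : 0 < r) (ht : 0 ≤ t) (hα : ∑ j, α j ≤ r ^ 2) :
    (gaussPi J) {y | (r + t) ^ 2 ≤ ∑ j, α j * y j ^ 2} ≤ ENNReal.ofReal (Real.exp (-t ^ 2 / 2)) := by
  set s := t / (r + t) / 2 with hs
  have hrt : 0 < r + t := by linarith
  have hs0 : 0 ≤ s := by positivity
  have hfun : ∀ y : J → ℝ, Real.exp (s * ∑ j, α j * y j ^ 2)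
      = ∏ j, Real.exp ((s * α j) * y j ^ 2) := by
    intro y; rw [← Real.exp_sum, Finset.mul_sum]; simp only [mul_assoc]
  have hint : ∫ y, Real.exp (s * ∑ j, α j * y j ^ 2) ∂(gaussPi J)
      = ∏ j, (√(1 - 2 * (s * α j)))⁻¹ := by
    simp_rw [hfun]
    rw [integral_fintype_prod_eq_prod (fun j (x : ℝ) => Real.exp ((s * α j) * x ^ 2))]
    simp_rw [integral_exp_mul_sq_gaussian]
  have hpos : ∀ j, 0 < 1 - 2 * (s * α j) := by
    intro j
    have : 2 * s < 1 := by rw [hs, mul_div_cancel₀ _ two_ne_zero, div_lt_one hrt]; linarith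
    have := mul_le_mul_of_nonneg_left (h1 j) (by positivity : 0 ≤ 2 * s)
    linarith
  have hintg : Integrable (fun y => Real.exp (s * ∑ j, α j * y j ^ 2)) (gaussPi J) := by
    refine not_imp_comm.1 integral_undef ?_
    rw [hint]
    exact Finset.prod_ne_zero_iff.2 fun j _ => (inv_pos.2 (Real.sqrt_pos.2 (hpos j))).ne'
  have hch := measure_ge_le_exp_mul_mgf ((r + t) ^ 2) hs0 hintg
  rw [mgf, hint] at hch
  rw [← ofReal_measureReal]
  refine ENNReal.ofReal_le_ofReal (hch.trans ?_)
  have hprod : ∏ j, (√(1 - 2 * (s * α j)))⁻¹ ≤ Real.exp (r * t / 2) := by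
    calc ∏ j, (√(1 - 2 * (s * α j)))⁻¹ ≤ ∏ j, Real.exp (t / (2 * r) * α j) :=
          Finset.prod_le_prod (fun j _ => inv_nonneg.2 (Real.sqrt_nonneg _))
            fun j _ => inv_sqrt_one_sub_le (h0 j) (h1 j) hr ht
      _ = Real.exp (t / (2 * r) * ∑ j, α j) := by rw [← Real.exp_sum, Finset.mul_sum]
      _ ≤ Real.exp (t / (2 * r) * r ^ 2) := by gcongr
      _ = _ := by congr 1; field_simp
  calc Real.exp (-s * (r + t) ^ 2) * ∏ j, (√(1 - 2 * (s * α j)))⁻¹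
      ≤ Real.exp (-s * (r + t) ^ 2) * Real.exp (r * t / 2) := by gcongr
    _ = Real.exp (-t ^ 2 / 2) := by
        rw [← Real.exp_add]
        congr 1
        rw [hs]; field_simp; ring

/-- Rotation invariance of the standard Gaussian measure. -/
lemma measurePreserving_rotation [DecidableEq J] {O : Matrix J J ℝ} (hO : Oᵀ * O = 1) :
    MeasurePreserving (fun y => O *ᵥ y) (gaussPi J) (gaussPi J) := by
  have hortho : Orthonormal ℝ fun j => (WithLp.toLp 2 (Oᵀ j) : EuclideanSpace ℝ J) := by
    rw [orthonormal_iff_ite]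
    intro i j
    have := congrFun (congrFun hO i) j
    rw [mul_apply, one_apply] at this
    rw [← this]
    simp [PiLp.inner_apply, mul_comm]
  have hspan := hortho.linearIndependent.span_eq_top_of_card_eq_finrank' (by simp)
  let b : OrthonormalBasis J ℝ (EuclideanSpace ℝ J) := OrthonormalBasis.mk hortho hspan.ge
  have hb : ∀ j, b j = WithLp.toLp 2 (Oᵀ j) := by intro j; simp [b]
  have h1 := stdGaussian_eq_map_pi_orthonormalBasis b
  rw [← map_pi_eq_stdGaussian] at h1
  have hm : Measurable fun y : J → ℝ => O *ᵥ y := by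
    exact (Continuous.matrix_mulVec continuous_const continuous_id).measurable
  refine ⟨hm, ?_⟩
  have h2 := congrArg (Measure.map (WithLp.ofLp : EuclideanSpace ℝ J → J → ℝ)) h1
  rw [Measure.map_map (by fun_prop) (by fun_prop), Measure.map_map (by fun_prop) (by fun_prop)] at h2
  have e1 : (WithLp.ofLp : EuclideanSpace ℝ J → J → ℝ) ∘ WithLp.toLp 2 = id := rfl
  have e2 : (WithLp.ofLp : EuclideanSpace ℝ J → J → ℝ) ∘ (fun x => ∑ i, x i • b i)
      = fun y : J → ℝ => O *ᵥ y := by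
    funext y p
    simp [hb, mulVec, dotProduct, mul_comm]
  rw [e1, e2, Measure.map_id] at h2
  exact h2.symm

variable {K : Type*} [Fintype K] [DecidableEq K]

/-- Concentration of the norm of a linear image of a standard Gaussian vector. -/
theorem measure_vnorm_mulVec_ge_le [DecidableEq J] (B : Matrix K J ℝ) {F ℓ t : ℝ} (hF : frob B ≤ F)
    (hℓ : ‖B‖ ≤ ℓ) (hF0 : 0 < F) (hℓ0 : 0 < ℓ) (ht : 0 ≤ t) :
    (gaussPi J) {x | F + ℓ * t ≤ vnorm (B *ᵥ x)} ≤ ENNReal.ofReal (Real.exp (-t ^ 2 / 2)) := by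
  have hH : (Bᵀ * B).IsHermitian := by
    rw [← conjTranspose_eq_transpose_of_trivial]; exact isHermitian_conjTranspose_mul_self B
  set O : Matrix J J ℝ := (hH.eigenvectorUnitary : Matrix J J ℝ) with hOdef
  have hO : Oᵀ * O = 1 := by
    have := (Unitary.mem_iff.1 hH.eigenvectorUnitary.2).1
    rwa [star_eq_conjTranspose, conjTranspose_eq_transpose_of_trivial] at this
  have hdiag : (B * O)ᵀ * (B * O) = diagonal hH.eigenvalues := by
    have h1 : Bᵀ * B * O = O * diagonal hH.eigenvalues := by
      ext i j
      have := congrFun (hH.mulVec_eigenvectorBasis j) i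
      rw [mul_diagonal, mul_apply]
      simp only [mulVec, dotProduct, Pi.smul_apply, smul_eq_mul] at this
      rw [mul_comm]
      exact this
    rw [transpose_mul, Matrix.mul_assoc, ← Matrix.mul_assoc Bᵀ, h1, ← Matrix.mul_assoc, hO,
      Matrix.one_mul]
  set ev := hH.eigenvalues
  have hq : ∀ y : J → ℝ, vnorm (B *ᵥ (O *ᵥ y)) ^ 2 = ∑ j, ev j * y j ^ 2 := by
    intro y
    rw [vnorm_sq, mulVec_mulVec, dotProduct_mulVec, ← mulVec_transpose, mulVec_mulVec, hdiag,
      dotProduct]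
    refine Finset.sum_congr rfl fun j _ => ?_
    rw [mulVec_diagonal]; ring
  have hev : ∀ j, ev j = vnorm (B *ᵥ (O *ᵥ Pi.single j 1)) ^ 2 := by
    intro j
    rw [hq]
    simp [Pi.single_apply]
  have hev0 : ∀ j, 0 ≤ ev j := fun j => by rw [hev]; exact sq_nonneg _
  have hev1 : ∀ j, ev j ≤ ℓ ^ 2 := fun j => by
    rw [hev]
    refine pow_le_pow_left₀ (vnorm_nonneg _) ?_ 2
    refine (vnorm_mulVec_le _ _).trans ?_
    rw [vnorm_mulVec_of_isometry hO]
    have : vnorm (Pi.single j (1 : ℝ)) = 1 := by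
      rw [← sq_eq_sq₀ (vnorm_nonneg _) zero_le_one, vnorm_sq]; simp
    rw [this, mul_one]; exact hℓ
  have hsum : ∑ j, ev j ≤ F ^ 2 := by
    have h2 : ∑ j, ev j = frob B ^ 2 := by
      rw [frob_sq_trace, ← Matrix.trace_diagonal, ← hdiag, transpose_mul, Matrix.mul_assoc,
        trace_mul_comm, Matrix.mul_assoc, Matrix.mul_assoc, mul_eq_one_comm.1 hO, Matrix.mul_one]
    rw [h2]; exact pow_le_pow_left₀ (frob_nonneg _) hF 2
  have hmeas : MeasurableSet {x : J → ℝ | F + ℓ * t ≤ vnorm (B *ᵥ x)} := by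
    refine (isClosed_le continuous_const ?_).measurableSet
    unfold vnorm
    have : Continuous fun x : J → ℝ => B *ᵥ x :=
      Continuous.matrix_mulVec continuous_const continuous_id
    fun_prop
  rw [← (measurePreserving_rotation hO).measure_preimage hmeas.nullMeasurableSet]
  refine le_trans (measure_mono ?_) (measure_weighted_sq_ge_le (α := fun j => ev j / ℓ ^ 2)
    (fun j => div_nonneg (hev0 j) (sq_nonneg _))
    (fun j => div_le_one_of_le₀ (hev1 j) (sq_nonneg _)) (r := F / ℓ) (div_pos hF0 hℓ0) ht ?_)
  · intro y hy
    simp only [Set.mem_preimage, Set.mem_ofPred_eq] at hy ⊢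
    have h3 := pow_le_pow_left₀ (by positivity) hy 2
    rw [hq] at h3
    have h4 : ∑ j, ev j / ℓ ^ 2 * y j ^ 2 = (∑ j, ev j * y j ^ 2) / ℓ ^ 2 := by
      rw [Finset.sum_div]; exact Finset.sum_congr rfl fun j _ => by ring
    rw [h4, le_div_iff₀ (by positivity), ← mul_pow, add_mul, div_mul_cancel₀ _ hℓ0.ne', mul_comm t]
    exact h3
  · rw [← Finset.sum_div, div_pow]
    exact div_le_div_of_nonneg_right hsum (sq_nonneg _)

end Concentration

section GaussianMatrix
open scoped Matrix.Norms.L2Operator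
open ProbabilityTheory

variable {ι κ ρ τ : Type*} [Fintype ι] [Fintype κ] [Fintype ρ] [Fintype τ]
  [DecidableEq ι] [DecidableEq κ] [DecidableEq ρ] [DecidableEq τ]

lemma measurePreserving_uncurry :
    MeasurePreserving (fun (X : ι → κ → ℝ) (p : ι × κ) => X p.1 p.2) (stdGaussian ι κ)
      (gaussPi (ι × κ)) := by
  have hm : Measurable fun (X : ι → κ → ℝ) (p : ι × κ) => X p.1 p.2 := by fun_prop
  refine ⟨hm, (Measure.pi_eq fun s hs => ?_).symm⟩
  rw [Measure.map_apply hm (MeasurableSet.univ_pi hs)]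
  have : (fun (X : ι → κ → ℝ) (p : ι × κ) => X p.1 p.2) ⁻¹' Set.univ.pi s
      = Set.univ.pi fun i => Set.univ.pi fun j => s (i, j) := by
    ext X; simp
  rw [this, stdGaussian, Measure.pi_pi]
  simp_rw [Measure.pi_pi]
  rw [Fintype.prod_prod_type]

lemma vnorm_sum_mul (M : Matrix ρ τ ℝ) : vnorm (fun p : ρ × τ => M p.1 p.2) = frob M := by
  rw [vnorm, frob, Fintype.sum_prod_type]

/-- Concentration of the Frobenius norm of `L X R` for a standard Gaussian matrix `X`. -/
theorem measure_frob_mul_mul_ge_le (L : Matrix ρ ι ℝ) (R : Matrix κ τ ℝ) {F ℓ t : ℝ}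
    (hF : frob L * frob R ≤ F) (hℓ : ‖L‖ * ‖R‖ ≤ ℓ) (hF0 : 0 < F) (hℓ0 : 0 < ℓ) (ht : 0 ≤ t) :
    stdGaussian ι κ {X | F + ℓ * t ≤ frob (L * of X * R)}
      ≤ ENNReal.ofReal (Real.exp (-t ^ 2 / 2)) := by
  set B : Matrix (ρ × τ) (ι × κ) ℝ := of fun p q => L p.1 q.1 * R q.2 p.2 with hB
  have hBx : ∀ X : ι → κ → ℝ, vnorm (B *ᵥ fun p => X p.1 p.2) = frob (L * of X * R) := by
    intro X
    rw [← vnorm_sum_mul]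
    congr 1
    funext p
    simp only [mulVec, dotProduct, hB, of_apply, mul_apply, Fintype.sum_prod_type, Finset.sum_mul]
    rw [Finset.sum_comm]
    exact Finset.sum_congr rfl fun _ _ => Finset.sum_congr rfl fun _ _ => by ring
  have hBF : frob B ≤ F := by
    refine le_of_eq_of_le ?_ hF
    rw [← sq_eq_sq₀ (frob_nonneg _) (mul_nonneg (frob_nonneg _) (frob_nonneg _)), mul_pow,
      frob_sq, frob_sq, frob_sq]
    simp only [hB, of_apply, Fintype.sum_prod_type, mul_pow]
    simp_rw [← Finset.mul_sum, Finset.sum_mul]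
    refine Finset.sum_congr rfl fun p _ => ?_
    rw [Finset.sum_comm]
    refine Finset.sum_congr rfl fun q _ => ?_
    rw [← Finset.mul_sum]
    congr 1
    exact Finset.sum_comm
  have hBℓ : ‖B‖ ≤ ℓ := by
    refine norm_le_of_vnorm_mulVec_le hℓ0.le fun x => ?_
    have h1 := hBx fun i j => x (i, j)
    have h2 := vnorm_sum_mul (of fun i j => x (i, j))
    simp only [of_apply] at h1 h2
    rw [h1, h2]
    calc frob (L * of (fun i j => x (i, j)) * R)
        ≤ frob (L * of (fun i j => x (i, j))) * ‖R‖ := frob_mul_le' _ _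
      _ ≤ ‖L‖ * frob (of fun i j => x (i, j)) * ‖R‖ := by gcongr; exact frob_mul_le _ _
      _ = ‖L‖ * ‖R‖ * frob (of fun i j => x (i, j)) := by ring
      _ ≤ _ := mul_le_mul_of_nonneg_right hℓ (frob_nonneg _)
  have hmeas : MeasurableSet {x : ι × κ → ℝ | F + ℓ * t ≤ vnorm (B *ᵥ x)} := by
    refine (isClosed_le continuous_const ?_).measurableSet
    unfold vnorm
    have : Continuous fun x : ι × κ → ℝ => B *ᵥ x :=
      Continuous.matrix_mulVec continuous_const continuous_id
    fun_prop
  refine le_trans (le_of_eq ?_) (measure_vnorm_mulVec_ge_le B hBF hBℓ hF0 hℓ0 ht)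
  rw [← measurePreserving_uncurry.measure_preimage hmeas.nullMeasurableSet]
  congr 1
  ext X
  simp only [Set.mem_preimage, Set.mem_ofPred_eq, hBx]

/-- A finite `1/2`-net of the unit sphere of `ℝ^k`. -/
lemma exists_net (k : ℕ) : ∃ T : Finset (Fin k → ℝ), T.card ≤ 5 ^ k ∧ (∀ v ∈ T, vnorm v = 1) ∧
    ∀ u, vnorm u = 1 → ∃ v ∈ T, vnorm (u - v) ≤ 1 / 2 := by
  classical
  let P : Finset (Fin k → ℝ) → Prop := fun T => (∀ v ∈ T, vnorm v = 1) ∧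
    ∀ v ∈ T, ∀ w ∈ T, v ≠ w → 1 / 2 ≤ vnorm (v - w)
  have hcard : ∀ T, P T → T.card ≤ 5 ^ k := by
    intro T hT
    let f : (Fin k → ℝ) → EuclideanSpace ℝ (Fin k) := fun v => WithLp.toLp 2 ((2 : ℝ) • v)
    have hf : Function.Injective f := by
      intro v w h
      have h' := congrArg WithLp.ofLp h
      exact smul_right_injective _ (two_ne_zero : (2 : ℝ) ≠ 0) h'
    have hn : ∀ v w, ‖f v - f w‖ = 2 * vnorm (v - w) := by
      intro v w
      rw [vnorm_eq_norm]
      have : f v - f w = (2 : ℝ) • WithLp.toLp 2 (v - w) := by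
        ext i; simp [f, mul_sub]
      rw [this, norm_smul]; norm_num
    have hn0 : ∀ v, ‖f v‖ = 2 * vnorm v := by
      intro v
      have := hn v 0
      simpa [f] using this
    have := Besicovitch.card_le_of_separated (T.image f) (by
      intro c hc
      obtain ⟨v, hv, rfl⟩ := Finset.mem_image.1 hc
      rw [hn0, hT.1 v hv]; norm_num) (by
      intro c hc c' hc' hne
      obtain ⟨v, hv, rfl⟩ := Finset.mem_image.1 hc
      obtain ⟨w, hw, rfl⟩ := Finset.mem_image.1 hc'
      rw [hn]
      have := hT.2 v hv w hw fun h => hne (by rw [h])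
      linarith)
    rwa [Finset.card_image_of_injective _ hf, finrank_euclideanSpace_fin] at this
  have hne : {c | ∃ T, P T ∧ T.card = c}.Nonempty := ⟨0, ∅, by simp [P], rfl⟩
  have hbd : BddAbove {c | ∃ T, P T ∧ T.card = c} :=
    ⟨5 ^ k, by rintro _ ⟨T, hT, rfl⟩; exact hcard T hT⟩
  obtain ⟨T, hT, hTc⟩ := Nat.sSup_mem hne hbd
  refine ⟨T, hcard T hT, hT.1, fun u hu => ?_⟩
  by_contra! hcon
  have hsymm : ∀ v w : Fin k → ℝ, vnorm (v - w) = vnorm (w - v) := fun v w => by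
    rw [← vnorm_neg, neg_sub]
  have hu' : u ∉ T := fun h => by
    have h1 := hcon u h
    have : vnorm (u - u) = 0 := by rw [vnorm_eq_zero]; exact sub_self u
    linarith
  have hT' : P (insert u T) := by
    refine ⟨fun v hv => ?_, fun v hv w hw hvw => ?_⟩
    · rcases Finset.mem_insert.1 hv with rfl | hv
      exacts [hu, hT.1 v hv]
    · rcases Finset.mem_insert.1 hv with hv' | hv' <;> rcases Finset.mem_insert.1 hw with hw' | hw'
      · exact absurd (hv'.trans hw'.symm) hvw
      · rw [hv']; exact (hcon w hw').le
      · rw [hw', hsymm]; exact (hcon v hv').le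
      · exact hT.2 v hv' w hw' hvw
  have := le_csSup hbd ⟨_, hT', rfl⟩
  rw [Finset.card_insert_of_notMem hu', ← hTc] at this
  lia

lemma exists_net_norm (k : ℕ) : ∃ T : Finset (Fin k → ℝ), T.card ≤ 5 ^ k ∧
    (∀ v ∈ T, vnorm v = 1) ∧ ∀ (X : Matrix ρ (Fin k) ℝ) (r : ℝ), 0 < r → 2 * r ≤ ‖X‖ →
      ∃ v ∈ T, r ≤ vnorm (X *ᵥ v) := by
  obtain ⟨T, hc, h1, hT⟩ := exists_net k
  refine ⟨T, hc, h1, fun X r hr hX => ?_⟩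
  have key : ∀ a : ℝ, 0 ≤ a → (∀ v ∈ T, vnorm (X *ᵥ v) ≤ a) → ‖X‖ ≤ 2 * a := by
    intro a ha h
    have : ‖X‖ ≤ a + ‖X‖ / 2 := by
      refine norm_le_of_vnorm_mulVec_le (by positivity) fun u => ?_
      obtain ⟨e, he, hue⟩ | hu : (∃ e, vnorm e = 1 ∧ u = vnorm u • e) ∨ vnorm u = 0 := by
        by_cases hu : vnorm u = 0
        · exact Or.inr hu
        · refine Or.inl ⟨(vnorm u)⁻¹ • u, ?_, ?_⟩
          · rw [vnorm_smul, abs_of_nonneg (inv_nonneg.2 (vnorm_nonneg _)), inv_mul_cancel₀ hu]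
          · rw [smul_smul, mul_inv_cancel₀ hu, one_smul]
      · obtain ⟨v, hv, hev⟩ := hT e he
        have h2 : vnorm (X *ᵥ e) ≤ a + ‖X‖ / 2 := by
          calc vnorm (X *ᵥ e) = vnorm (X *ᵥ v + X *ᵥ (e - v)) := by
                rw [← mulVec_add, add_sub_cancel]
            _ ≤ vnorm (X *ᵥ v) + vnorm (X *ᵥ (e - v)) := vnorm_add_le _ _
            _ ≤ a + ‖X‖ * (1 / 2) := add_le_add (h v hv) ((vnorm_mulVec_le _ _).trans (by gcongr))
            _ = _ := by ring
        rw [hue, mulVec_smul, vnorm_smul, abs_of_nonneg (vnorm_nonneg _), vnorm_smul,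
          abs_of_nonneg (vnorm_nonneg _), he, mul_one, mul_comm]
        exact mul_le_mul_of_nonneg_right h2 (vnorm_nonneg _)
      · have := vnorm_mulVec_le X u
        rw [hu, mul_zero] at this ⊢
        exact this
    linarith
  by_contra! hcon
  rcases T.eq_empty_or_nonempty with rfl | hne
  · have := key 0 le_rfl (by simp); linarith
  · obtain ⟨v, hv, hmax⟩ := Finset.exists_max_image T (fun v => vnorm (X *ᵥ v)) hne
    have := key _ (vnorm_nonneg _) hmax
    have := hcon v hv
    linarith

lemma card_mul_exp_le {k c : ℕ} (hc : c ≤ 5 ^ k) {t : ℝ} (ht : 0 ≤ t) :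
    (c : ENNReal) * ENNReal.ofReal (Real.exp (-(2 * √k + t) ^ 2 / 2))
      ≤ ENNReal.ofReal (Real.exp (-t ^ 2 / 2)) := by
  rw [← ENNReal.ofReal_natCast, ← ENNReal.ofReal_mul (by positivity)]
  refine ENNReal.ofReal_le_ofReal ?_
  have h5 : (5 : ℝ) ≤ Real.exp 2 := by
    have := Real.exp_one_gt_d9
    rw [show (2 : ℝ) = 1 + 1 by norm_num, Real.exp_add]
    nlinarith
  have hc' : (c : ℝ) ≤ Real.exp (2 * k) := by
    calc (c : ℝ) ≤ 5 ^ k := by exact_mod_cast hc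
      _ ≤ Real.exp 2 ^ k := by gcongr
      _ = _ := by rw [← Real.exp_nat_mul, mul_comm]
  calc (c : ℝ) * Real.exp (-(2 * √k + t) ^ 2 / 2)
      ≤ Real.exp (2 * k) * Real.exp (-(2 * √k + t) ^ 2 / 2) := by gcongr
    _ ≤ _ := by
      rw [← Real.exp_add]
      refine Real.exp_le_exp.2 ?_
      have h1 : √(k : ℝ) ^ 2 = k := Real.sq_sqrt (Nat.cast_nonneg _)
      nlinarith [mul_nonneg (Real.sqrt_nonneg (k : ℝ)) ht]

lemma frob_replicateCol (v : ρ → ℝ) : frob (replicateCol (Fin 1) v) = vnorm v := by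
  simp [frob, vnorm]

lemma norm_replicateCol_le (v : ρ → ℝ) : ‖replicateCol (Fin 1) v‖ ≤ vnorm v :=
  (norm_le_frob _).trans (frob_replicateCol v).le

/-- Operator norm tail bound by a net over the column space. -/
theorem measure_norm_mul_mul_ge_le {k : ℕ} (L : Matrix ρ ι ℝ) (R : Matrix κ (Fin k) ℝ) {F ℓ t : ℝ}
    (hF : frob L * ‖R‖ ≤ F) (hℓ : ‖L‖ * ‖R‖ ≤ ℓ) (hF0 : 0 < F) (hℓ0 : 0 < ℓ) (ht : 0 ≤ t) :
    stdGaussian ι κ {X | 2 * (F + ℓ * (2 * √k + t)) ≤ ‖L * of X * R‖}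
      ≤ ENNReal.ofReal (Real.exp (-t ^ 2 / 2)) := by
  obtain ⟨T, hc, h1, hT⟩ := exists_net_norm (ρ := ρ) k
  have hτ : 0 ≤ 2 * √(k : ℝ) + t := by positivity
  refine le_trans (measure_mono (t := ⋃ v ∈ T, {X : ι → κ → ℝ | F + ℓ * (2 * √k + t) ≤
    frob (L * of X * (R * replicateCol (Fin 1) v))}) fun X hX => ?_) ?_
  · obtain ⟨v, hv, h⟩ := hT _ _ (by positivity) hX
    simp only [Set.mem_iUnion]
    refine ⟨v, hv, ?_⟩
    rw [Set.mem_ofPred_eq, ← Matrix.mul_assoc, ← replicateCol_mulVec, frob_replicateCol]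
    exact h
  · refine (measure_biUnion_finset_le _ _).trans ?_
    refine le_trans (Finset.sum_le_card_nsmul _ _
      (ENNReal.ofReal (Real.exp (-(2 * √k + t) ^ 2 / 2))) fun v hv => ?_) ?_
    · have h3 : vnorm (R *ᵥ v) ≤ ‖R‖ := by
        simpa [h1 v hv] using vnorm_mulVec_le R v
      rw [← replicateCol_mulVec]
      refine measure_frob_mul_mul_ge_le _ _ (le_trans ?_ hF) (le_trans ?_ hℓ) hF0 hℓ0 hτ
      · rw [frob_replicateCol]; exact mul_le_mul_of_nonneg_left h3 (frob_nonneg _)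
      · exact mul_le_mul_of_nonneg_left ((norm_replicateCol_le _).trans h3) (norm_nonneg _)
    · rw [nsmul_eq_mul]
      exact card_mul_exp_le hc ht

/-- Operator norm tail bound by a net over the row space. -/
theorem measure_norm_mul_mul_ge_le' {k : ℕ} (L : Matrix (Fin k) ι ℝ) (R : Matrix κ τ ℝ) {F ℓ t : ℝ}
    (hF : ‖L‖ * frob R ≤ F) (hℓ : ‖L‖ * ‖R‖ ≤ ℓ) (hF0 : 0 < F) (hℓ0 : 0 < ℓ) (ht : 0 ≤ t) :
    stdGaussian ι κ {X | 2 * (F + ℓ * (2 * √k + t)) ≤ ‖L * of X * R‖}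
      ≤ ENNReal.ofReal (Real.exp (-t ^ 2 / 2)) := by
  obtain ⟨T, hc, h1, hT⟩ := exists_net_norm (ρ := τ) k
  have hτ : 0 ≤ 2 * √(k : ℝ) + t := by positivity
  refine le_trans (measure_mono (t := ⋃ v ∈ T, {X : ι → κ → ℝ | F + ℓ * (2 * √k + t) ≤
    frob ((Lᵀ * replicateCol (Fin 1) v)ᵀ * of X * R)}) fun X hX => ?_) ?_
  · rw [Set.mem_ofPred_eq, ← norm_transpose] at hX
    obtain ⟨v, hv, h⟩ := hT _ _ (by positivity) hX
    simp only [Set.mem_iUnion]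
    refine ⟨v, hv, ?_⟩
    rw [Set.mem_ofPred_eq, transpose_mul, transpose_transpose, Matrix.mul_assoc, Matrix.mul_assoc,
      ← Matrix.mul_assoc L, ← frob_transpose, transpose_mul, transpose_transpose,
      ← replicateCol_mulVec, frob_replicateCol]
    exact h
  · refine (measure_biUnion_finset_le _ _).trans ?_
    refine le_trans (Finset.sum_le_card_nsmul _ _
      (ENNReal.ofReal (Real.exp (-(2 * √k + t) ^ 2 / 2))) fun v hv => ?_) ?_
    · have h3 : vnorm (Lᵀ *ᵥ v) ≤ ‖L‖ := by
        simpa [h1 v hv, norm_transpose] using vnorm_mulVec_le Lᵀ v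
      rw [← replicateCol_mulVec]
      refine measure_frob_mul_mul_ge_le _ _ (le_trans ?_ hF) (le_trans ?_ hℓ) hF0 hℓ0 hτ
      · rw [frob_transpose, frob_replicateCol]
        exact mul_le_mul_of_nonneg_right h3 (frob_nonneg _)
      · rw [norm_transpose]
        exact mul_le_mul_of_nonneg_right ((norm_replicateCol_le _).trans h3) (norm_nonneg _)
    · rw [nsmul_eq_mul]
      exact card_mul_exp_le hc ht

end GaussianMatrix

section LinearEvents
open scoped Matrix.Norms.L2Operator
open ProbabilityTheory

variable {n d m : ℕ}

/-- The `d × nd` matrix selecting the `i`-th block. -/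
def blkSel (n d : ℕ) (i : Fin n) : Matrix (Fin d) (Fin n × Fin d) ℝ :=
  of fun a p => if p = (i, a) then 1 else 0

lemma blkSel_mul (W : Matrix (Fin n × Fin d) (Fin m) ℝ) (i : Fin n) :
    blkSel n d i * W = blk W i := by
  ext a b; simp [blkSel, mul_apply, blk]

lemma blkSel_isometry (i : Fin n) : (blkSel n d i)ᵀᵀ * (blkSel n d i)ᵀ = 1 := by
  ext a b; simp [blkSel, mul_apply, one_apply, eq_comm]

lemma norm_blkSel_le (i : Fin n) : ‖blkSel n d i‖ ≤ 1 := by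
  rw [← norm_transpose]; exact norm_le_one_of_isometry (blkSel_isometry i)

lemma frob_blkSel (i : Fin n) : frob (blkSel n d i) = √d := by
  rw [← frob_transpose, ← frob_sq_of_isometry (blkSel_isometry i), Real.sqrt_sq (frob_nonneg _)]

lemma frob_one_le (k : ℕ) : frob (1 : Matrix (Fin k) (Fin k) ℝ) ≤ √k := by
  rw [← frob_sq_of_isometry (U := (1 : Matrix (Fin k) (Fin k) ℝ)) (by simp),
    Real.sqrt_sq (frob_nonneg _)]

lemma norm_one_le (k : ℕ) : ‖(1 : Matrix (Fin k) (Fin k) ℝ)‖ ≤ 1 := IsOrth.one.norm_le_one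

lemma mask_transpose_mul {k : ℕ} (W : Matrix (Fin n × Fin d) (Fin m) ℝ)
    (V : Matrix (Fin n × Fin d) (Fin k) ℝ) (i : Fin n) :
    (mask W i)ᵀ * V = Wᵀ * mask V i := by
  ext a b
  simp only [mul_apply, transpose_apply, mask, of_apply, ite_mul, mul_ite, zero_mul, mul_zero]

variable {t β : ℝ}

lemma measure_norm_ge_le (hd : 1 ≤ d) (hn : 1 ≤ n) (ht : 0 ≤ t) (hβ : β = √n * (√d + t) + √m) :
    stdGaussian (Fin n × Fin d) (Fin m) {W | 4 * β < ‖of W‖}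
      ≤ ENNReal.ofReal (Real.exp (-t ^ 2 / 2)) := by
  have hn' : 1 ≤ √(n : ℝ) := Real.one_le_sqrt.2 (by exact_mod_cast hn)
  have hd' : 1 ≤ √(d : ℝ) := Real.one_le_sqrt.2 (by exact_mod_cast hd)
  have h1 : ‖(1 : Matrix (Fin n × Fin d) (Fin n × Fin d) ℝ)‖ ≤ 1 :=
    norm_le_of_vnorm_mulVec_le zero_le_one fun v => by simp
  have h2 : frob (1 : Matrix (Fin n × Fin d) (Fin n × Fin d) ℝ) ≤ √n * √d := by
    rw [frob, ← Real.sqrt_mul (Nat.cast_nonneg _)]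
    refine Real.sqrt_le_sqrt (le_of_eq ?_)
    simp [one_apply]
  refine le_trans (measure_mono fun W hW => ?_) (measure_norm_mul_mul_ge_le (k := m)
    (1 : Matrix (Fin n × Fin d) (Fin n × Fin d) ℝ) (1 : Matrix (Fin m) (Fin m) ℝ)
    (F := √n * √d) (ℓ := 1) (t := t) ?_ ?_ (by positivity) one_pos ht)
  · rw [Set.mem_ofPred_eq] at hW ⊢
    rw [Matrix.one_mul, Matrix.mul_one]
    refine le_trans ?_ hW.le
    have := mul_le_mul_of_nonneg_right hn' ht
    have : 0 ≤ √n * √d := by positivity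
    have : 0 ≤ √n * t := by positivity
    rw [hβ]; linarith
  · exact (mul_le_mul h2 (norm_one_le m) (norm_nonneg _) (by positivity)).trans (by rw [mul_one])
  · exact (mul_le_mul h1 (norm_one_le m) (norm_nonneg _) (by positivity)).trans (by rw [mul_one])

lemma measure_norm_blk_ge_le (hm : 1 ≤ m) (ht : 0 ≤ t) (i : Fin n) :
    stdGaussian (Fin n × Fin d) (Fin m) {W | 2 * √m + 4 * √d + 2 * t < ‖blk (of W) i‖}
      ≤ ENNReal.ofReal (Real.exp (-t ^ 2 / 2)) := by
  have hm' : 1 ≤ √(m : ℝ) := Real.one_le_sqrt.2 (by exact_mod_cast hm)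
  refine le_trans (measure_mono fun W hW => ?_) (measure_norm_mul_mul_ge_le' (k := d)
    (blkSel n d i) (1 : Matrix (Fin m) (Fin m) ℝ)
    (F := √m) (ℓ := 1) (t := t) ?_ ?_ (by positivity) one_pos ht)
  · rw [Set.mem_ofPred_eq] at hW ⊢
    rw [Matrix.mul_one, blkSel_mul]
    linarith
  · exact (mul_le_mul (norm_blkSel_le i) (frob_one_le m) (frob_nonneg _) zero_le_one).trans
      (by rw [one_mul])
  · exact (mul_le_mul (norm_blkSel_le i) (norm_one_le m) (norm_nonneg _) zero_le_one).trans
      (by rw [mul_one])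

lemma measure_frob_blk_ge_le (hd : 1 ≤ d) (hm : 1 ≤ m) (ht : 0 ≤ t) (i : Fin n) :
    stdGaussian (Fin n × Fin d) (Fin m) {W | √m * √d + t < frob (blk (of W) i)}
      ≤ ENNReal.ofReal (Real.exp (-t ^ 2 / 2)) := by
  have hm' : 1 ≤ √(m : ℝ) := Real.one_le_sqrt.2 (by exact_mod_cast hm)
  have hd' : 1 ≤ √(d : ℝ) := Real.one_le_sqrt.2 (by exact_mod_cast hd)
  refine le_trans (measure_mono fun W hW => ?_) (measure_frob_mul_mul_ge_le
    (blkSel n d i) (1 : Matrix (Fin m) (Fin m) ℝ)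
    (F := √m * √d) (ℓ := 1) (t := t) ?_ ?_ (by positivity) one_pos ht)
  · rw [Set.mem_ofPred_eq] at hW ⊢
    rw [Matrix.mul_one, blkSel_mul]
    linarith
  · rw [frob_blkSel, mul_comm]
    exact mul_le_mul_of_nonneg_right (frob_one_le m) (by positivity)
  · exact (mul_le_mul (norm_blkSel_le i) (norm_one_le m) (norm_nonneg _) zero_le_one).trans
      (by rw [mul_one])

lemma measure_frob_mask_ge_le (hn : 1 ≤ n) (hd : 1 ≤ d) (hm : 1 ≤ m) (ht : 0 ≤ t) (i : Fin n) :
    stdGaussian (Fin n × Fin d) (Fin m)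
      {W | √n * (√m * √d + t) < frob ((mask (of W) i)ᵀ * ZStack n d)}
      ≤ ENNReal.ofReal (Real.exp (-t ^ 2 / 2)) := by
  have hm' : 1 ≤ √(m : ℝ) := Real.one_le_sqrt.2 (by exact_mod_cast hm)
  have hd' : 1 ≤ √(d : ℝ) := Real.one_le_sqrt.2 (by exact_mod_cast hd)
  have hn' : 1 ≤ √(n : ℝ) := Real.one_le_sqrt.2 (by exact_mod_cast hn)
  have hZ : ‖(mask (ZStack n d) i)ᵀ‖ ≤ √n := by
    rw [norm_transpose]; exact (norm_mask_le _ i).trans norm_ZStack_le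
  have hZF : frob (mask (ZStack n d) i)ᵀ ≤ √n * √d := by
    rw [frob_transpose, mul_comm]
    refine (frob_le_sqrt_mul_norm _).trans ?_
    rw [Fintype.card_fin, ← norm_transpose]
    exact mul_le_mul_of_nonneg_left hZ (by positivity)
  refine le_trans (measure_mono fun W hW => ?_) (measure_frob_mul_mul_ge_le
    (mask (ZStack n d) i)ᵀ (1 : Matrix (Fin m) (Fin m) ℝ)
    (F := √n * √d * √m) (ℓ := √n) (t := t) ?_ ?_ (by positivity) (by positivity) ht)
  · rw [Set.mem_ofPred_eq] at hW ⊢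
    rw [Matrix.mul_one, ← frob_transpose, transpose_mul, transpose_transpose]
    rw [← mask_transpose_mul]
    linarith
  · exact mul_le_mul hZF (frob_one_le m) (frob_nonneg _) (by positivity)
  · exact (mul_le_mul hZ (norm_one_le m) (norm_nonneg _) (by positivity)).trans (by rw [mul_one])

end LinearEvents

section Decoupling
open ProbabilityTheory

variable {ι : Type*} [Fintype ι] {E : ι → Type*} [∀ i, MeasurableSpace (E i)]
  (ν : ∀ i, Measure (E i)) [∀ i, IsProbabilityMeasure (ν i)] (q : ι → Prop) [DecidablePred q]

/-- Resampling a subset of the coordinates of a product measure preserves it. -/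
lemma measurePreserving_resample :
    MeasurePreserving (fun (z : (∀ i, E i) × (∀ i, E i)) i => if q i then z.1 i else z.2 i)
      ((Measure.pi ν).prod (Measure.pi ν)) (Measure.pi ν) := by
  have hm : Measurable fun (z : (∀ i, E i) × (∀ i, E i)) i => if q i then z.1 i else z.2 i := by
    refine measurable_pi_lambda _ fun i => ?_
    by_cases h : q i <;> simp only [h, if_true, if_false] <;> fun_prop
  refine ⟨hm, (Measure.pi_eq fun s hs => ?_).symm⟩
  rw [Measure.map_apply hm (MeasurableSet.univ_pi hs)]
  have : (fun (z : (∀ i, E i) × (∀ i, E i)) i => if q i then z.1 i else z.2 i) ⁻¹' Set.univ.pi s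
      = (Set.univ.pi fun i => if q i then s i else Set.univ) ×ˢ
        (Set.univ.pi fun i => if q i then Set.univ else s i) := by
    ext z
    simp only [Set.mem_preimage, Set.mem_univ_pi, Set.mem_prod, ← forall_and]
    refine forall_congr' fun i => ?_
    by_cases h : q i <;> simp [h]
  rw [this, Measure.prod_prod, Measure.pi_pi, Measure.pi_pi, ← Finset.prod_mul_distrib]
  refine Finset.prod_congr rfl fun i _ => ?_
  by_cases h : q i <;> simp [h]

lemma measure_le_of_resample {B : Set (∀ i, E i)} (hB : MeasurableSet B) {p : ENNReal}
    (h : ∀ Y : ∀ i, E i, Measure.pi ν {X | (fun i => if q i then X i else Y i) ∈ B} ≤ p) :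
    Measure.pi ν B ≤ p := by
  have hmp := measurePreserving_resample ν q
  rw [← hmp.measure_preimage hB.nullMeasurableSet, Measure.prod_apply_symm (hmp.measurable hB)]
  calc _ ≤ ∫⁻ _, p ∂(Measure.pi ν) := lintegral_mono fun Y => h Y
    _ = p := by simp

lemma isClosed_exists_mem {X Y : Type*} [TopologicalSpace X] [TopologicalSpace Y] {K : Set Y}
    (hK : IsCompact K) {C : Set (X × Y)} (hC : IsClosed C) : IsClosed {x | ∃ y ∈ K, (x, y) ∈ C} := by
  have := isCompact_iff_compactSpace.1 hK
  have h := isClosedMap_fst_of_compactSpace (X := X) (Y := K)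
    ((fun z : X × K => (z.1, (z.2 : Y))) ⁻¹' C) (hC.preimage (by fun_prop))
  convert h using 1
  ext x
  simp

end Decoupling

section NonlinearEvents
open scoped Matrix.Norms.L2Operator
open ProbabilityTheory

variable {n d m : ℕ} {N : Type*} [Fintype N] [DecidableEq N]

lemma continuous_frob {α β : Type*} [Fintype α] [Fintype β] :
    Continuous (frob : Matrix α β ℝ → ℝ) := by
  unfold frob; fun_prop

lemma isClosed_isTopSingVecs :
    IsClosed {z : Matrix N (Fin m) ℝ × Matrix N (Fin d) ℝ | IsTopSingVecs z.1 z.2} := by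
  refine (isClosed_eq (by fun_prop) (by fun_prop)).and ?_
  simp only [Set.ofPred_forall]
  refine isClosed_iInter fun Q => isClosed_iInter fun _ => isClosed_le ?_ ?_ <;> fun_prop

lemma continuous_blk (i : Fin n) :
    Continuous fun X : Matrix (Fin n × Fin d) (Fin m) ℝ => blk X i :=
  continuous_matrix fun a b => by simp only [blk, of_apply]; fun_prop

lemma continuous_mask (i : Fin n) :
    Continuous fun X : Matrix (Fin n × Fin d) (Fin m) ℝ => mask X i :=
  continuous_matrix fun a b => by
    simp only [mask, of_apply]
    split_ifs <;> fun_prop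

lemma isClosed_isPolar :
    IsClosed {z : Matrix (Fin d) (Fin d) ℝ × Matrix (Fin d) (Fin d) ℝ | IsPolar z.1 z.2} := by
  have := continuous_frob (α := Fin d) (β := Fin d)
  refine (isClosed_isOrth.preimage continuous_snd).and ?_
  simp only [Set.ofPred_forall]
  refine isClosed_iInter fun Q => isClosed_iInter fun _ => isClosed_le ?_ ?_ <;> fun_prop

lemma isCompact_orthBlocks :
    IsCompact {S : Matrix (Fin n × Fin d) (Fin d) ℝ | ∀ i, IsOrth (blk S i)} := by
  refine Metric.isCompact_of_isClosed_isBounded ?_ ?_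
  · simp only [Set.ofPred_forall]
    exact isClosed_iInter fun i => isClosed_isOrth.preimage (continuous_blk i)
  · refine (Metric.isBounded_closedBall (x := (0 : Matrix (Fin n × Fin d) (Fin d) ℝ))
      (r := √(n * d))).subset fun S hS => ?_
    rw [mem_closedBall_zero_iff]
    refine (norm_le_frob S).trans (Real.le_sqrt_of_sq_le (le_of_eq ?_))
    rw [frob_sq_blk, Finset.sum_congr rfl fun i _ => frob_sq_of_isometry (hS i).1]
    simp

variable {A : Matrix (Fin d) (Fin m) ℝ} {σ β δ κ t r : ℝ}

namespace Regime
variable {W : Matrix (Fin n × Fin d) (Fin m) ℝ} {U U' : Matrix (Fin n × Fin d) (Fin d) ℝ}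

/-- The top singular vectors of the data matrix are unique up to rotation. -/
lemma exists_isOrth_eq_mul (R : Regime n A σ β δ κ) (hW : ‖W‖ ≤ 4 * β)
    (hU : IsTopSingVecs (ZStack n d * A + σ • W) U)
    (hU' : IsTopSingVecs (ZStack n d * A + σ • W) U') :
    ∃ O : Matrix (Fin d) (Fin d) ℝ, IsOrth O ∧ U' = U * O := by
  have hqs := R.qs_pos
  have h := hU.sin_theta hU' (hU.model_perp (R.noise_le hW)) (by linarith [R.qs_pos])
    (R.lower hW hU')
  rw [sub_self, Matrix.zero_mul] at h
  have h0 : frob (0 : Matrix (Fin n × Fin d) (Fin d) ℝ) = 0 := by simp [frob]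
  rw [h0] at h
  have hpos : 0 < (0.999 * (√n * sigmaMin A)) ^ 2 - (4 * δ * (√n * sigmaMin A)) ^ 2 := by
    have h1 : 0 ≤ 4 * δ * (√n * sigmaMin A) := mul_nonneg (by linarith [R.δ_pos]) hqs.le
    nlinarith [R.noise_small]
  have hf : frob (U' - U * (Uᵀ * U')) ≤ 0 := by
    by_contra! hc
    exact absurd h (not_le.2 (mul_pos hpos hc))
  have he : U' = U * (Uᵀ * U') := by
    rw [← sub_eq_zero]
    have h2 := (norm_le_frob _).trans hf
    exact norm_le_zero_iff.1 h2
  refine ⟨Uᵀ * U', ?_, he⟩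
  have h3 : (Uᵀ * U')ᵀ * (Uᵀ * U') = 1 := by
    rw [transpose_mul, transpose_transpose, Matrix.mul_assoc, ← he, hU'.1]
  exact ⟨h3, mul_eq_one_comm.1 h3⟩

end Regime

lemma mask_resample (i : Fin n) (X Y : Fin n × Fin d → Fin m → ℝ) :
    mask (of fun p => if p.1 = i then X p else Y p) i = mask (of Y) i := by
  ext p b
  simp only [mask, of_apply]
  split_ifs <;> rfl

lemma blk_resample (i : Fin n) (X Y : Fin n × Fin d → Fin m → ℝ) :
    blk (of fun p => if p.1 = i then X p else Y p) i = blk (of X) i := by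
  ext a b
  simp [blk]

/-- The event that a block of noise correlates with the leave-one-out singular vectors. -/
def blkDataEvent (A : Matrix (Fin d) (Fin m) ℝ) (σ β r : ℝ) (i : Fin n) :
    Set (Fin n × Fin d → Fin m → ℝ) :=
  {W | ‖mask (of W) i‖ ≤ 4 * β ∧ ∃ U ∈ {U : Matrix (Fin n × Fin d) (Fin d) ℝ | Uᵀ * U = 1},
    (W, U) ∈ {z : (Fin n × Fin d → Fin m → ℝ) × Matrix (Fin n × Fin d) (Fin d) ℝ |
      IsTopSingVecs (ZStack n d * A + σ • mask (of z.1) i) z.2 ∧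
      r ≤ ‖blk (of z.1) i * ((ZStack n d * A + σ • mask (of z.1) i)ᵀ * z.2)‖}}

lemma isClosed_blkDataEvent (i : Fin n) : IsClosed (blkDataEvent A σ β r i) := by
  have c1 := continuous_mask (d := d) (m := m) i
  have c2 := continuous_blk (d := d) (m := m) i
  refine (isClosed_le ?_ continuous_const).and (isClosed_exists_mem isCompact_isometry
    ((isClosed_isTopSingVecs.preimage (f := fun z : (Fin n × Fin d → Fin m → ℝ) ×
      Matrix (Fin n × Fin d) (Fin d) ℝ => (ZStack n d * A + σ • mask (of z.1) i, z.2)) ?_).and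
      (isClosed_le continuous_const ?_)))
  · exact (c1.comp continuous_id).norm
  · have : Continuous fun z : (Fin n × Fin d → Fin m → ℝ) × Matrix (Fin n × Fin d) (Fin d) ℝ =>
      mask (of z.1) i := c1.comp continuous_fst
    fun_prop
  · have h1 : Continuous fun z : (Fin n × Fin d → Fin m → ℝ) × Matrix (Fin n × Fin d) (Fin d) ℝ =>
      mask (of z.1) i := c1.comp continuous_fst
    have h2 : Continuous fun z : (Fin n × Fin d → Fin m → ℝ) × Matrix (Fin n × Fin d) (Fin d) ℝ =>
      blk (of z.1) i := c2.comp continuous_fst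
    fun_prop

lemma measure_blkDataEvent_le (R : Regime n A σ β δ κ) (ht : 0 ≤ t) (i : Fin n) :
    stdGaussian (Fin n × Fin d) (Fin m)
      (blkDataEvent A σ β (2 * (1.001 * (√n * ‖A‖) * (3 * √d + t))) i)
      ≤ ENNReal.ofReal (Real.exp (-t ^ 2 / 2)) := by
  refine measure_le_of_resample _ (fun p => p.1 = i) (isClosed_blkDataEvent i).measurableSet
    fun Y => ?_
  simp only [blkDataEvent, Set.mem_ofPred_eq, mask_resample, blk_resample]
  by_cases hY : ‖mask (of Y) i‖ ≤ 4 * β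
  swap
  · simp [hY]
  obtain ⟨U, hU⟩ := exists_isTopSingVecs (d := d) (ZStack n d * A + σ • mask (of Y) i)
    (by simpa using Nat.le_mul_of_pos_left d R.hn)
  set D := ZStack n d * A + σ • mask (of Y) i
  have hq := R.q_one
  have hy := R.y_one
  have hA : 0 < ‖A‖ := R.hs.trans_le (sigmaMin_le_norm R.hd)
  have hM : ‖Dᵀ * U‖ ≤ 1.001 * (√n * ‖A‖) := by
    have h1 : ‖Dᵀ‖ ≤ 1.001 * (√n * ‖A‖) := by
      rw [norm_transpose, R.hκ, ← mul_assoc, ← mul_assoc, mul_right_comm, mul_assoc, mul_assoc,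
        mul_comm (sigmaMin A), ← mul_assoc √(n : ℝ), mul_comm √(n : ℝ), mul_assoc κ]
      exact R.data_norm_le hY
    exact (l2_opNorm_mul _ _).trans ((mul_le_mul h1 (norm_le_one_of_isometry hU.1) (norm_nonneg _)
      (by positivity)).trans (by rw [mul_one]))
  refine le_trans (measure_mono fun X hX => ?_) (measure_norm_mul_mul_ge_le (k := d)
    (blkSel n d i) (Dᵀ * U) (F := √d * (1.001 * (√n * ‖A‖))) (ℓ := 1.001 * (√n * ‖A‖)) (t := t)
    ?_ ?_ (by positivity) (by positivity) ht)
  · obtain ⟨-, U', -, hU', hr⟩ := hX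
    obtain ⟨O, hO, rfl⟩ := R.exists_isOrth_eq_mul hY hU hU'
    rw [← Matrix.mul_assoc, ← Matrix.mul_assoc, hO.norm_mul_right] at hr
    rw [Set.mem_ofPred_eq, blkSel_mul, ← Matrix.mul_assoc]
    refine le_trans (le_of_eq ?_) hr
    ring
  · rw [frob_blkSel]; exact mul_le_mul_of_nonneg_left hM (Real.sqrt_nonneg _)
  · exact (mul_le_mul (norm_blkSel_le i) hM (norm_nonneg _) zero_le_one).trans (by rw [one_mul])

/-- The event that a block of noise correlates with the leave-one-out initialization. -/
def blkPolarEvent (A : Matrix (Fin d) (Fin m) ℝ) (σ β b r : ℝ) (i : Fin n) :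
    Set (Fin n × Fin d → Fin m → ℝ) :=
  {W | ‖mask (of W) i‖ ≤ 4 * β ∧
    ∃ y ∈ {U : Matrix (Fin n × Fin d) (Fin d) ℝ | Uᵀ * U = 1} ×ˢ
      {S : Matrix (Fin n × Fin d) (Fin d) ℝ | ∀ i, IsOrth (blk S i)},
    (W, y) ∈ {z : (Fin n × Fin d → Fin m → ℝ) ×
        Matrix (Fin n × Fin d) (Fin d) ℝ × Matrix (Fin n × Fin d) (Fin d) ℝ |
      IsTopSingVecs (ZStack n d * A + σ • mask (of z.1) i) z.2.1 ∧ IsPolarBlocks z.2.1 z.2.2 ∧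
      (∀ j, ‖√n • blk z.2.1 j - blk z.2.2 j‖ ≤ 1 / 2) ∧ frob ((mask (of z.1) i)ᵀ * z.2.2) ≤ b ∧
      r ≤ frob (blk (of z.1) i * ((mask (of z.1) i)ᵀ * z.2.2))}}

lemma isClosed_blkPolarEvent {b : ℝ} (i : Fin n) : IsClosed (blkPolarEvent A σ β b r i) := by
  have c1 := continuous_mask (d := d) (m := m) i
  have c2 := continuous_blk (d := d) (m := m) i
  have c3 := fun j => continuous_blk (n := n) (d := d) (m := d) j
  have c4 := continuous_frob (α := Fin m) (β := Fin d)
  have c5 := continuous_frob (α := Fin d) (β := Fin d)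
  have h1 : Continuous fun z : (Fin n × Fin d → Fin m → ℝ) ×
      Matrix (Fin n × Fin d) (Fin d) ℝ × Matrix (Fin n × Fin d) (Fin d) ℝ =>
    mask (of z.1) i := c1.comp continuous_fst
  have h2 : Continuous fun z : (Fin n × Fin d → Fin m → ℝ) ×
      Matrix (Fin n × Fin d) (Fin d) ℝ × Matrix (Fin n × Fin d) (Fin d) ℝ =>
    blk (of z.1) i := c2.comp continuous_fst
  refine (isClosed_le ?_ continuous_const).and (isClosed_exists_mem
    (isCompact_isometry.prod isCompact_orthBlocks)
    ((isClosed_isTopSingVecs.preimage (f := fun z : (Fin n × Fin d → Fin m → ℝ) ×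
      Matrix (Fin n × Fin d) (Fin d) ℝ × Matrix (Fin n × Fin d) (Fin d) ℝ =>
        (ZStack n d * A + σ • mask (of z.1) i, z.2.1)) ?_).and (IsClosed.and ?_ (IsClosed.and ?_
      ((isClosed_le ?_ continuous_const).and (isClosed_le continuous_const ?_))))))
  · exact (c1.comp continuous_id).norm
  · fun_prop
  · simp only [IsPolarBlocks, Set.ofPred_forall]
    exact isClosed_iInter fun j => isClosed_isPolar.preimage
      (f := fun z : (Fin n × Fin d → Fin m → ℝ) ×
        Matrix (Fin n × Fin d) (Fin d) ℝ × Matrix (Fin n × Fin d) (Fin d) ℝ =>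
        (blk z.2.1 j, blk z.2.2 j)) (by have := c3 j; fun_prop)
  · simp only [Set.ofPred_forall]
    exact isClosed_iInter fun j => isClosed_le (by have := c3 j; fun_prop) continuous_const
  · exact c4.comp (by fun_prop)
  · exact c5.comp (by fun_prop)

lemma measure_blkPolarEvent_le (R : Regime n A σ β δ κ) (ht : 0 ≤ t) {b : ℝ} (hb : 0 < b)
    (i : Fin n) :
    stdGaussian (Fin n × Fin d) (Fin m) (blkPolarEvent A σ β b ((√d + t) * b) i)
      ≤ ENNReal.ofReal (Real.exp (-t ^ 2 / 2)) := by
  refine measure_le_of_resample _ (fun p => p.1 = i) (isClosed_blkPolarEvent i).measurableSet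
    fun Y => ?_
  simp only [blkPolarEvent, Set.mem_ofPred_eq, mask_resample, blk_resample]
  have hy := R.y_one
  rcases Set.eq_empty_or_nonempty {X : Fin n × Fin d → Fin m → ℝ | ‖mask (of Y) i‖ ≤ 4 * β ∧
    ∃ y ∈ {U : Matrix (Fin n × Fin d) (Fin d) ℝ | Uᵀ * U = 1} ×ˢ
      {S : Matrix (Fin n × Fin d) (Fin d) ℝ | ∀ i, IsOrth (blk S i)},
      IsTopSingVecs (ZStack n d * A + σ • mask (of Y) i) y.1 ∧ IsPolarBlocks y.1 y.2 ∧
      (∀ j, ‖√n • blk y.1 j - blk y.2 j‖ ≤ 1 / 2) ∧ frob ((mask (of Y) i)ᵀ * y.2) ≤ b ∧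
      (√d + t) * b ≤ frob (blk (of X) i * ((mask (of Y) i)ᵀ * y.2))} with he | ⟨X₀, hX₀⟩
  · rw [he]; simp
  obtain ⟨hY, ⟨U, S⟩, -, hU, hS, hclose, hfb, -⟩ := hX₀
  refine le_trans (measure_mono fun X hX => ?_) (measure_frob_mul_mul_ge_le
    (blkSel n d i) ((mask (of Y) i)ᵀ * S) (F := √d * b) (ℓ := b) (t := t)
    ?_ ?_ (by positivity) hb ht)
  · obtain ⟨-, ⟨U', S'⟩, -, hU', hS', hclose', -, hr⟩ := hX
    simp only at hU' hS' hclose' hr hU hS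
    obtain ⟨O, hO, rfl⟩ := R.exists_isOrth_eq_mul hY hU hU'
    have hSS : S' = S * O := by
      have h := frob_blocks_lipschitz hS' (hS.mul_right hO) hclose'
      have h0 : frob (0 : Matrix (Fin n × Fin d) (Fin d) ℝ) = 0 := by simp [frob]
      rw [sub_self, h0, zero_mul, mul_zero] at h
      exact sub_eq_zero.1 (norm_le_zero_iff.1 ((norm_le_frob _).trans h))
    rw [hSS, ← Matrix.mul_assoc, ← Matrix.mul_assoc, hO.frob_mul_right] at hr
    rw [Set.mem_ofPred_eq, blkSel_mul, ← Matrix.mul_assoc]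
    refine le_trans (le_of_eq ?_) hr
    ring
  · rw [frob_blkSel]; exact mul_le_mul_of_nonneg_left hfb (Real.sqrt_nonneg _)
  · exact (mul_le_mul (norm_blkSel_le i) ((norm_le_frob _).trans hfb) (norm_nonneg _)
      zero_le_one).trans (by rw [one_mul])

end NonlinearEvents

section Assembly
open scoped Matrix.Norms.L2Operator
open ProbabilityTheory

variable {n d m : ℕ} {A : Matrix (Fin d) (Fin m) ℝ} {σ β δ κ t : ℝ}

instance : IsProbabilityMeasure (stdGaussian (Fin n × Fin d) (Fin m)) := by
  unfold stdGaussian; infer_instance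

/-- The noise matrices are good outside an event of small probability. -/
lemma measure_not_goodNoise_le (R : Regime n A σ β δ κ) (hm : 1 ≤ m)
    (hβ : β = √n * (√d + t) + √m) (ht : 0 ≤ t) :
    stdGaussian (Fin n × Fin d) (Fin m) {W | ¬ GoodNoise A (of W) σ β t}
      ≤ (6 * n : ℕ) * ENNReal.ofReal (Real.exp (-t ^ 2 / 2)) := by
  set p := ENNReal.ofReal (Real.exp (-t ^ 2 / 2))
  let E : Fin 5 → Fin n → Set (Fin n × Fin d → Fin m → ℝ) := fun k i =>
    ![{W | 2 * √m + 4 * √d + 2 * t < ‖blk (of W) i‖},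
      {W | √m * √d + t < frob (blk (of W) i)},
      {W | √n * (√m * √d + t) < frob ((mask (of W) i)ᵀ * ZStack n d)},
      blkDataEvent A σ β (2 * (1.001 * (√n * ‖A‖) * (3 * √d + t))) i,
      blkPolarEvent A σ β (crossBound n d m β t) ((√d + t) * crossBound n d m β t) i] k
  have hb : 0 < crossBound n d m β t := by
    have := R.q_one
    have := R.hβ
    rw [crossBound]
    positivity
  have hE : ∀ k i, stdGaussian (Fin n × Fin d) (Fin m) (E k i) ≤ p := by
    intro k i
    fin_cases k
    · exact measure_norm_blk_ge_le hm ht i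
    · exact measure_frob_blk_ge_le R.hd hm ht i
    · exact measure_frob_mask_ge_le R.hn R.hd hm ht i
    · exact measure_blkDataEvent_le R ht i
    · exact measure_blkPolarEvent_le R ht hb i
  have hsub : {W | ¬ GoodNoise A (of W) σ β t} ⊆
      {W : Fin n × Fin d → Fin m → ℝ | 4 * β < ‖of W‖} ∪ ⋃ i, ⋃ k, E k i := by
    intro W hW
    by_contra hcon
    simp only [Set.mem_union, Set.mem_iUnion, not_or, not_exists, Set.mem_ofPred_eq, not_lt] at hcon
    obtain ⟨h1, h⟩ := hcon
    have hmask : ∀ i, ‖mask (of W) i‖ ≤ 4 * β := fun i => (norm_mask_le _ i).trans h1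
    refine hW ⟨h1, fun i => not_lt.1 (h i 0), fun i => not_lt.1 (h i 1), fun i => not_lt.1 (h i 2),
      fun i U' hU' => ?_, fun i U' S' hU' hS' hclose hcross => ?_⟩
    · by_contra! hr
      exact h i 3 ⟨hmask i, U', hU'.1, hU', hr.le⟩
    · by_contra! hr
      exact h i 4 ⟨hmask i, (U', S'), ⟨hU'.1, fun j => (hS' j).1⟩, hU', hS', hclose, hcross, hr.le⟩
  refine (measure_mono hsub).trans ((measure_union_le _ _).trans ?_)
  calc _ ≤ p + ∑ _i : Fin n, ∑ _k : Fin 5, p := by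
        refine add_le_add (measure_norm_ge_le R.hd R.hn ht hβ) ?_
        refine (measure_iUnion_fintype_le _ _).trans (Finset.sum_le_sum fun i _ => ?_)
        exact (measure_iUnion_fintype_le _ _).trans (Finset.sum_le_sum fun k _ => hE k i)
    _ = ((1 + n * 5 : ℕ) : ENNReal) * p := by
        simp only [Finset.sum_const, Finset.card_univ, Fintype.card_fin, nsmul_eq_mul]
        push_cast
        ring
    _ ≤ _ := by
        gcongr
        have := R.hn
        lia

end Assembly

section Main
open scoped Matrix.Norms.L2Operator

theorem spectral_initialization_of_le (n d m : ℕ) (hn : 1 ≤ n) (hd : 1 ≤ d) (hdm : d ≤ m)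
    (A : Matrix (Fin d) (Fin m) ℝ) (hs : 0 < sigmaMin A) (σ γ : ℝ) (hσ : 0 < σ) (hγ : 2 ≤ γ)
    (hσc : σ ≤ 1 / 100000 * (sigmaMin A / kappa A ^ 4) * Real.sqrt (n : ℝ) /
        (Real.sqrt (d : ℝ) * bnd1 n d m γ)) :
      ENNReal.ofReal (1 - 6 * (n : ℝ) ^ (-γ + 1)) ≤
        stdGaussian (Fin n × Fin d) (Fin m) {W |
          ∀ ε ξ : ℝ, ε = 1 / (32 * kappa A ^ 2 * Real.sqrt (d : ℝ)) → ξ = 6 →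
          ∀ U S0 : Matrix (Fin n × Fin d) (Fin d) ℝ,
            IsTopSingVecs (ZStack n d * A + σ • Matrix.of W) U →
            IsPolarBlocks U S0 →
            (∃ Q, IsOrth Q ∧ ∀ i, opNorm (blk S0 i - Q) ≤
              120 * kappa A ^ 2 * σ * bnd1 n d m γ / (Real.sqrt (n : ℝ) * sigmaMin A)) ∧
            dF S0 (ZStack n d) ≤ ε * Real.sqrt ((n : ℝ) * d) / 2 ∧
            (∀ i, frob (blk (Matrix.of W) i * (Matrix.of W)ᵀ * S0) ≤
              ξ / 2 * Real.sqrt (d : ℝ) * bnd1 n d m γ ^ 2) ∧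
            (∀ (i : Fin n) (U' S' : Matrix (Fin n × Fin d) (Fin d) ℝ),
              IsTopSingVecs (ZStack n d * A + σ • mask (Matrix.of W) i) U' →
              IsPolarBlocks U' S' →
              dF S0 S' ≤ ε * Real.sqrt (d : ℝ))} := by
  rcases Nat.lt_or_ge n 2 with h1 | hn2
  · obtain rfl : n = 1 := by lia
    rw [ENNReal.ofReal_of_nonpos (by norm_num)]
    exact zero_le
  have hn0 : (0 : ℝ) < n := by exact_mod_cast hn
  have hlog : 0 ≤ Real.log n := Real.log_nonneg (by exact_mod_cast hn)
  set t := √(2 * γ * Real.log n) with ht_def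
  have ht : 0 ≤ t := Real.sqrt_nonneg _
  have hnd : √((n : ℝ) * d) = √n * √d := Real.sqrt_mul hn0.le _
  have hβ : bnd1 n d m γ = √n * (√d + t) + √m := by
    have : √(2 * γ * n * Real.log n) = √n * t := by
      rw [← Real.sqrt_mul hn0.le]; congr 1; ring
    rw [bnd1, this, hnd]; ring
  have hq : 1 ≤ √(n : ℝ) := Real.one_le_sqrt.2 (by exact_mod_cast hn)
  have hy : 1 ≤ √(d : ℝ) := Real.one_le_sqrt.2 (by exact_mod_cast hd)
  set β := bnd1 n d m γ
  have hβ0 : 0 < β := by rw [hβ]; positivity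
  have hκ : ‖A‖ = kappa A * sigmaMin A := by
    rw [kappa, opNorm_eq_norm, div_mul_cancel₀ _ hs.ne']
  set κ := kappa A
  have hκ0 : 0 < κ := by
    have := hs.trans_le (sigmaMin_le_norm (A := A) hd)
    rw [hκ] at this
    exact pos_of_mul_pos_left this hs.le
  have hqs : 0 < √n * sigmaMin A := by positivity
  have R : Regime n A σ β (σ * β / (√n * sigmaMin A)) κ := by
    refine ⟨hn, hd, hs, hσ, hβ0, hκ, by field_simp, ?_⟩
    rw [le_div_iff₀ (by positivity)] at hσc
    rw [div_mul_eq_mul_div, div_mul_eq_mul_div, div_le_iff₀ hqs]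
    calc σ * β * κ ^ 4 * √d = σ * (√d * β) * κ ^ 4 := by ring
      _ ≤ 1 / 100000 * (sigmaMin A / κ ^ 4) * √n * κ ^ 4 := by gcongr
      _ = _ := by field_simp
  have hbad := measure_not_goodNoise_le R (hd.trans hdm) hβ ht
  have hexp : Real.exp (-t ^ 2 / 2) = (n : ℝ) ^ (-γ) := by
    rw [ht_def, Real.sq_sqrt (by positivity), Real.rpow_def_of_pos hn0]
    congr 1; ring
  rw [hexp, ← ENNReal.ofReal_natCast, ← ENNReal.ofReal_mul (by positivity)] at hbad
  have hpow : ((6 * n : ℕ) : ℝ) * (n : ℝ) ^ (-γ) = 6 * (n : ℝ) ^ (-γ + 1) := by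
    rw [Real.rpow_add_one hn0.ne']; push_cast; ring
  rw [hpow] at hbad
  rw [ENNReal.ofReal_sub _ (by positivity), ENNReal.ofReal_one, tsub_le_iff_right]
  rw [← measure_univ (μ := stdGaussian (Fin n × Fin d) (Fin m))]
  refine le_trans (measure_mono ?_) ((measure_union_le _ _).trans (add_le_add_right hbad _))
  intro W _
  refine or_iff_not_imp_right.2 fun hG => ?_
  have G : GoodNoise A (of W) σ β t := not_not.1 hG
  rintro ε ξ rfl rfl U S hU hS
  obtain ⟨⟨Q, hQ, h1⟩, h2, h3, h4⟩ := R.conclusion G hβ ht hn2 hdm hU hS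
  refine ⟨⟨Q, hQ, fun i => (h1 i).trans (le_of_eq (by ring))⟩, by rwa [hnd], fun i => ?_, h4⟩
  exact (h3 i).trans (le_of_eq (by ring))

end Main

/-- Lemma 5.6, Initialization: properties of the spectral initialization
S⁰ = P_n(U), including closeness to Z and to the leave-one-out initializations S^{i,0}. -/
theorem spectral_initialization :
    ∃ c C : ℝ, 0 < c ∧ 0 < C ∧
      ∀ (n d m : ℕ), 1 ≤ n → 1 ≤ d → d ≤ m →
      ∀ A : Matrix (Fin d) (Fin m) ℝ, 0 < sigmaMin A →
      ∀ σ γ : ℝ, 0 < σ → 2 ≤ γ →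
      σ ≤ c * (sigmaMin A / kappa A ^ 4) * Real.sqrt (n : ℝ) /
        (Real.sqrt (d : ℝ) * bnd1 n d m γ) →
      ENNReal.ofReal (1 - C * (n : ℝ) ^ (-γ + 1)) ≤
        stdGaussian (Fin n × Fin d) (Fin m) {W |
          ∀ ε ξ : ℝ, ε = 1 / (32 * kappa A ^ 2 * Real.sqrt (d : ℝ)) → ξ = 6 →
          ∀ U S0 : Matrix (Fin n × Fin d) (Fin d) ℝ,
            IsTopSingVecs (ZStack n d * A + σ • Matrix.of W) U →
            IsPolarBlocks U S0 →
            (∃ Q, IsOrth Q ∧ ∀ i, opNorm (blk S0 i - Q) ≤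
              120 * kappa A ^ 2 * σ * bnd1 n d m γ / (Real.sqrt (n : ℝ) * sigmaMin A)) ∧
            dF S0 (ZStack n d) ≤ ε * Real.sqrt ((n : ℝ) * d) / 2 ∧
            (∀ i, frob (blk (Matrix.of W) i * (Matrix.of W)ᵀ * S0) ≤
              ξ / 2 * Real.sqrt (d : ℝ) * bnd1 n d m γ ^ 2) ∧
            (∀ (i : Fin n) (U' S' : Matrix (Fin n × Fin d) (Fin d) ℝ),
              IsTopSingVecs (ZStack n d * A + σ • mask (Matrix.of W) i) U' →
              IsPolarBlocks U' S' →
              dF S0 S' ≤ ε * Real.sqrt (d : ℝ))} :=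
  ⟨1 / 100000, 6, by norm_num, by norm_num, spectral_initialization_of_le⟩

end GOPP
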